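/- Let $n\ge 2$ and suppose $2\le q\le 2(n+1)/(n-1)$, $\gamma_1 < \frac{n-1}{2}-\frac{n}{q}$, and $\gamma_2=\gamma_1-\frac{n-1}{2}+\frac{n+1}{q}$. Then there is a constant $C$ (depending on $n,q,\gamma_1,\gamma_2$) such that for every smooth function $w:\mathbb{R}\times\mathbb{R}^n\to\mathbb{C}$ whose support is contained in the forward light cone $\{(t,x): t\ge |x|\}$ one has $\big\| (t^2-|x|^2)^{\gamma_1} w \big\|_{L^q(\Lambda)} \le C\, \big\| (t^2-|x|^2)^{\gamma_2}\,(\partial_t^2 w-\Delta_x w) \big\|_{L^{q'}(\Lambda)}$, where $\Lambda=\{(t,x): t>|x|\}$, $1/q+1/q'=1$, and $\Delta_x=\sum_{j=1}^n \partial_{x_j}^2$ is the spatial Laplacian (the inequality being interpreted in $[0,\infty]$, so it holds trivially when the right-hand side is infinite). -/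

import Mathlib

open MeasureTheory ENNReal

set_option linter.unusedSectionVars false

namespace LightCone

open Set Filter Topology
open scoped InnerProductSpace

section Geometry

variable {V : Type*} [NormedAddCommGroup V] [InnerProductSpace ℝ V]

/-- The component of `p` orthogonal to `e`. -/
def sp (e p : V) : V := p - ⟪e, p⟫_ℝ • e

/-- The Lorentz form with time direction `e`. -/
def lor (e p r : V) : ℝ := 2 * ⟪e, p⟫_ℝ * ⟪e, r⟫_ℝ - ⟪p, r⟫_ℝ

/-- The Euclidean reflection fixing `e`, so that `lor e p r = ⟪p, refl e r⟫`. -/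
def refl (e p : V) : V := (2 * ⟪e, p⟫_ℝ) • e - p

/-- The open forward light cone with axis `e`. -/
def cone (e : V) : Set V := {p | ‖sp e p‖ < ⟪e, p⟫_ℝ}

/-- The closed forward light cone with axis `e`. -/
def ccone (e : V) : Set V := {p | ‖sp e p‖ ≤ ⟪e, p⟫_ℝ}

/-- The Lorentz form of `ω + i η` with itself. -/
noncomputable def clor (e ω η : V) : ℂ :=
  ((lor e ω ω - lor e η η : ℝ) : ℂ) + (2 * lor e ω η : ℝ) * Complex.I

lemma lor_comm (e p r : V) : lor e p r = lor e r p := by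
  simp only [lor, real_inner_comm p r]; ring

lemma lor_eq_inner_refl (e p r : V) : lor e p r = ⟪p, refl e r⟫_ℝ := by
  simp only [lor, refl, inner_sub_right, inner_smul_right, real_inner_comm e p]; ring

lemma lor_add_left (e p p' r : V) : lor e (p + p') r = lor e p r + lor e p' r := by
  simp only [lor, inner_add_left, inner_add_right]; ring

lemma lor_add_right (e p r r' : V) : lor e p (r + r') = lor e p r + lor e p r' := by
  simp only [lor, inner_add_right]; ring

lemma lor_sub_left (e p p' r : V) : lor e (p - p') r = lor e p r - lor e p' r := by
  simp only [lor, inner_sub_left, inner_sub_right]; ring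

lemma lor_sub_right (e p r r' : V) : lor e p (r - r') = lor e p r - lor e p r' := by
  simp only [lor, inner_sub_right]; ring

lemma lor_smul_left (e : V) (a : ℝ) (p r : V) : lor e (a • p) r = a * lor e p r := by
  simp only [lor, inner_smul_left, inner_smul_right, RCLike.conj_to_real]; ring

lemma lor_smul_right (e : V) (a : ℝ) (p r : V) : lor e p (a • r) = a * lor e p r := by
  simp only [lor, inner_smul_right]; ring

lemma sp_add (e p r : V) : sp e (p + r) = sp e p + sp e r := by
  simp only [sp, inner_add_right, add_smul]; abel

lemma sp_smul (e : V) (a : ℝ) (p : V) : sp e (a • p) = a • sp e p := by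
  simp only [sp, inner_smul_right, smul_sub, smul_smul]

@[fun_prop]
lemma continuous_sp (e : V) : Continuous (sp e) := by unfold sp; fun_prop

lemma continuous_lor (e : V) : Continuous fun p : V => lor e p p := by unfold lor; fun_prop

lemma isOpen_cone (e : V) : IsOpen (cone e) :=
  isOpen_lt (by fun_prop) (by fun_prop)

lemma isClosed_ccone (e : V) : IsClosed (ccone e) :=
  isClosed_le (by fun_prop) (by fun_prop)

lemma cone_subset_ccone (e : V) : cone e ⊆ ccone e := fun p (h : ‖sp e p‖ < _) => h.le

lemma add_mem_cone {e p r : V} (hp : p ∈ ccone e) (hr : r ∈ cone e) : p + r ∈ cone e := by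
  simp only [cone, ccone, mem_ofPred_eq, sp_add, inner_add_right] at *
  linarith [norm_add_le (sp e p) (sp e r)]

lemma add_mem_ccone {e p r : V} (hp : p ∈ ccone e) (hr : r ∈ ccone e) : p + r ∈ ccone e := by
  simp only [ccone, mem_ofPred_eq, sp_add, inner_add_right] at *
  linarith [norm_add_le (sp e p) (sp e r)]

lemma smul_mem_cone {e p : V} {a : ℝ} (ha : 0 < a) (hp : p ∈ cone e) : a • p ∈ cone e := by
  simp only [cone, mem_ofPred_eq, sp_smul, inner_smul_right, norm_smul, Real.norm_eq_abs,
    abs_of_pos ha] at *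
  exact mul_lt_mul_of_pos_left hp ha

variable {e : V} (he : ‖e‖ = 1)
include he

lemma inner_self_axis : ⟪e, e⟫_ℝ = 1 := by simp [he]

lemma inner_eq_sp (p r : V) : ⟪p, r⟫_ℝ = ⟪e, p⟫_ℝ * ⟪e, r⟫_ℝ + ⟪sp e p, sp e r⟫_ℝ := by
  simp only [sp, inner_sub_right, inner_smul_right, inner_sub_left, inner_smul_left,
    inner_self_axis he, RCLike.conj_to_real, real_inner_comm e p]
  ring

lemma lor_eq_sp (p r : V) : lor e p r = ⟪e, p⟫_ℝ * ⟪e, r⟫_ℝ - ⟪sp e p, sp e r⟫_ℝ := by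
  rw [lor, inner_eq_sp he p r]; ring

lemma lor_self_eq_sp (p : V) : lor e p p = ⟪e, p⟫_ℝ ^ 2 - ‖sp e p‖ ^ 2 := by
  rw [lor_eq_sp he, real_inner_self_eq_norm_sq]; ring

lemma norm_sq_eq_sp (p : V) : ‖p‖ ^ 2 = ⟪e, p⟫_ℝ ^ 2 + ‖sp e p‖ ^ 2 := by
  rw [← real_inner_self_eq_norm_sq, inner_eq_sp he, real_inner_self_eq_norm_sq]; ring

lemma lor_axis (p : V) : lor e e p = ⟪e, p⟫_ℝ := by
  simp [lor, he]; ring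

lemma refl_refl (p : V) : refl e (refl e p) = p := by
  simp only [refl, inner_sub_right, inner_smul_right, inner_self_axis he]
  module

lemma axis_mem_cone : e ∈ cone e := by
  simp [cone, sp, he]

lemma lor_self_axis : lor e e e = 1 := by rw [lor_axis he, inner_self_axis he]

lemma inner_refl (p : V) : ⟪e, refl e p⟫_ℝ = ⟪e, p⟫_ℝ := by
  simp only [refl, inner_sub_right, inner_smul_right, inner_self_axis he]; ring

lemma lor_refl_left (p r : V) : lor e (refl e p) r = ⟪p, r⟫_ℝ := by
  rw [lor_comm, lor_eq_inner_refl, refl_refl he, real_inner_comm]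

lemma lor_refl_refl (p r : V) : lor e (refl e p) (refl e r) = lor e p r := by
  rw [lor_refl_left he, lor_eq_inner_refl]

lemma sp_refl (p : V) : sp e (refl e p) = - sp e p := by
  rw [sp, inner_refl he, refl, sp]; module

lemma refl_mem_cone {p : V} (hp : p ∈ cone e) : refl e p ∈ cone e := by
  simpa [cone, sp_refl he, inner_refl he] using hp

lemma lor_pos {p : V} (hp : p ∈ cone e) : 0 < lor e p p := by
  have h : ‖sp e p‖ < ⟪e, p⟫_ℝ := hp
  rw [lor_self_eq_sp he]
  nlinarith [norm_nonneg (sp e p)]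

lemma mem_cone_iff {p : V} : p ∈ cone e ↔ 0 < ⟪e, p⟫_ℝ ∧ 0 < lor e p p := by
  refine ⟨fun h => ⟨(norm_nonneg _).trans_lt h, lor_pos he h⟩, fun ⟨h1, h2⟩ => ?_⟩
  rw [lor_self_eq_sp he] at h2
  exact lt_of_pow_lt_pow_left₀ 2 h1.le (by linarith)

lemma mem_ccone_iff {p : V} : p ∈ ccone e ↔ 0 ≤ ⟪e, p⟫_ℝ ∧ 0 ≤ lor e p p := by
  rw [lor_self_eq_sp he]
  refine ⟨fun h => ⟨(norm_nonneg _).trans h, ?_⟩, fun ⟨h1, h2⟩ => ?_⟩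
  · have h : ‖sp e p‖ ≤ ⟪e, p⟫_ℝ := h
    nlinarith [norm_nonneg (sp e p)]
  · exact le_of_sq_le_sq (by linarith) h1

lemma lor_pos_of_mem {ω p : V} (hω : ω ∈ cone e) (hp : p ∈ cone e) : 0 < lor e ω p := by
  rw [lor_eq_sp he]
  have h1 : ‖sp e ω‖ < ⟪e, ω⟫_ℝ := hω
  have h2 : ‖sp e p‖ < ⟪e, p⟫_ℝ := hp
  have := real_inner_le_norm (sp e ω) (sp e p)
  nlinarith [norm_nonneg (sp e ω), norm_nonneg (sp e p)]

lemma exists_pos_le_inner {ω : V} (hω : ω ∈ cone e) :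
    ∃ δ > 0, ∀ p ∈ ccone e, δ * ‖p‖ ≤ ⟪ω, p⟫_ℝ := by
  have h1 : ‖sp e ω‖ < ⟪e, ω⟫_ℝ := hω
  refine ⟨(⟪e, ω⟫_ℝ - ‖sp e ω‖) / 2, by linarith, fun p hp => ?_⟩
  have h2 : ‖sp e p‖ ≤ ⟪e, p⟫_ℝ := hp
  have h3 : ‖p‖ ≤ 2 * ⟪e, p⟫_ℝ := by
    refine le_of_sq_le_sq ?_ (by linarith [norm_nonneg (sp e p)])
    rw [norm_sq_eq_sp he]
    nlinarith [norm_nonneg (sp e p)]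
  rw [inner_eq_sp he ω p]
  have := neg_le_of_abs_le (abs_real_inner_le_norm (sp e ω) (sp e p))
  nlinarith [norm_nonneg (sp e ω), norm_nonneg (sp e p)]

lemma lor_nonpos_of_lor_eq_zero {ω k : V} (hω : ω ∈ cone e) (hk : lor e ω k = 0) :
    lor e k k ≤ 0 := by
  have h1 : ‖sp e ω‖ < ⟪e, ω⟫_ℝ := hω
  rw [lor_eq_sp he] at hk
  rw [lor_self_eq_sp he]
  have h3 := abs_real_inner_le_norm (sp e ω) (sp e k)
  have h4 : ⟪e, ω⟫_ℝ * |⟪e, k⟫_ℝ| ≤ ‖sp e ω‖ * ‖sp e k‖ := by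
    rw [← abs_of_pos ((norm_nonneg _).trans_lt h1), ← abs_mul]
    rwa [sub_eq_zero.1 hk]
  have h5 : |⟪e, k⟫_ℝ| ≤ ‖sp e k‖ := by
    by_contra! h
    nlinarith [norm_nonneg (sp e ω), norm_nonneg (sp e k)]
  have := sq_le_sq' (by linarith [abs_nonneg ⟪e, k⟫_ℝ, norm_nonneg (sp e k)]) h5
  rw [sq_abs] at this
  linarith

/-- Reversed Cauchy–Schwarz inequality. -/
lemma lor_mul_le_sq {ω : V} (hω : ω ∈ cone e) (η : V) :
    lor e ω ω * lor e η η ≤ lor e ω η ^ 2 := by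
  have hp := lor_pos he hω
  have h0 : lor e ω (η - (lor e ω η / lor e ω ω) • ω) = 0 := by
    rw [lor_sub_right, lor_smul_right]; field_simp; ring
  have h := lor_nonpos_of_lor_eq_zero he hω h0
  rw [lor_sub_left, lor_smul_left, h0, lor_sub_right, lor_smul_right, lor_comm e η ω] at h
  field_simp at h
  linarith

lemma clor_re (ω η : V) : (clor e ω η).re = lor e ω ω - lor e η η := by simp [clor]

lemma clor_im (ω η : V) : (clor e ω η).im = 2 * lor e ω η := by simp [clor]

lemma clor_mem_slitPlane {ω : V} (hω : ω ∈ cone e) (η : V) :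
    clor e ω η ∈ Complex.slitPlane := by
  rw [Complex.mem_slitPlane_iff, clor_re he, clor_im he]
  by_cases h : lor e ω η = 0
  · left
    linarith [lor_nonpos_of_lor_eq_zero he hω h, lor_pos he hω]
  · right; simpa using h

lemma lor_le_norm_clor {ω : V} (hω : ω ∈ cone e) (η : V) :
    lor e ω ω ≤ ‖clor e ω η‖ := by
  refine le_of_sq_le_sq ?_ (norm_nonneg _)
  rw [← Complex.normSq_eq_norm_sq, Complex.normSq_apply, clor_re he, clor_im he]
  have h1 := lor_mul_le_sq he hω η
  have h2 := lor_pos he hω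
  rcases le_total 0 (lor e η η) with h | h <;> nlinarith

lemma clor_ne_zero {ω : V} (hω : ω ∈ cone e) (η : V) : clor e ω η ≠ 0 :=
  Complex.slitPlane_ne_zero (clor_mem_slitPlane he hω η)

end Geometry

lemma exp_abs_add_abs_le (x y : ℝ) :
    Real.exp (|x| + |y|) ≤
      Real.exp (2 * x) + Real.exp (-(2 * x)) + Real.exp (2 * y) + Real.exp (-(2 * y)) := by
  have key : ∀ t : ℝ, Real.exp (2 * |t|) ≤ Real.exp (2 * t) + Real.exp (-(2 * t)) := fun t => by
    rcases abs_cases t with ⟨h, _⟩ | ⟨h, _⟩ <;> rw [h]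
    · linarith [Real.exp_pos (-(2 * t))]
    · rw [mul_neg]; linarith [Real.exp_pos (2 * t)]
  have : Real.exp (|x| + |y|) ≤ Real.exp (2 * |x|) + Real.exp (2 * |y|) := by
    rcases le_total |x| |y| with h | h
    · have := Real.exp_le_exp.2 (show |x| + |y| ≤ 2 * |y| by linarith)
      linarith [Real.exp_pos (2 * |x|)]
    · have := Real.exp_le_exp.2 (show |x| + |y| ≤ 2 * |x| by linarith)
      linarith [Real.exp_pos (2 * |y|)]
  linarith [key x, key y]

/-- An integral depending on `z` through `cexp (z * L)` is holomorphic in `z`. -/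
lemma differentiableAt_integral_cexp {α : Type*} [MeasurableSpace α] {μ : Measure α}
    {L h : α → ℂ} (hL : AEStronglyMeasurable L μ) {z₀ : ℂ} {r : ℝ} (hr : 0 < r)
    (hh : AEStronglyMeasurable h μ)
    (hintg : ∀ z, ‖z - z₀‖ ≤ 4 * r → Integrable (fun a => Complex.exp (z * L a) * h a) μ) :
    DifferentiableAt ℂ (fun z => ∫ a, Complex.exp (z * L a) * h a ∂μ) z₀ := by
  have hm : ∀ z, AEStronglyMeasurable (fun a => Complex.exp (z * L a) * h a) μ := fun z =>
    (Complex.continuous_exp.comp_aestronglyMeasurable (hL.const_mul z)).mul hh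
  have hI : ∀ w : ℂ, ‖w‖ = 4 * r → Integrable (fun a =>
      ‖Complex.exp ((z₀ + w) * L a) * h a‖) μ := fun w hw => (hintg _ (by simp [hw])).norm
  have hb := ((((hI (4 * r) (by simp [abs_of_pos hr])).add
    (hI (-(4 * r)) (by simp [abs_of_pos hr]))).add
    (hI (-(4 * r * Complex.I)) (by simp [abs_of_pos hr]))).add
    (hI (4 * r * Complex.I) (by simp [abs_of_pos hr]))).const_mul (1 / r)
  refine (hasDerivAt_integral_of_dominated_loc_of_deriv_le (s := Metric.ball z₀ r)
    (F' := fun z a => L a * Complex.exp (z * L a) * h a) (Metric.ball_mem_nhds z₀ hr)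
    (Eventually.of_forall hm) (hintg z₀ (by simp; positivity)) ?_ ?_ hb ?_).2.differentiableAt
  · simp_rw [mul_assoc]; exact hL.mul (hm z₀)
  · refine Eventually.of_forall fun a z hz => ?_
    have hz' : ‖z - z₀‖ < r := by simpa [dist_eq_norm] using hz
    simp only [Pi.add_apply, norm_mul, Complex.norm_exp]
    have e1 : (z * L a).re ≤ (z₀ * L a).re + r * ‖L a‖ := by
      have : z * L a = z₀ * L a + (z - z₀) * L a := by ring
      rw [this, Complex.add_re]
      gcongr
      exact (Complex.re_le_norm _).trans (by rw [norm_mul]; gcongr)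
    have e2 : r * ‖L a‖ ≤ Real.exp (r * ‖L a‖) := by linarith [Real.add_one_le_exp (r * ‖L a‖)]
    have e3 : Real.exp (2 * (r * ‖L a‖)) ≤ Real.exp (|2 * r * (L a).re| + |2 * r * (L a).im|) := by
      rw [Real.exp_le_exp, abs_mul (2 * r), abs_mul (2 * r), abs_of_pos (by positivity : 0 < 2 * r)]
      nlinarith [Complex.norm_le_abs_re_add_abs_im (L a)]
    have e4 := exp_abs_add_abs_le (2 * r * (L a).re) (2 * r * (L a).im)
    have e5 : ‖L a‖ * Real.exp (z * L a).re ≤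
        1 / r * (Real.exp (z₀ * L a).re * Real.exp (2 * (r * ‖L a‖))) := by
      calc ‖L a‖ * Real.exp (z * L a).re
          = 1 / r * ((r * ‖L a‖) * Real.exp (z * L a).re) := by field_simp
        _ ≤ 1 / r * (Real.exp (r * ‖L a‖) * Real.exp ((z₀ * L a).re + r * ‖L a‖)) := by gcongr
        _ = _ := by rw [← Real.exp_add, ← Real.exp_add]; ring_nf
    calc _ ≤ 1 / r * (Real.exp (z₀ * L a).re * (Real.exp (2 * (2 * r * (L a).re)) +
          Real.exp (-(2 * (2 * r * (L a).re))) + Real.exp (2 * (2 * r * (L a).im))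
            + Real.exp (-(2 * (2 * r * (L a).im))))) * ‖h a‖ := by
          refine mul_le_mul_of_nonneg_right (e5.trans ?_) (norm_nonneg _)
          gcongr
          exact e3.trans e4
      _ = _ := by
          simp only [add_mul, neg_mul, Complex.add_re, Complex.neg_re, Complex.mul_re,
            Complex.mul_im, Complex.I_re, Complex.I_im, Complex.ofReal_re, Complex.ofReal_im,
            Complex.re_ofNat, Complex.im_ofNat, Real.exp_add, mul_add, mul_zero, zero_mul,
            sub_zero, add_zero, mul_one, zero_sub, neg_neg]
          ring_nf
  · refine Eventually.of_forall fun a z _ => ?_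
    have := (((hasDerivAt_id z).mul_const (L a)).cexp).mul_const (h a)
    simpa [mul_comm] using this

section Laplace

variable {V : Type*} [NormedAddCommGroup V] [InnerProductSpace ℝ V] [FiniteDimensional ℝ V]
  [MeasurableSpace V] [BorelSpace V] {e : V}

lemma one_add_pow_mul_exp_le {δ : ℝ} (hδ : 0 < δ) (k : ℕ) {r : ℝ} (hr : 0 ≤ r) :
    (1 + r) ^ k * Real.exp (-(δ * r)) ≤ k.factorial * Real.exp δ / δ ^ k := by
  have := Real.pow_div_factorial_le_exp (δ * (1 + r)) (by positivity) k
  rw [div_le_iff₀ (by positivity), mul_pow, mul_add, mul_one, Real.exp_add] at this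
  rw [le_div_iff₀ (by positivity), Real.exp_neg, mul_right_comm, ← div_eq_mul_inv,
    div_le_iff₀ (Real.exp_pos _)]
  linarith

lemma integrable_pow_mul_exp_neg_norm {δ : ℝ} (hδ : 0 < δ) (k : ℕ) :
    Integrable (fun p : V => (1 + ‖p‖) ^ k * Real.exp (-(δ * ‖p‖))) := by
  have h1 := (integrable_one_add_norm (E := V) (μ := volume)
    (r := (Module.finrank ℝ V + 1 : ℕ)) (by simp))
  refine (h1.const_mul ((k + (Module.finrank ℝ V + 1)).factorial * Real.exp δ /
    δ ^ (k + (Module.finrank ℝ V + 1)))).mono' (by fun_prop) (Eventually.of_forall fun p => ?_)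
  rw [Real.norm_of_nonneg (by positivity), Real.rpow_neg (by positivity), Real.rpow_natCast]
  have := one_add_pow_mul_exp_le hδ (k + (Module.finrank ℝ V + 1)) (norm_nonneg p)
  rw [← div_eq_mul_inv, le_div_iff₀ (by positivity)]
  rw [pow_add] at this
  linarith

lemma measurableSet_cone (e : V) : MeasurableSet (cone e) := (isOpen_cone e).measurableSet

variable (he : ‖e‖ = 1)
include he

lemma lor_self_le_norm_sq (p : V) : lor e p p ≤ ‖p‖ ^ 2 := by
  rw [lor_self_eq_sp he p, norm_sq_eq_sp he p]; nlinarith [sq_nonneg ‖sp e p‖]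

lemma integrableOn_cone_pow {ω : V} (hω : ω ∈ cone e) (k : ℕ) :
    IntegrableOn (fun p => (1 + ‖p‖) ^ k * Real.exp (-⟪ω, p⟫_ℝ)) (cone e) := by
  obtain ⟨δ, hδ, h⟩ := exists_pos_le_inner he hω
  refine (integrable_pow_mul_exp_neg_norm hδ k).integrableOn.mono' (by fun_prop) ?_
  filter_upwards [ae_restrict_mem (measurableSet_cone e)] with p hp
  rw [Real.norm_of_nonneg (by positivity)]
  gcongr
  exact h p (cone_subset_ccone e hp)

lemma lor_rpow_le {p : V} (hp : p ∈ cone e) {a : ℝ} (ha : 0 ≤ a) {k : ℕ} (hk : 2 * a ≤ k) :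
    lor e p p ^ a ≤ (1 + ‖p‖) ^ k := by
  calc lor e p p ^ a ≤ ((1 + ‖p‖) ^ 2) ^ a := by
        refine Real.rpow_le_rpow (lor_pos he hp).le ?_ ha
        nlinarith [lor_self_le_norm_sq he p, norm_nonneg p]
    _ = (1 + ‖p‖) ^ (2 * a) := by
        rw [← Real.rpow_natCast, ← Real.rpow_mul (by positivity)]; norm_num
    _ ≤ (1 + ‖p‖) ^ (k : ℝ) := Real.rpow_le_rpow_of_exponent_le (by simp) hk
    _ = _ := Real.rpow_natCast _ _

lemma integrableOn_cone_exp {ω : V} (hω : ω ∈ cone e) {z : ℂ} (hz : 0 ≤ z.re) {f : V → ℂ}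
    (hf : AEStronglyMeasurable f (volume.restrict (cone e)))
    (hb : ∀ p, ‖f p‖ ≤ Real.exp (-⟪ω, p⟫_ℝ)) :
    IntegrableOn (fun p => f p * (lor e p p : ℂ) ^ z) (cone e) := by
  obtain ⟨k, hk⟩ := exists_nat_ge (2 * z.re)
  refine (integrableOn_cone_pow he hω k).mono' ?_ ?_
  · refine hf.mul (Measurable.aestronglyMeasurable ?_)
    exact (Complex.measurable_ofReal.comp (continuous_lor e).measurable).pow_const z
  filter_upwards [ae_restrict_mem (measurableSet_cone e)] with p hp
  rw [norm_mul, Complex.norm_cpow_eq_rpow_re_of_pos (lor_pos he hp), mul_comm]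
  gcongr
  · exact lor_rpow_le he hp hz hk
  · exact hb p

end Laplace

open scoped Pointwise

section Laplace

variable {V : Type*} [NormedAddCommGroup V] [InnerProductSpace ℝ V] [FiniteDimensional ℝ V]
  [MeasurableSpace V] [BorelSpace V] {e : V}

/-- The Laplace transform of `lor e p p ^ z` on the cone, at the axis `e`. -/
noncomputable def coneGamma (e : V) (z : ℂ) : ℂ :=
  ∫ p in cone e, Complex.exp (-(⟪e, p⟫_ℝ : ℂ)) * (lor e p p : ℂ) ^ z

/-- Reflection with respect to the Lorentz form. -/
noncomputable def lorRefl (e k : V) : V →ₗ[ℝ] V where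
  toFun p := p - (2 * lor e p k / lor e k k) • k
  map_add' p r := by
    simp only [lor_add_left, mul_add, add_div, add_smul]; abel
  map_smul' a p := by
    simp only [lor_smul_left, smul_sub, smul_smul, RingHom.id_apply]
    congr 2; ring

lemma lorRefl_apply (e k p : V) : lorRefl e k p = p - (2 * lor e p k / lor e k k) • k := rfl

lemma lor_lorRefl {e k : V} (hk : lor e k k ≠ 0) (p r : V) :
    lor e (lorRefl e k p) (lorRefl e k r) = lor e p r := by
  simp only [lorRefl_apply, lor_sub_left, lor_sub_right, lor_smul_left, lor_smul_right,
    lor_comm e k]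
  field_simp; ring

lemma lorRefl_lorRefl {e k : V} (hk : lor e k k ≠ 0) (p : V) :
    lorRefl e k (lorRefl e k p) = p := by
  have : 2 * lor e (p - (2 * lor e p k / lor e k k) • k) k / lor e k k
      = - (2 * lor e p k / lor e k k) := by
    rw [lor_sub_left, lor_smul_left]; field_simp; ring
  rw [lorRefl_apply e k (lorRefl e k p), lorRefl_apply, this]; module

lemma measurePreserving_lorRefl {e k : V} (hk : lor e k k ≠ 0) :
    MeasurePreserving (lorRefl e k : V → V) volume volume := by
  have h1 : LinearMap.det (lorRefl e k) * LinearMap.det (lorRefl e k) = 1 := by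
    rw [← LinearMap.det_comp]
    convert LinearMap.det_id
    ext p; exact lorRefl_lorRefl hk p
  have h2 : LinearMap.det (lorRefl e k) ≠ 0 := fun h => by simp [h] at h1
  refine ⟨(lorRefl e k).continuous_of_finiteDimensional.measurable, ?_⟩
  rw [Measure.map_linearMap_addHaar_eq_smul_addHaar _ h2]
  have h3 : |LinearMap.det (lorRefl e k)| = 1 := by
    rcases mul_self_eq_one_iff.1 h1 with h | h <;> simp [h]
  simp [abs_inv, h3]

lemma measurableEmbedding_lorRefl {e k : V} (hk : lor e k k ≠ 0) :
    MeasurableEmbedding (lorRefl e k : V → V) :=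
  (LinearEquiv.ofInvolutive (lorRefl e k)
    (lorRefl_lorRefl hk)).toContinuousLinearEquiv.toHomeomorph.measurableEmbedding

variable (he : ‖e‖ = 1)
include he

lemma one_lt_inner_of_lor_eq_one {ω : V} (hω : ω ∈ cone e) (h1 : lor e ω ω = 1) (hne : ω ≠ e) :
    1 < ⟪e, ω⟫_ℝ := by
  have h0 : 0 < ⟪e, ω⟫_ℝ := ((mem_cone_iff he).1 hω).1
  rw [lor_self_eq_sp he] at h1
  rcases (norm_nonneg (sp e ω)).eq_or_lt with h | h
  · exfalso
    apply hne
    rw [← h] at h1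
    have h2 : ⟪e, ω⟫_ℝ = 1 := by nlinarith
    have h3 : sp e ω = 0 := norm_eq_zero.1 h.symm
    rw [sp, h2, one_smul] at h3
    exact sub_eq_zero.1 h3
  · nlinarith

lemma setIntegral_cone_eq_of_lor_eq_one {ω : V} (hω : ω ∈ cone e) (h1 : lor e ω ω = 1) (z : ℂ) :
    ∫ p in cone e, Complex.exp (-(⟪ω, p⟫_ℝ : ℂ)) * (lor e p p : ℂ) ^ z = coneGamma e z := by
  by_cases hne : ω = e
  · rw [hne]; rfl
  have hgt := one_lt_inner_of_lor_eq_one he hω h1 hne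
  set k := refl e ω - e with hkdef
  have e1 : lor e (refl e ω) e = ⟪e, ω⟫_ℝ := by rw [lor_refl_left he, real_inner_comm]
  have hkk : lor e k k = 2 - 2 * ⟪e, ω⟫_ℝ := by
    rw [hkdef, lor_sub_left, lor_sub_right, lor_sub_right, lor_refl_refl he, h1,
      lor_comm e e (refl e ω), e1, lor_self_axis he]; ring
  have hk : lor e k k ≠ 0 := by rw [hkk]; linarith
  have hR : lorRefl e k (refl e ω) = e := by
    have : 2 * lor e (refl e ω) k / lor e k k = 1 := by
      rw [div_eq_one_iff_eq hk, hkk, hkdef, lor_sub_right, lor_refl_refl he, h1, e1]; ring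
    rw [lorRefl_apply, this, hkdef]; module
  have hin : ∀ p, ⟪e, lorRefl e k p⟫_ℝ = ⟪ω, p⟫_ℝ := fun p => by
    rw [← lor_axis he, ← lor_refl_left he, ← lor_lorRefl hk (refl e ω) p, hR]
  have hpre : (lorRefl e k) ⁻¹' cone e = cone e := by
    have hsub : ∀ p ∈ cone e, lorRefl e k p ∈ cone e := fun p hp => by
      rw [mem_cone_iff he, hin, lor_lorRefl hk]
      refine ⟨?_, lor_pos he hp⟩
      rw [← lor_refl_left he]
      exact lor_pos_of_mem he (refl_mem_cone he hω) hp
    ext p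
    exact ⟨fun h => by simpa [lorRefl_lorRefl hk] using hsub _ h, hsub p⟩
  have := (measurePreserving_lorRefl hk).setIntegral_preimage_emb
    (measurableEmbedding_lorRefl hk)
    (fun p => Complex.exp (-(⟪e, p⟫_ℝ : ℂ)) * (lor e p p : ℂ) ^ z) (cone e)
  simp_rw [hpre, hin, lor_lorRefl hk] at this
  exact this

omit he in
lemma ofReal_sq_cpow {s : ℝ} (hs : 0 < s) (z : ℂ) :
    ((s ^ 2 : ℝ) : ℂ) ^ z = (s : ℂ) ^ (2 * z) := by
  have hsc : (s : ℂ) ≠ 0 := by exact_mod_cast hs.ne'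
  rw [Complex.cpow_def_of_ne_zero hsc, Complex.cpow_def_of_ne_zero (by simpa using hsc),
    ← Complex.ofReal_log (by positivity), ← Complex.ofReal_log hs.le, Real.log_pow]
  push_cast; congr 1; ring

lemma smul_cone {s : ℝ} (hs : 0 < s) : s • cone e = cone e := by
  ext p
  rw [mem_smul_set_iff_inv_smul_mem₀ hs.ne']
  exact ⟨fun h => by simpa [smul_smul, hs.ne'] using smul_mem_cone hs h,
    smul_mem_cone (inv_pos.2 hs)⟩

/-- The Laplace transform of `lor e p p ^ z` on the cone, at real points. -/
lemma setIntegral_cone_eq {ω : V} (hω : ω ∈ cone e) (z : ℂ) :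
    ∫ p in cone e, Complex.exp (-(⟪ω, p⟫_ℝ : ℂ)) * (lor e p p : ℂ) ^ z =
      coneGamma e z * (lor e ω ω : ℂ) ^ (-z - Module.finrank ℝ V / 2) := by
  set s := √(lor e ω ω) with hs_def
  have hpos := lor_pos he hω
  have hs : 0 < s := Real.sqrt_pos.2 hpos
  have hs2 : lor e ω ω = s ^ 2 := (Real.sq_sqrt hpos.le).symm
  have hω1 : s⁻¹ • ω ∈ cone e := smul_mem_cone (inv_pos.2 hs) hω
  have h1 : lor e (s⁻¹ • ω) (s⁻¹ • ω) = 1 := by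
    rw [lor_smul_left, lor_smul_right, hs2]; field_simp
  have key := Measure.setIntegral_comp_smul_of_pos volume (fun p : V =>
    Complex.exp (-(⟪s⁻¹ • ω, p⟫_ℝ : ℂ)) * (lor e p p : ℂ) ^ z) (cone e) hs
  rw [smul_cone he hs, setIntegral_cone_eq_of_lor_eq_one he hω1 h1] at key
  have hsc : (s : ℂ) ≠ 0 := by exact_mod_cast hs.ne'
  have e1 : ∀ p ∈ cone e, Complex.exp (-(⟪ω, p⟫_ℝ : ℂ)) * (lor e p p : ℂ) ^ z =
      (s : ℂ) ^ (-(2 * z)) * (Complex.exp (-(⟪s⁻¹ • ω, s • p⟫_ℝ : ℂ)) *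
        (lor e (s • p) (s • p) : ℂ) ^ z) := fun p hp => by
    rw [inner_smul_left, inner_smul_right, lor_smul_left, lor_smul_right, ← mul_assoc s s,
      ← sq, RCLike.conj_to_real, inv_mul_cancel_left₀ hs.ne', Complex.ofReal_mul,
      Complex.mul_cpow_ofReal_nonneg (by positivity) (lor_pos he hp).le]
    rw [ofReal_sq_cpow hs, Complex.cpow_neg]
    have : (s : ℂ) ^ (2 * z) ≠ 0 := by simp [Complex.cpow_eq_zero_iff, hsc]
    field_simp
  rw [setIntegral_congr_fun (measurableSet_cone e) e1, integral_const_mul, key]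
  have : (lor e ω ω : ℂ) ^ (-z - Module.finrank ℝ V / 2 : ℂ) =
      (s : ℂ) ^ (-(2 * z)) * ((s : ℂ) ^ (Module.finrank ℝ V))⁻¹ := by
    rw [hs2, ← Complex.cpow_natCast, ← Complex.cpow_neg, ← Complex.cpow_add _ _ hsc,
      ofReal_sq_cpow hs]
    congr 1; ring
  rw [this]
  simp only [Complex.real_smul, Complex.ofReal_inv, Complex.ofReal_pow]
  ring

end Laplace

section Laplace

variable {V : Type*} [NormedAddCommGroup V] [InnerProductSpace ℝ V] [FiniteDimensional ℝ V]
  [MeasurableSpace V] [BorelSpace V] {e : V}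

lemma convex_cone (e : V) : Convex ℝ (cone e) := by
  intro p hp r hr a b ha hb hab
  rcases ha.eq_or_lt with rfl | ha
  · rw [zero_add] at hab; simpa [hab] using hr
  rcases hb.eq_or_lt with rfl | hb
  · rw [add_zero] at hab; simpa [hab] using hp
  exact add_mem_cone (cone_subset_ccone e (smul_mem_cone ha hp)) (smul_mem_cone hb hr)

/-- The points `l` for which the Laplace integral at `ω + l • η` converges. -/
def strip (e ω η : V) : Set ℂ := {l | ω + l.re • η ∈ cone e}

lemma isOpen_strip (e ω η : V) : IsOpen (strip e ω η) :=
  (isOpen_cone e).preimage (by fun_prop : Continuous fun l : ℂ => ω + l.re • η)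

lemma convex_strip (e ω η : V) : Convex ℝ (strip e ω η) := by
  intro l hl m hm a b ha hb hab
  have := convex_cone e hl hm ha hb hab
  change ω + (a • l + b • m).re • η ∈ cone e
  convert this using 1
  have : ω = (a + b) • ω := by rw [hab, one_smul]
  nth_rewrite 1 [this]
  simp only [Complex.add_re, Complex.real_smul, Complex.mul_re, Complex.ofReal_re,
    Complex.ofReal_im]
  module

variable (he : ‖e‖ = 1)
include he

lemma clor_strip (ω η : V) (l : ℂ) :
    (lor e ω ω : ℂ) + 2 * l * lor e ω η + l ^ 2 * lor e η η =
      clor e (ω + l.re • η) (l.im • η) := by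
  simp only [clor, lor_add_left, lor_add_right, lor_smul_left, lor_smul_right, lor_comm e η ω]
  nth_rewrite 1 2 [← Complex.re_add_im l]
  push_cast
  linear_combination (l.im ^ 2 * lor e η η : ℂ) * Complex.I_sq

/-- The Laplace transform of `lor e p p ^ z` on the cone, at complex points. -/
lemma setIntegral_cone_cexp {ω : V} (hω : ω ∈ cone e) (η : V) {z : ℂ} (hz : 0 ≤ z.re) :
    ∫ p in cone e, Complex.exp (-((⟪ω, p⟫_ℝ : ℂ) + ⟪η, p⟫_ℝ * Complex.I)) * (lor e p p : ℂ) ^ z =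
      coneGamma e z * clor e ω η ^ (-z - Module.finrank ℝ V / 2) := by
  set L : V → ℂ := fun p => -(⟪η, p⟫_ℝ : ℂ) with hL
  set h : V → ℂ := fun p => Complex.exp (-(⟪ω, p⟫_ℝ : ℂ)) * (lor e p p : ℂ) ^ z with hh
  have hconv : ∀ l ∈ strip e ω η, IntegrableOn (fun p => Complex.exp (l * L p) * h p) (cone e) := by
    intro l hl
    have := integrableOn_cone_exp he (ω := ω + l.re • η) hl hz
      (f := fun p => Complex.exp (l * L p) * Complex.exp (-(⟪ω, p⟫_ℝ : ℂ))) (by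
        apply Continuous.aestronglyMeasurable; simp only [hL]; fun_prop) (fun p => by
        rw [← Complex.exp_add, Complex.norm_exp, Real.exp_le_exp]
        apply le_of_eq
        simp [hL, inner_add_left, inner_smul_left])
    simpa [hh, mul_assoc] using this
  have hG : AnalyticOnNhd ℂ (fun l => ∫ p in cone e, Complex.exp (l * L p) * h p)
      (strip e ω η) := by
    refine DifferentiableOn.analyticOnNhd (fun l hl => DifferentiableAt.differentiableWithinAt ?_)
      (isOpen_strip e ω η)
    obtain ⟨r, hr, hball⟩ := Metric.isOpen_iff.1 (isOpen_strip e ω η) l hl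
    have hmeas : AEStronglyMeasurable h (volume.restrict (cone e)) := by
      refine (Continuous.aestronglyMeasurable (by fun_prop)).mul
        (Measurable.aestronglyMeasurable ?_)
      exact (Complex.measurable_ofReal.comp (continuous_lor e).measurable).pow_const z
    refine differentiableAt_integral_cexp (r := r / 5) (h := h) (L := L)
      (Continuous.aestronglyMeasurable (by simp only [hL]; fun_prop)) (by positivity) hmeas
      fun m hm => hconv m (hball ?_)
    rw [Metric.mem_ball, dist_eq_norm]; linarith
  have hH : AnalyticOnNhd ℂ (fun l => coneGamma e z *
      ((lor e ω ω : ℂ) + 2 * l * lor e ω η + l ^ 2 * lor e η η) ^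
        (-z - Module.finrank ℝ V / 2)) (strip e ω η) := by
    refine DifferentiableOn.analyticOnNhd (fun l hl => DifferentiableAt.differentiableWithinAt ?_)
      (isOpen_strip e ω η)
    refine DifferentiableAt.const_mul (DifferentiableAt.cpow (by fun_prop) (by fun_prop) ?_) _
    rw [clor_strip he]
    exact clor_mem_slitPlane he hl _
  have h0 : (0 : ℂ) ∈ strip e ω η := by simpa [strip] using hω
  have hI : Complex.I ∈ strip e ω η := by simpa [strip] using hω
  have hfreq : ∃ᶠ l in 𝓝[≠] (0 : ℂ), (∫ p in cone e, Complex.exp (l * L p) * h p) =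
      coneGamma e z * ((lor e ω ω : ℂ) + 2 * l * lor e ω η + l ^ 2 * lor e η η) ^
        (-z - Module.finrank ℝ V / 2) := by
    have ht : Tendsto (fun s : ℝ => (s : ℂ)) (𝓝[≠] 0) (𝓝[≠] 0) := by
      refine tendsto_nhdsWithin_iff.2 ⟨?_, ?_⟩
      · exact (Complex.continuous_ofReal.tendsto' 0 0 (by simp)).mono_left nhdsWithin_le_nhds
      · filter_upwards [self_mem_nhdsWithin] with s hs using by simpa using hs
    refine ht.frequently (Eventually.frequently ?_)
    have hev : ∀ᶠ s : ℝ in 𝓝 0, ω + s • η ∈ cone e := by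
      refine (by fun_prop : Continuous fun s : ℝ => ω + s • η).continuousAt.eventually_mem ?_
      simpa using (isOpen_cone e).mem_nhds hω
    filter_upwards [nhdsWithin_le_nhds hev] with s hs
    have := setIntegral_cone_eq he hs z
    rw [clor_strip he, Complex.ofReal_re, Complex.ofReal_im, zero_smul]
    have hc : clor e (ω + s • η) 0 = (lor e (ω + s • η) (ω + s • η) : ℂ) := by simp [clor, lor]
    rw [hc, ← this]
    congr 1
    ext p
    rw [hh, ← mul_assoc, ← Complex.exp_add]
    simp [hL, inner_add_left, inner_smul_left]
  have := hG.eqOn_of_preconnected_of_frequently_eq hH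
    (convex_strip e ω η).isPreconnected h0 hfreq hI
  beta_reduce at this
  rw [clor_strip he] at this
  simp only [Complex.I_re, Complex.I_im, zero_smul, add_zero, one_smul] at this
  rw [← this]
  congr 1
  ext p
  rw [hh, ← mul_assoc, ← Complex.exp_add]
  congr 2
  simp only [hL]; ring

end Laplace

open scoped SchwartzMap LineDeriv FourierTransform

section Multiplier

variable {V : Type*} [NormedAddCommGroup V] [InnerProductSpace ℝ V] {e : V}

/-- The Fourier multiplier `clor e ω (2πη) ^ (-α/2)`. -/
noncomputable def mult (e ω : V) (α : ℂ) (η : V) : ℂ :=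
  clor e ω ((2 * Real.pi) • η) ^ (-α / 2)

/-- The symbol of the differential operator `∂_v + ⟪ω, v⟫`. -/
noncomputable def dsym (ω v η : V) : ℂ := (⟪ω, v⟫_ℝ : ℂ) + (2 * Real.pi * ⟪η, v⟫_ℝ : ℝ) * Complex.I

/-- `η ↦ ∂_v` of `clor e ω (2πη)`, as a continuous linear map in `v`. -/
noncomputable def dsymL (e ω η : V) : V →L[ℝ] ℂ :=
  (Complex.ofRealCLM ∘L innerSL ℝ ω + (2 * Real.pi * Complex.I) •
    (Complex.ofRealCLM ∘L innerSL ℝ η)) ∘L ((2 : ℝ) • (innerSL ℝ e).smulRight e - .id ℝ V)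

lemma dsymL_apply (e ω η v : V) : dsymL e ω η v = dsym ω (refl e v) η := by
  simp [dsymL, dsym, refl, inner_sub_right, inner_smul_right, mul_assoc]
  ring

lemma dsymL_hasTemperateGrowth (e ω : V) : (dsymL e ω).HasTemperateGrowth := by
  have h : (fun η : V => (2 * Real.pi * Complex.I) •
    (Complex.ofRealCLM ∘L innerSL ℝ η)).HasTemperateGrowth := by
    have := (((2 * Real.pi * Complex.I) • ContinuousLinearMap.compL ℝ V ℝ ℂ Complex.ofRealCLM)
      ∘L (innerSL ℝ (E := V))).hasTemperateGrowth
    exact this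
  have h2 := (((ContinuousLinearMap.compL ℝ V V ℂ).flip
    ((2 : ℝ) • (innerSL ℝ e).smulRight e - .id ℝ V)).hasTemperateGrowth).comp
    ((Function.HasTemperateGrowth.const (Complex.ofRealCLM ∘L innerSL ℝ ω)).add h)
  exact h2

lemma hasFDerivAt_clor (ω η : V) :
    HasFDerivAt (fun η => clor e ω ((2 * Real.pi) • η))
      ((4 * Real.pi * Complex.I) • dsymL e ω η) η := by
  have h1 : ∀ v : V, HasFDerivAt (fun η : V => ⟪v, η⟫_ℝ) (innerSL ℝ v) η := fun v =>
    (innerSL ℝ v).hasFDerivAt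
  have h2 := (hasStrictFDerivAt_norm_sq (F := V) η).hasFDerivAt
  have hR : ∀ (x : V → ℝ) (L : V →L[ℝ] ℝ), HasFDerivAt x L η →
      HasFDerivAt (fun η => (x η : ℂ)) (Complex.ofRealCLM ∘L L) η :=
    fun x L h => Complex.ofRealCLM.hasFDerivAt.comp η h
  have h0 := (((hR _ _ ((((h1 e).mul (h1 e)).const_mul 2).sub h2)).const_mul
      ((2 * Real.pi : ℂ) ^ 2)).const_sub (lor e ω ω : ℂ)).add
      ((hR _ _ (((h1 e).const_mul (2 * ⟪e, ω⟫_ℝ)).sub (h1 ω))).const_mul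
        (4 * Real.pi * Complex.I))
  have h3 : (fun η => clor e ω ((2 * Real.pi) • η)) = fun η =>
        (lor e ω ω : ℂ) - (2 * Real.pi) ^ 2 *
          ((2 * (⟪e, η⟫_ℝ * ⟪e, η⟫_ℝ) - ‖η‖ ^ 2 : ℝ) : ℂ) +
          (4 * Real.pi * Complex.I) * ((2 * ⟪e, ω⟫_ℝ * ⟪e, η⟫_ℝ - ⟪ω, η⟫_ℝ : ℝ) : ℂ) := by
    ext η
    simp only [clor, lor_smul_left, lor_smul_right]
    simp only [lor, real_inner_self_eq_norm_sq]
    push_cast; ring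
  rw [h3]
  refine h0.congr_fderiv ?_
  ext v
  simp [dsymL_apply, dsym, refl, inner_sub_right, inner_smul_right, real_inner_comm e]
  linear_combination (-8 * Real.pi ^ 2 * (2 * ⟪e, v⟫_ℝ * ⟪e, η⟫_ℝ - ⟪η, v⟫_ℝ) : ℂ) * Complex.I_sq

lemma norm_cpow_le {z : ℂ} (hz : z ≠ 0) (w : ℂ) :
    ‖z ^ w‖ ≤ ‖z‖ ^ w.re * Real.exp (Real.pi * |w.im|) := by
  rw [Complex.norm_cpow_of_ne_zero hz, div_eq_mul_inv, ← Real.exp_neg]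
  gcongr
  calc _ ≤ |Complex.arg z * w.im| := neg_le_abs _
    _ ≤ _ := by rw [abs_mul]; gcongr; exact Complex.abs_arg_le_pi z

variable (he : ‖e‖ = 1)
include he

lemma hasFDerivAt_mult {ω : V} (hω : ω ∈ cone e) (α : ℂ) (η : V) :
    HasFDerivAt (mult e ω α)
      ((-(2 * Real.pi * Complex.I * α) * mult e ω (α + 2) η) • dsymL e ω η) η := by
  have h1 := ((hasDerivAt_id (clor e ω ((2 * Real.pi) • η))).cpow_const (c := -α / 2)
    (clor_mem_slitPlane he hω _)).hasFDerivAt.restrictScalars ℝ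
  have := h1.comp η (hasFDerivAt_clor (e := e) ω η)
  refine this.congr_fderiv ?_
  ext v
  simp only [ContinuousLinearMap.comp_apply, ContinuousLinearMap.coe_restrictScalars',
    smul_apply, ContinuousLinearMap.toSpanSingleton_apply, smul_eq_mul, id,
    mult]
  rw [show -(α + 2) / 2 = -α / 2 - 1 by ring]
  ring

lemma contDiff_mult {ω : V} (hω : ω ∈ cone e) (α : ℂ) : ContDiff ℝ (⊤ : ℕ∞) (mult e ω α) := by
  rw [contDiff_infty]
  intro n
  induction n generalizing α with
  | zero =>
    exact contDiff_zero.2 (continuous_iff_continuousAt.2 fun η =>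
      (hasFDerivAt_mult he hω α η).continuousAt)
  | succ n ih =>
    push_cast
    rw [contDiff_succ_iff_fderiv]
    refine ⟨fun η => (hasFDerivAt_mult he hω α η).differentiableAt, by simp, ?_⟩
    rw [funext fun η => (hasFDerivAt_mult he hω α η).fderiv]
    have h := ((dsymL_hasTemperateGrowth e ω).1.of_le
      (by exact_mod_cast le_top) : ContDiff ℝ n (dsymL e ω))
    exact (contDiff_const.mul (ih (α + 2))).smul h

lemma norm_clor_le (ω η : V) : ‖clor e ω η‖ ≤ 4 * (‖ω‖ + ‖η‖) ^ 2 := by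
  have h1 : ∀ p r : V, |lor e p r| ≤ ‖p‖ * ‖r‖ := fun p r => by
    rw [lor_eq_inner_refl]
    have : ‖refl e r‖ = ‖r‖ := by
      rw [← sq_eq_sq₀ (norm_nonneg _) (norm_nonneg _), norm_sq_eq_sp he, norm_sq_eq_sp he r,
        inner_refl he, sp_refl he, norm_neg]
    rw [← this]; exact abs_real_inner_le_norm _ _
  have := Complex.norm_le_abs_re_add_abs_im (clor e ω η)
  rw [clor_re he, clor_im he, abs_mul, abs_two] at this
  have h2 := abs_sub (lor e ω ω) (lor e η η)
  nlinarith [h1 ω ω, h1 η η, h1 ω η, norm_nonneg ω, norm_nonneg η]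

lemma norm_mult_le_poly {ω : V} (hω : ω ∈ cone e) (α : ℂ) :
    ∃ k : ℕ, ∃ C : ℝ, ∀ η, ‖mult e ω α η‖ ≤ C * (1 + ‖η‖) ^ k := by
  obtain ⟨k, hk⟩ := exists_nat_ge (2 * (-α / 2).re)
  have hσ := lor_pos he hω
  set c := Real.exp (Real.pi * |(-α / 2).im|)
  rcases le_total 0 (-α / 2).re with h | h
  · refine ⟨k, (4 * (‖ω‖ + 2 * Real.pi) ^ 2) ^ (-α / 2).re * c, fun η => ?_⟩
    refine (norm_cpow_le (clor_ne_zero he hω _) _).trans ?_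
    have h1 : ‖clor e ω ((2 * Real.pi) • η)‖ ≤ (4 * (‖ω‖ + 2 * Real.pi) ^ 2) * (1 + ‖η‖) ^ 2 := by
      refine (norm_clor_le he _ _).trans ?_
      rw [mul_assoc, ← mul_pow]
      gcongr
      rw [norm_smul, Real.norm_of_nonneg (by positivity)]
      nlinarith [norm_nonneg ω, norm_nonneg η, Real.pi_pos]
    calc _ ≤ ((4 * (‖ω‖ + 2 * Real.pi) ^ 2) * (1 + ‖η‖) ^ 2) ^ (-α / 2).re * c := by
          gcongr
      _ = (4 * (‖ω‖ + 2 * Real.pi) ^ 2) ^ (-α / 2).re * c *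
            ((1 + ‖η‖) ^ (2 * (-α / 2).re)) := by
          rw [Real.mul_rpow (by positivity) (by positivity), ← Real.rpow_natCast (1 + ‖η‖),
            ← Real.rpow_mul (x := 1 + ‖η‖) (by positivity)]
          push_cast; ring
      _ ≤ _ := by
          rw [← Real.rpow_natCast (1 + ‖η‖) k]
          gcongr
          simp
  · refine ⟨0, lor e ω ω ^ (-α / 2).re * c, fun η => ?_⟩
    refine (norm_cpow_le (clor_ne_zero he hω _) _).trans ?_
    rw [pow_zero, mul_one]
    refine mul_le_mul_of_nonneg_right ?_ (Real.exp_nonneg _)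
    exact Real.rpow_le_rpow_of_nonpos hσ (lor_le_norm_clor he hω _) h

lemma mult_hasTemperateGrowth {ω : V} (hω : ω ∈ cone e) (α : ℂ) :
    (mult e ω α).HasTemperateGrowth := by
  refine ⟨contDiff_mult he hω α, fun n => ?_⟩
  induction n using Nat.strong_induction_on generalizing α with
  | _ n ih =>
  rcases n with _ | n
  · obtain ⟨k, C, h⟩ := norm_mult_le_poly he hω α
    exact ⟨k, C, fun η => by simpa using h η⟩
  · obtain ⟨kl, Cl, hCl, hl⟩ := (dsymL_hasTemperateGrowth e ω).norm_iteratedFDeriv_le_uniform n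
    choose! k C hC using fun m (hm : m < n + 1) => ih m hm (α + 2)
    have hC0 : ∀ m < n + 1, 0 ≤ C m := fun m hm => by
      have := (norm_nonneg _).trans (hC m hm 0); simpa using this
    refine ⟨(∑ m ∈ Finset.range (n + 1), k m) + kl, ‖-(2 * Real.pi * Complex.I * α)‖ *
      ∑ m ∈ Finset.range (n + 1), (n.choose m : ℝ) * C m * Cl, fun η => ?_⟩
    have hf : fderiv ℝ (mult e ω α) = (-(2 * Real.pi * Complex.I * α)) •
        (fun η => mult e ω (α + 2) η • dsymL e ω η) := by
      ext1 η
      rw [(hasFDerivAt_mult he hω α η).fderiv, Pi.smul_apply, smul_smul]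
    have hcd : ContDiff ℝ (⊤ : ℕ∞) (fun η => mult e ω (α + 2) η • dsymL e ω η) :=
      (contDiff_mult he hω _).smul (dsymL_hasTemperateGrowth e ω).1
    rw [← norm_iteratedFDeriv_fderiv, hf, iteratedFDeriv_const_smul_apply
      (hcd.of_le (by exact_mod_cast le_top)).contDiffAt, norm_smul,
      mul_assoc ‖-(2 * Real.pi * Complex.I * α)‖]
    refine mul_le_mul_of_nonneg_left ?_ (norm_nonneg (-(2 * Real.pi * Complex.I * α)))
    refine (norm_iteratedFDeriv_smul_le (contDiff_mult he hω _) (dsymL_hasTemperateGrowth e ω).1 η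
      (by exact_mod_cast le_top)).trans ?_
    rw [Finset.sum_mul]
    refine Finset.sum_le_sum fun m hm => ?_
    have hm' := Finset.mem_range.1 hm
    calc _ ≤ (n.choose m : ℝ) * (C m * (1 + ‖η‖) ^ k m) * (Cl * (1 + ‖η‖) ^ kl) := by
          gcongr
          · exact mul_nonneg (Nat.cast_nonneg _) (mul_nonneg (hC0 m hm') (by positivity))
          · exact hC m hm' η
          · exact hl _ (by omega) η
      _ = (n.choose m : ℝ) * C m * Cl * (1 + ‖η‖) ^ (k m + kl) := by rw [pow_add]; ring
      _ ≤ _ := by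
          have := hC0 m hm'
          gcongr
          · simp
          · exact Finset.single_le_sum (f := k) (fun _ _ => Nat.zero_le _) hm

end Multiplier

section Operators

variable {V : Type*} [NormedAddCommGroup V] [InnerProductSpace ℝ V] {e : V}
  [FiniteDimensional ℝ V] [MeasurableSpace V] [BorelSpace V]

open SchwartzMap

/-- The conjugated fractional wave operator of order `-α`. -/
noncomputable def T (e ω : V) (α : ℂ) : 𝓢(V, ℂ) →L[ℂ] 𝓢(V, ℂ) :=
  fourierMultiplierCLM ℂ (mult e ω α)

/-- The conjugated derivative `∂_v + ⟪ω, v⟫`. -/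
noncomputable def D (ω v : V) : 𝓢(V, ℂ) →L[ℂ] 𝓢(V, ℂ) :=
  fourierMultiplierCLM ℂ (dsym ω v)

/-- Multiplication by `⟪·, v⟫`. -/
noncomputable def A (v : V) : 𝓢(V, ℂ) →L[ℂ] 𝓢(V, ℂ) :=
  smulLeftCLM ℂ (fun p : V => (⟪p, v⟫_ℝ : ℂ))

lemma inner_hasTemperateGrowth (v : V) : (fun p : V => (⟪p, v⟫_ℝ : ℂ)).HasTemperateGrowth := by
  have : (fun p : V => ⟪p, v⟫_ℝ).HasTemperateGrowth := by fun_prop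
  exact Complex.ofRealCLM.hasTemperateGrowth.comp this

lemma A_apply (v : V) (S : 𝓢(V, ℂ)) (p : V) : A v S p = (⟪p, v⟫_ℝ : ℂ) * S p := by
  simp [A, smulLeftCLM_apply_apply (inner_hasTemperateGrowth v)]

lemma A_eq (v : V) (S : 𝓢(V, ℂ)) : A v S = smulLeftCLM ℂ (fun p : V => ⟪p, v⟫_ℝ) S := by
  ext p
  rw [A_apply, smulLeftCLM_apply_apply (by fun_prop), Complex.real_smul]

lemma dsym_eq (ω v : V) : dsym ω v = fun η : V => (⟪ω, v⟫_ℝ : ℂ) +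
    (2 * Real.pi * Complex.I) * (⟪η, v⟫_ℝ : ℂ) := by
  ext η; simp [dsym]; ring

lemma dsym_hasTemperateGrowth (ω v : V) : (dsym ω v).HasTemperateGrowth := by
  rw [dsym_eq]
  exact (Function.HasTemperateGrowth.const _).add
    ((Function.HasTemperateGrowth.const _).mul (inner_hasTemperateGrowth v))

lemma D_eq (ω v : V) (S : 𝓢(V, ℂ)) : D ω v S = ∂_{v} S + (⟪ω, v⟫_ℝ : ℂ) • S := by
  have h : dsym ω v = (fun _ => (⟪ω, v⟫_ℝ : ℂ)) +
      (2 * Real.pi * Complex.I : ℂ) • (fun η : V => (⟪η, v⟫_ℝ : ℂ)) := by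
    rw [dsym_eq]; rfl
  have h2 := inner_hasTemperateGrowth v
  rw [D, fourierMultiplierCLM_apply, h, smulLeftCLM_add (.const _)
    (show Function.HasTemperateGrowth (_ • _) from (Function.HasTemperateGrowth.const _).mul h2),
    smulLeftCLM_smul h2, smulLeftCLM_const,
    lineDeriv_eq_fourierMultiplierCLM, ← fourierMultiplierCLM_ofReal ℂ (by fun_prop),
    fourierMultiplierCLM_apply]
  simp [FourierTransform.fourierInv_add, FourierTransform.fourierInv_smul, add_comm]

lemma D_apply (ω v : V) (S : 𝓢(V, ℂ)) (p : V) :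
    D ω v S p = fderiv ℝ S p v + (⟪ω, v⟫_ℝ : ℂ) * S p := by
  rw [D_eq]; simp [lineDerivOp_apply_eq_fderiv]

lemma D_A (ω v w : V) (S : 𝓢(V, ℂ)) :
    D ω v (A w S) = A w (D ω v S) + (⟪v, w⟫_ℝ : ℂ) • S := by
  ext p
  have h : HasFDerivAt (fun p : V => (⟪p, w⟫_ℝ : ℂ) * S p)
      ((⟪p, w⟫_ℝ : ℂ) • fderiv ℝ S p + S p • (Complex.ofRealCLM ∘L innerSL ℝ w)) p := by
    have h1 : HasFDerivAt (fun p : V => (⟪p, w⟫_ℝ : ℂ)) (Complex.ofRealCLM ∘L innerSL ℝ w) p := by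
      have := (Complex.ofRealCLM ∘L innerSL ℝ w).hasFDerivAt (x := p)
      refine this.congr_of_eventuallyEq (.of_forall fun q => ?_)
      simp [real_inner_comm]
    exact h1.mul S.differentiableAt.hasFDerivAt
  have h2 : (A w S : V → ℂ) = fun p => (⟪p, w⟫_ℝ : ℂ) * S p := by ext; rw [A_apply]
  rw [D_apply, h2, h.fderiv]
  simp [D_apply, A_apply, real_inner_comm w]
  ring

lemma mult_eq_exp (he : ‖e‖ = 1) {ω : V} (hω : ω ∈ cone e) (α : ℂ) (η : V) :
    mult e ω α η = Complex.exp (α * (-Complex.log (clor e ω ((2 * Real.pi) • η)) / 2)) := by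
  rw [mult, Complex.cpow_def_of_ne_zero (clor_ne_zero he hω _)]
  congr 1; ring

variable (he : ‖e‖ = 1) {ω : V} (hω : ω ∈ cone e)
include he hω

lemma T_T (α β : ℂ) (S : 𝓢(V, ℂ)) : T e ω α (T e ω β S) = T e ω (α + β) S := by
  rw [T, T, fourierMultiplierCLM_fourierMultiplierCLM_apply (mult_hasTemperateGrowth he hω _)
    (mult_hasTemperateGrowth he hω _), T]
  congr 2
  ext η
  simp only [Pi.mul_apply, mult_eq_exp he hω, ← Complex.exp_add]
  congr 1; ring

lemma T_zero (S : 𝓢(V, ℂ)) : T e ω 0 S = S := by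
  have : mult e ω 0 = fun _ => 1 := by ext; simp [mult]
  rw [T, this]; simp

lemma T_D (α : ℂ) (v : V) (S : 𝓢(V, ℂ)) : T e ω α (D ω v S) = D ω v (T e ω α S) := by
  rw [T, D, fourierMultiplierCLM_fourierMultiplierCLM_apply (mult_hasTemperateGrowth he hω _)
    (dsym_hasTemperateGrowth _ _), fourierMultiplierCLM_fourierMultiplierCLM_apply
    (dsym_hasTemperateGrowth _ _) (mult_hasTemperateGrowth he hω _), mul_comm]

lemma A_T (α : ℂ) (v : V) (S : 𝓢(V, ℂ)) :
    A v (T e ω α S) = T e ω α (A v S) + α • D ω (refl e v) (T e ω (α + 2) S) := by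
  have hpi : (2 * Real.pi * Complex.I : ℂ) ≠ 0 := by simp [Real.pi_ne_zero]
  have hm := mult_hasTemperateGrowth he hω
  have key : ∂_{v} (smulLeftCLM ℂ (mult e ω α) (𝓕 S)) =
      smulLeftCLM ℂ (mult e ω α) (∂_{v} (𝓕 S)) + (-(2 * Real.pi * Complex.I * α)) •
        smulLeftCLM ℂ (dsym ω (refl e v)) (smulLeftCLM ℂ (mult e ω (α + 2)) (𝓕 S)) := by
    ext η
    have h1 := (hasFDerivAt_mult he hω α η).mul (𝓕 S).differentiableAt.hasFDerivAt
    have h2 : (smulLeftCLM ℂ (mult e ω α) (𝓕 S) : V → ℂ) = (mult e ω α) * (𝓕 S : 𝓢(V, ℂ)) := by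
      ext; simp [smulLeftCLM_apply_apply (hm α)]
    rw [lineDerivOp_apply_eq_fderiv, h2, h1.fderiv]
    simp [smulLeftCLM_apply_apply (hm _), smulLeftCLM_apply_apply (dsym_hasTemperateGrowth _ _),
      lineDerivOp_apply_eq_fderiv, dsymL_apply]
    ring
  have h3 := congrArg (𝓕⁻ ·) key
  simp only [fourierInv_lineDerivOp_eq, FourierTransform.fourierInv_add,
    FourierTransform.fourierInv_smul, lineDerivOp_fourier_eq, map_smul] at h3
  have h4 : D ω (refl e v) (T e ω (α + 2) S) = 𝓕⁻ (smulLeftCLM ℂ (dsym ω (refl e v))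
      (smulLeftCLM ℂ (mult e ω (α + 2)) (𝓕 S))) := by
    simp [D, T, fourierMultiplierCLM_apply]
  rw [← h4, ← fourierMultiplierCLM_apply, ← fourierMultiplierCLM_apply, ← A_eq, ← A_eq] at h3
  have h5 : (-(2 * Real.pi * Complex.I : ℂ)) • A v (T e ω α S) = (-(2 * Real.pi * Complex.I : ℂ)) •
      (T e ω α (A v S) + α • D ω (refl e v) (T e ω (α + 2) S)) := by
    rw [map_smul] at h3
    rw [smul_add, smul_smul, neg_mul]
    exact h3
  exact smul_right_injective _ (neg_ne_zero.2 hpi) h5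

lemma sum_dsym {ι : Type*} [Fintype ι] (b : OrthonormalBasis ι ℝ V) (η : V) :
    ∑ i, dsym ω (b i) η * dsym ω (refl e (b i)) η = clor e ω ((2 * Real.pi) • η) := by
  have h : ∀ x y : V, ∑ i, ((⟪x, b i⟫_ℝ : ℂ) * ⟪y, refl e (b i)⟫_ℝ) = (lor e x y : ℂ) := fun x y => by
    rw [lor_eq_inner_refl, ← b.sum_inner_mul_inner x (refl e y)]
    push_cast
    refine Finset.sum_congr rfl fun i _ => ?_
    congr 2
    simp [refl, inner_sub_left, inner_sub_right, inner_smul_left, inner_smul_right,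
      real_inner_comm]
    ring
  have h1 : ∀ i, dsym ω (b i) η * dsym ω (refl e (b i)) η =
      (⟪ω, b i⟫_ℝ : ℂ) * ⟪ω, refl e (b i)⟫_ℝ
      - (2 * Real.pi) ^ 2 * ((⟪η, b i⟫_ℝ : ℂ) * ⟪η, refl e (b i)⟫_ℝ)
      + 2 * Real.pi * Complex.I * ((⟪ω, b i⟫_ℝ : ℂ) * ⟪η, refl e (b i)⟫_ℝ)
      + 2 * Real.pi * Complex.I * ((⟪η, b i⟫_ℝ : ℂ) * ⟪ω, refl e (b i)⟫_ℝ) := fun i => by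
    simp only [dsym]
    push_cast
    linear_combination ((2 * Real.pi) ^ 2 * ((⟪η, b i⟫_ℝ : ℂ) * ⟪η, refl e (b i)⟫_ℝ)) *
      Complex.I_sq
  simp only [h1, Finset.sum_add_distrib, Finset.sum_sub_distrib, ← Finset.mul_sum, h]
  simp only [clor, lor_smul_left, lor_smul_right, lor_comm e η ω]
  push_cast
  ring

lemma sum_D_D {ι : Type*} [Fintype ι] (b : OrthonormalBasis ι ℝ V) (α : ℂ) (S : 𝓢(V, ℂ)) :
    ∑ i, D ω (b i) (D ω (refl e (b i)) (T e ω (α + 2) S)) = T e ω α S := by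
  have hd := dsym_hasTemperateGrowth (V := V) ω
  have hm := mult_hasTemperateGrowth he hω
  have h1 : ∀ i, D ω (b i) (D ω (refl e (b i)) (T e ω (α + 2) S)) =
      fourierMultiplierCLM ℂ (dsym ω (b i) * dsym ω (refl e (b i)) * mult e ω (α + 2)) S := by
    intro i
    rw [D, D, T, fourierMultiplierCLM_fourierMultiplierCLM_apply (hd _) (hm _),
      fourierMultiplierCLM_fourierMultiplierCLM_apply (hd _) ((hd _).mul (hm _)), mul_assoc]
  have h2 := congrArg (fun L => L S) (fourierMultiplierCLM_sum ℂ (s := Finset.univ)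
    (g := fun i => dsym ω (b i) * dsym ω (refl e (b i)) * mult e ω (α + 2))
    fun i _ => ((hd _).mul (hd _)).mul (hm _))
  simp only [h1]
  rw [sum_apply] at h2
  rw [← h2, T]
  congr 2
  ext η
  simp only [Pi.mul_apply]
  rw [← Finset.sum_mul, sum_dsym he hω, mult, mult, show -α / 2 = 1 + -(α + 2) / 2 by ring,
    Complex.cpow_add _ _ (clor_ne_zero he hω _), Complex.cpow_one]

omit he hω in
/-- The conjugated Euler operator. -/
noncomputable def eul {ι : Type*} [Fintype ι] (b : OrthonormalBasis ι ℝ V) (ω : V) :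
    𝓢(V, ℂ) →L[ℂ] 𝓢(V, ℂ) := ∑ i, A (b i) ∘L D ω (b i)

omit he hω in
lemma eul_apply {ι : Type*} [Fintype ι] (b : OrthonormalBasis ι ℝ V) (S : 𝓢(V, ℂ)) (p : V) :
    eul b ω S p = fderiv ℝ S p p + (⟪ω, p⟫_ℝ : ℂ) * S p := by
  have h : ∀ L : V →L[ℝ] ℂ, ∑ i, (⟪p, b i⟫_ℝ : ℂ) * L (b i) = L p := fun L => by
    conv_rhs => rw [← b.sum_repr' p, map_sum]
    refine Finset.sum_congr rfl fun i _ => ?_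
    rw [map_smul, real_inner_comm, Complex.real_smul]
  have h2 := h (fderiv ℝ S p)
  have h3 := h (Complex.ofRealCLM ∘L innerSL ℝ ω)
  simp only [ContinuousLinearMap.comp_apply, innerSL_apply_apply, Complex.ofRealCLM_apply] at h3
  rw [eul, sum_apply, sum_apply]
  simp only [ContinuousLinearMap.comp_apply, A_apply, D_apply, mul_add, Finset.sum_add_distrib, h2,
    ← mul_assoc, ← Finset.sum_mul, h3]

omit he hω in
lemma sum_A_refl_D_refl (he : ‖e‖ = 1) {ι : Type*} [Fintype ι] (b : OrthonormalBasis ι ℝ V)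
    (S : 𝓢(V, ℂ)) : ∑ i, A (refl e (b i)) (D ω (refl e (b i)) S) = eul b ω S := by
  have hr : ∀ x y : V, ⟪x, refl e y⟫_ℝ = ⟪refl e x, y⟫_ℝ := fun x y => by
    simp [refl, inner_sub_left, inner_sub_right, inner_smul_left, inner_smul_right,
      real_inner_comm]
    ring
  ext p
  have h : ∀ L : V →ₗ[ℝ] ℂ, ∑ i, (⟪p, refl e (b i)⟫_ℝ : ℂ) * L (refl e (b i)) = L p := fun L => by
    conv_rhs => rw [← refl_refl he p, ← b.sum_repr' (refl e p)]
    have : refl e (∑ i, ⟪b i, refl e p⟫_ℝ • b i) = ∑ i, ⟪b i, refl e p⟫_ℝ • refl e (b i) := by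
      simp only [refl, inner_sum, inner_smul_right, smul_sub, Finset.sum_sub_distrib, smul_smul,
        ← Finset.sum_smul, Finset.mul_sum]
      congr 2
      exact Finset.sum_congr rfl fun i _ => by ring
    rw [this, map_sum]
    refine Finset.sum_congr rfl fun i _ => ?_
    rw [map_smul, hr, real_inner_comm, Complex.real_smul]
  have h2 := h (fderiv ℝ S p)
  have h3 := h (Complex.ofRealCLM ∘L innerSL ℝ ω : V →L[ℝ] ℂ)
  simp only [ContinuousLinearMap.coe_coe, ContinuousLinearMap.comp_apply, innerSL_apply_apply,
    Complex.ofRealCLM_apply] at h2 h3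
  rw [eul_apply, sum_apply]
  simp only [A_apply, D_apply, mul_add, Finset.sum_add_distrib, h2, ← mul_assoc, ← Finset.sum_mul,
    h3]

lemma eul_T {ι : Type*} [Fintype ι] (b : OrthonormalBasis ι ℝ V) (α : ℂ) (S : 𝓢(V, ℂ)) :
    eul b ω (T e ω α S) = T e ω α (eul b ω S + α • S) := by
  simp only [eul, sum_apply, ContinuousLinearMap.comp_apply, map_add, map_sum,
    map_smul, ← T_D he hω, A_T he hω, Finset.sum_add_distrib, ← Finset.smul_sum]
  congr 2
  rw [← sum_D_D he hω b α S]
  refine Finset.sum_congr rfl fun i _ => ?_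
  rw [T_D he hω, T_D he hω, D, D, fourierMultiplierCLM_fourierMultiplierCLM_apply (dsym_hasTemperateGrowth _ _)
    (dsym_hasTemperateGrowth _ _), fourierMultiplierCLM_fourierMultiplierCLM_apply
    (dsym_hasTemperateGrowth _ _) (dsym_hasTemperateGrowth _ _), mul_comm]

omit he hω in
lemma lor_self_hasTemperateGrowth : (fun p : V => (lor e p p : ℂ)).HasTemperateGrowth := by
  have : (fun p : V => lor e p p).HasTemperateGrowth := by
    have h1 : (fun p : V => ⟪e, p⟫_ℝ).HasTemperateGrowth := by fun_prop
    have h2 : (fun p : V => ‖p‖ ^ 2).HasTemperateGrowth := by fun_prop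
    simp only [lor, real_inner_self_eq_norm_sq]
    exact (((Function.HasTemperateGrowth.const 2).mul h1).mul h1).sub h2
  exact Complex.ofRealCLM.hasTemperateGrowth.comp this

omit he hω in
/-- Multiplication by the Lorentz form. -/
noncomputable def mulLor (e : V) : 𝓢(V, ℂ) →L[ℂ] 𝓢(V, ℂ) :=
  smulLeftCLM ℂ (fun p : V => (lor e p p : ℂ))

omit he hω in
lemma mulLor_apply (S : 𝓢(V, ℂ)) (p : V) : mulLor e S p = (lor e p p : ℂ) * S p := by
  simp [mulLor, smulLeftCLM_apply_apply lor_self_hasTemperateGrowth]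

omit he hω in
lemma sum_A_A {ι : Type*} [Fintype ι] (b : OrthonormalBasis ι ℝ V) (S : 𝓢(V, ℂ)) :
    ∑ i, A (b i) (A (refl e (b i)) S) = mulLor e S := by
  ext p
  rw [sum_apply, mulLor_apply]
  simp only [A_apply, ← mul_assoc, ← Finset.sum_mul]
  congr 1
  rw [lor_eq_inner_refl, ← b.sum_inner_mul_inner p (refl e p)]
  push_cast
  refine Finset.sum_congr rfl fun i _ => ?_
  congr 2
  simp [refl, inner_sub_left, inner_sub_right, inner_smul_left, inner_smul_right,
    real_inner_comm]
  ring

lemma mulLor_T {ι : Type*} [Fintype ι] (b : OrthonormalBasis ι ℝ V) (α : ℂ) (S : 𝓢(V, ℂ)) :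
    mulLor e (T e ω α S) = T e ω α (mulLor e S) + α • T e ω α
      ((2 : ℂ) • eul b ω (T e ω 2 S) + ((Module.finrank ℝ V : ℂ) - 2 + α) • T e ω 2 S) := by
  have h1 : ∀ i, A (b i) (A (refl e (b i)) (T e ω α S)) =
      T e ω α (A (b i) (A (refl e (b i)) S)) +
      α • T e ω (α + 2) (A (refl e (b i)) (D ω (refl e (b i)) S)) +
      α • T e ω (α + 2) S + α • A (b i) (D ω (b i) (T e ω (α + 2) S)) := fun i => by
    rw [A_T he hω, refl_refl he, map_add, A_T he hω, map_smul, ← T_D he hω _ (refl e (b i)), D_A,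
      map_add]
    have : ⟪refl e (b i), refl e (b i)⟫_ℝ = 1 := by
      rw [← lor_eq_inner_refl, lor_comm, lor_eq_inner_refl, refl_refl he,
        real_inner_self_eq_norm_sq, b.norm_eq_one, one_pow]
    rw [this]
    simp [smul_add, add_assoc]
  rw [← sum_A_A b, Finset.sum_congr rfl fun i _ => h1 i]
  simp only [Finset.sum_add_distrib, ← map_sum, ← Finset.smul_sum, sum_A_A,
    sum_A_refl_D_refl he b]
  have h2 : ∑ i, A (b i) (D ω (b i) (T e ω (α + 2) S)) = eul b ω (T e ω (α + 2) S) := by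
    simp [eul]
  have h3 : Fintype.card ι = Module.finrank ℝ V := by
    rw [Module.finrank_eq_card_basis b.toBasis]
  rw [h2, Finset.sum_const, Finset.card_univ, h3, eul_T he hω, eul_T he hω]
  simp only [map_add, map_sub, map_smul, T_T he hω, smul_add, smul_sub, smul_smul, add_smul, sub_smul,
    ← Nat.cast_smul_eq_nsmul ℂ]
  module

end Operators

section Kernel

variable {V : Type*} [NormedAddCommGroup V] [InnerProductSpace ℝ V] {e : V}
  [FiniteDimensional ℝ V] [MeasurableSpace V] [BorelSpace V]

open SchwartzMap

lemma schwartz_inversion (S : 𝓢(V, ℂ)) (p : V) :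
    S p = ∫ η, Complex.exp ((2 * Real.pi * ⟪η, p⟫_ℝ : ℝ) * Complex.I) * 𝓕 S η := by
  have h : 𝓕⁻ (𝓕 S : 𝓢(V, ℂ)) = S := FourierTransform.fourierInv_fourier_eq S
  conv_lhs => rw [← h]
  rw [fourierInv_coe, Real.fourierInv_eq']
  rfl

variable (he : ‖e‖ = 1)
include he

lemma coneGamma_ofReal_ne_zero {x : ℝ} (hx : 0 ≤ x) : coneGamma e (x : ℂ) ≠ 0 := by
  have hm := axis_mem_cone he
  have hintg := integrableOn_cone_exp he hm (z := (x : ℂ)) (by simpa using hx)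
    (f := fun p => Complex.exp (-(⟪e, p⟫_ℝ : ℂ))) (by fun_prop)
    (fun p => by rw [Complex.norm_exp]; simp)
  have heq : ∀ p ∈ cone e, Complex.exp (-(⟪e, p⟫_ℝ : ℂ)) * (lor e p p : ℂ) ^ (x : ℂ) =
      ((Real.exp (-⟪e, p⟫_ℝ) * lor e p p ^ x : ℝ) : ℂ) := fun p hp => by
    push_cast
    rw [Complex.ofReal_cpow (lor_pos he hp).le]
  have hint2 : IntegrableOn (fun p => Real.exp (-⟪e, p⟫_ℝ) * lor e p p ^ x) (cone e) := by
    refine (hintg.re).congr ?_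
    filter_upwards [ae_restrict_mem (measurableSet_cone e)] with p hp
    rw [heq p hp]
    exact Complex.ofReal_re _
  rw [coneGamma, setIntegral_congr_fun (measurableSet_cone e) heq, integral_complex_ofReal,
    Complex.ofReal_ne_zero]
  refine ne_of_gt ?_
  rw [setIntegral_pos_iff_support_of_nonneg_ae _ hint2]
  · refine lt_of_lt_of_le ((isOpen_cone e).measure_pos volume ⟨e, hm⟩) (measure_mono fun p hp => ?_)
    exact ⟨(mul_pos (Real.exp_pos _) (Real.rpow_pos_of_pos (lor_pos he hp) _)).ne', hp⟩
  · filter_upwards [ae_restrict_mem (measurableSet_cone e)] with p hp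
    exact (mul_pos (Real.exp_pos _) (Real.rpow_pos_of_pos (lor_pos he hp) _)).le

variable {ω : V} (hω : ω ∈ cone e)
include hω

lemma integrable_mult_fourier (α : ℂ) (S : 𝓢(V, ℂ)) (p : V) :
    Integrable fun η => Complex.exp (α * (-Complex.log (clor e ω ((2 * Real.pi) • η)) / 2)) *
      (Complex.exp ((2 * Real.pi * ⟪η, p⟫_ℝ : ℝ) * Complex.I) * 𝓕 S η) := by
  have h := (smulLeftCLM ℂ (mult e ω α) (𝓕 S)).integrable (μ := volume)
  have h2 := h.bdd_mul (c := 1) (f := fun η : V =>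
    Complex.exp ((2 * Real.pi * ⟪η, p⟫_ℝ : ℝ) * Complex.I)) (by fun_prop)
    (.of_forall fun η => by rw [Complex.norm_exp_ofReal_mul_I])
  refine h2.congr (.of_forall fun η => ?_)
  simp only [smulLeftCLM_apply_apply (mult_hasTemperateGrowth he hω α), mult_eq_exp he hω,
    smul_eq_mul]
  ring

lemma T_apply (α : ℂ) (S : 𝓢(V, ℂ)) (p : V) : T e ω α S p =
    ∫ η, Complex.exp (α * (-Complex.log (clor e ω ((2 * Real.pi) • η)) / 2)) *
      (Complex.exp ((2 * Real.pi * ⟪η, p⟫_ℝ : ℝ) * Complex.I) * 𝓕 S η) := by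
  rw [T, fourierMultiplierCLM_apply, fourierInv_coe, Real.fourierInv_eq']
  congr 1
  ext η
  simp only [smulLeftCLM_apply_apply (mult_hasTemperateGrowth he hω α), mult_eq_exp he hω,
    smul_eq_mul]
  ring

lemma continuous_clor : Continuous fun η : V => clor e ω ((2 * Real.pi) • η) :=
  continuous_iff_continuousAt.2 fun η => (hasFDerivAt_clor ω η).continuousAt

lemma differentiable_T (S : 𝓢(V, ℂ)) (p : V) : Differentiable ℂ fun α => T e ω α S p := by
  intro α
  simp only [T_apply he hω]
  refine differentiableAt_integral_cexp (r := 1) ?_ one_pos ?_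
    fun z _ => integrable_mult_fourier he hω z S p
  · exact ((continuous_iff_continuousAt.2 fun η => (continuous_clor he hω).continuousAt.clog
      (clor_mem_slitPlane he hω _)).neg.div_const 2).aestronglyMeasurable
  · have : Continuous fun η => 𝓕 S η := (𝓕 S).continuous
    exact Continuous.aestronglyMeasurable (by fun_prop)

/-- For large order the operator is convolution with a power of the Lorentz form. -/
lemma coneGamma_mul_T {z : ℂ} (hz : 0 ≤ z.re) (S : 𝓢(V, ℂ)) (p : V) :
    coneGamma e z * T e ω (2 * z + Module.finrank ℝ V) S p =
      ∫ p' in cone e, Complex.exp (-(⟪ω, p'⟫_ℝ : ℂ)) * (lor e p' p' : ℂ) ^ z * S (p - p') := by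
  have hintg := integrableOn_cone_exp he hω hz
    (f := fun p => Complex.exp (-(⟪ω, p⟫_ℝ : ℂ))) (by fun_prop)
    (fun p => by rw [Complex.norm_exp]; simp)
  have hS : Integrable (fun η => 𝓕 S η) (volume : Measure V) := (𝓕 S).integrable
  have hprod : Integrable (fun x : V × V => (Complex.exp (-(⟪ω, x.1⟫_ℝ : ℂ)) *
      (lor e x.1 x.1 : ℂ) ^ z) * (Complex.exp ((2 * Real.pi * ⟪x.2, p - x.1⟫_ℝ : ℝ) * Complex.I) *
        𝓕 S x.2)) ((volume.restrict (cone e)).prod volume) := by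
    refine ((hintg.mul_prod hS).bdd_mul (c := 1) (f := fun x : V × V =>
      Complex.exp ((2 * Real.pi * ⟪x.2, p - x.1⟫_ℝ : ℝ) * Complex.I)) (by fun_prop)
      (.of_forall fun η => by rw [Complex.norm_exp_ofReal_mul_I])).congr (.of_forall fun x => ?_)
    simp only; ring
  calc _ = ∫ η, coneGamma e z * (mult e ω (2 * z + Module.finrank ℝ V) η *
        (Complex.exp ((2 * Real.pi * ⟪η, p⟫_ℝ : ℝ) * Complex.I) * 𝓕 S η)) := by
        rw [T_apply he hω, integral_const_mul]
        simp only [mult_eq_exp he hω]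
    _ = ∫ η, ∫ p' in cone e, (Complex.exp (-(⟪ω, p'⟫_ℝ : ℂ)) * (lor e p' p' : ℂ) ^ z) *
        (Complex.exp ((2 * Real.pi * ⟪η, p - p'⟫_ℝ : ℝ) * Complex.I) * 𝓕 S η) := by
        congr 1
        ext η
        rw [mult, ← mul_assoc, show -(2 * z + (Module.finrank ℝ V : ℂ)) / 2 =
          -z - Module.finrank ℝ V / 2 by ring, ← setIntegral_cone_cexp he hω _ hz,
          ← integral_mul_const]
        congr 1
        ext p'
        have : Complex.exp (-((⟪ω, p'⟫_ℝ : ℂ) + ⟪(2 * Real.pi) • η, p'⟫_ℝ * Complex.I)) *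
            Complex.exp ((2 * Real.pi * ⟪η, p⟫_ℝ : ℝ) * Complex.I) =
            Complex.exp (-(⟪ω, p'⟫_ℝ : ℂ)) *
            Complex.exp ((2 * Real.pi * ⟪η, p - p'⟫_ℝ : ℝ) * Complex.I) := by
          rw [← Complex.exp_add, ← Complex.exp_add]
          congr 1
          simp only [inner_smul_left, inner_sub_right]
          push_cast
          simp
          ring
        linear_combination ((lor e p' p' : ℂ) ^ z * 𝓕 S η) * this
    _ = ∫ p' in cone e, ∫ η, (Complex.exp (-(⟪ω, p'⟫_ℝ : ℂ)) * (lor e p' p' : ℂ) ^ z) *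
        (Complex.exp ((2 * Real.pi * ⟪η, p - p'⟫_ℝ : ℝ) * Complex.I) * 𝓕 S η) :=
        (integral_integral_swap hprod).symm
    _ = _ := by
        congr 1
        ext p'
        rw [integral_const_mul, ← schwartz_inversion]

/-- The undone conjugation: the operators do not depend on the conjugating covector, and the
value at `p` only depends on the backward cone of `p`. -/
lemma exp_mul_T_eq {ω₂ : V} (hω₂ : ω₂ ∈ cone e) (α : ℂ) (S S₂ : 𝓢(V, ℂ)) (p : V)
    (h : ∀ p' ∈ cone e, Complex.exp ⟪ω, p - p'⟫_ℝ * S (p - p') =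
      Complex.exp ⟪ω₂, p - p'⟫_ℝ * S₂ (p - p')) :
    Complex.exp ⟪ω, p⟫_ℝ * T e ω α S p = Complex.exp ⟪ω₂, p⟫_ℝ * T e ω₂ α S₂ p := by
  have key : ∀ x : ℝ, 0 ≤ x →
      Complex.exp ⟪ω, p⟫_ℝ * T e ω (2 * (x : ℂ) + Module.finrank ℝ V) S p =
      Complex.exp ⟪ω₂, p⟫_ℝ * T e ω₂ (2 * (x : ℂ) + Module.finrank ℝ V) S₂ p := fun x hx => by
    have hx' : 0 ≤ (x : ℂ).re := by simpa using hx
    refine mul_left_cancel₀ (coneGamma_ofReal_ne_zero he hx) ?_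
    rw [mul_left_comm, coneGamma_mul_T he hω hx', mul_left_comm, coneGamma_mul_T he hω₂ hx',
      ← integral_const_mul, ← integral_const_mul]
    refine setIntegral_congr_fun (measurableSet_cone e) fun p' hp' => ?_
    have h1 := h p' hp'
    have h2 : ∀ w : V, Complex.exp ⟪w, p⟫_ℝ * Complex.exp (-(⟪w, p'⟫_ℝ : ℂ)) =
        Complex.exp ⟪w, p - p'⟫_ℝ := fun w => by
      rw [← Complex.exp_add, inner_sub_right]; push_cast; ring_nf
    rw [← mul_assoc, ← mul_assoc, ← mul_assoc, ← mul_assoc, h2, h2]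
    linear_combination ((lor e p' p' : ℂ) ^ (x : ℂ)) * h1
  set N : ℂ := (Module.finrank ℝ V : ℂ)
  have hf : Differentiable ℂ fun β => Complex.exp ⟪ω, p⟫_ℝ * T e ω (2 * β + N) S p :=
    ((differentiable_T he hω S p).comp (by fun_prop : Differentiable ℂ fun β => 2 * β + N)).const_mul _
  have hg : Differentiable ℂ fun β => Complex.exp ⟪ω₂, p⟫_ℝ * T e ω₂ (2 * β + N) S₂ p :=
    ((differentiable_T he hω₂ S₂ p).comp (by fun_prop : Differentiable ℂ fun β => 2 * β + N)).const_mul _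
  have heq := AnalyticOnNhd.eqOn_of_preconnected_of_frequently_eq (z₀ := (1 : ℂ))
    (fun z _ => hf.analyticAt z) (fun z _ => hg.analyticAt z) isPreconnected_univ (mem_univ _) ?_
  · have := heq (mem_univ ((α - N) / 2))
    simpa [mul_div_cancel₀] using this
  · have ht : Tendsto (fun n : ℕ => (((1 : ℝ) + 1 / ((n : ℝ) + 1) : ℝ) : ℂ)) atTop (𝓝[≠] 1) := by
      refine tendsto_nhdsWithin_iff.2 ⟨?_, .of_forall fun n => ?_⟩
      · have := (tendsto_one_div_add_atTop_nhds_zero_nat (𝕜 := ℝ)).const_add 1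
        rw [add_zero] at this
        exact (Complex.continuous_ofReal.tendsto _).comp this
      · have : (0 : ℝ) < 1 / ((n : ℝ) + 1) := by positivity
        intro h
        have h' : (1 : ℝ) + 1 / ((n : ℝ) + 1) = 1 := Complex.ofReal_injective (by simpa using h)
        linarith
    refine ht.frequently (Frequently.of_forall fun n => ?_)
    exact key _ (by positivity)

lemma norm_mult_le {α : ℂ} (hα : 0 ≤ α.re) (η : V) :
    ‖mult e ω α η‖ ≤ lor e ω ω ^ (-α.re / 2) * Real.exp (Real.pi * |α.im| / 2) := by
  refine (norm_cpow_le (clor_ne_zero he hω _) _).trans ?_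
  have h1 : (-α / 2).re = -α.re / 2 := by simp
  have h2 : |(-α / 2).im| = |α.im| / 2 := by simp [abs_div]
  rw [h1, h2, ← mul_div_assoc]
  refine mul_le_mul_of_nonneg_right ?_ (Real.exp_nonneg _)
  exact Real.rpow_le_rpow_of_nonpos (lor_pos he hω) (lor_le_norm_clor he hω _) (by linarith)

lemma integral_norm_sq_T_le {α : ℂ} (hα : 0 ≤ α.re) (S : 𝓢(V, ℂ)) :
    ∫ p, ‖T e ω α S p‖ ^ 2 ≤
      lor e ω ω ^ (-α.re) * Real.exp (Real.pi * |α.im|) * ∫ p, ‖S p‖ ^ 2 := by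
  have hi : ∀ S : 𝓢(V, ℂ), Integrable (fun p => ‖S p‖ ^ 2) volume := fun S => by
    have := (S.memLp 2 volume).integrable_norm_pow (by norm_num)
    simpa using this
  rw [← integral_norm_sq_fourier, ← integral_norm_sq_fourier S, ← integral_const_mul]
  refine integral_mono (hi _) ((hi _).const_mul _) fun η => ?_
  have : 𝓕 (T e ω α S) η = mult e ω α η * 𝓕 S η := by
    rw [T, fourierMultiplierCLM_apply, FourierTransform.fourier_fourierInv_eq,
      smulLeftCLM_apply_apply (mult_hasTemperateGrowth he hω α), smul_eq_mul]
  simp only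
  rw [this, norm_mul, mul_pow]
  refine mul_le_mul_of_nonneg_right ?_ (sq_nonneg _)
  calc _ ≤ (lor e ω ω ^ (-α.re / 2) * Real.exp (Real.pi * |α.im| / 2)) ^ 2 := by
        gcongr; exact norm_mult_le he hω hα η
    _ = _ := by
        rw [mul_pow, ← Real.rpow_mul_natCast (lor_pos he hω).le, ← Real.exp_nat_mul]
        congr 2 <;> push_cast <;> ring

lemma norm_coneGamma_mul_T_le (y : ℝ) (S : 𝓢(V, ℂ)) (p : V) :
    ‖coneGamma e (y * Complex.I)‖ * ‖T e ω (2 * (y * Complex.I) + Module.finrank ℝ V) S p‖ ≤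
      ∫ p' in cone e, Real.exp (-⟪ω, p'⟫_ℝ) * ‖S (p - p')‖ := by
  rw [← norm_mul, coneGamma_mul_T he hω (by simp)]
  refine (norm_integral_le_integral_norm _).trans (le_of_eq ?_)
  refine setIntegral_congr_fun (measurableSet_cone e) fun p' hp' => ?_
  simp only [norm_mul, Complex.norm_exp]
  rw [Complex.norm_cpow_eq_rpow_re_of_pos (lor_pos he hp')]
  simp

end Kernel

section Riesz

variable {V : Type*} [NormedAddCommGroup V] [InnerProductSpace ℝ V] {e : V}
  [FiniteDimensional ℝ V] [MeasurableSpace V] [BorelSpace V]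

open SchwartzMap

/-- `S` is the function `F` multiplied by `exp (-⟪ω, ·⟫)`. -/
def IsConj (ω : V) (F : V → ℂ) (S : 𝓢(V, ℂ)) : Prop :=
  ∀ p, S p = Complex.exp (-(⟪ω, p⟫_ℝ : ℂ)) * F p

/-- Functions supported in a translate of the cone into its interior, all of whose exponential
conjugates are Schwartz functions. -/
structure Cls (e : V) (F : V → ℂ) : Prop where
  supp : ∃ ε : ℝ, 0 < ε ∧ ∀ p, F p ≠ 0 → p - ε • e ∈ ccone e
  conj : ∀ ω ∈ cone e, ∃ S : 𝓢(V, ℂ), IsConj ω F S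

open Classical in
/-- The Riesz operator of order `α`, a convolution operator with Fourier multiplier
`(-lor) ^ (-α/2)`. -/
noncomputable def RP (e : V) (α : ℂ) (F : V → ℂ) (p : V) : ℂ :=
  if h : ∃ S : 𝓢(V, ℂ), IsConj e F S then Complex.exp ⟪e, p⟫_ℝ * T e e α h.choose p else 0

/-- The Euler operator. -/
noncomputable def euler (F : V → ℂ) (p : V) : ℂ := fderiv ℝ F p p

/-- The wave operator. -/
noncomputable def box {ι G : Type*} [NormedAddCommGroup G] [NormedSpace ℝ G] [Fintype ι] (e : V)
    (b : OrthonormalBasis ι ℝ V) (F : V → G) (p : V) : G :=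
  ∑ i, fderiv ℝ (fun y => fderiv ℝ F y (refl e (b i))) p (b i)

lemma exp_mul_exp_neg (x : ℝ) : Complex.exp (x : ℂ) * Complex.exp (-(x : ℂ)) = 1 := by
  rw [← Complex.exp_add]; simp

lemma IsConj.eq {ω : V} {F : V → ℂ} {S : 𝓢(V, ℂ)} (h : IsConj ω F S) (p : V) :
    F p = Complex.exp (⟪ω, p⟫_ℝ : ℂ) * S p := by
  rw [h, ← mul_assoc, exp_mul_exp_neg, one_mul]

lemma isConj_iff {ω : V} {F : V → ℂ} {S : 𝓢(V, ℂ)} :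
    IsConj ω F S ↔ ∀ p, F p = Complex.exp (⟪ω, p⟫_ℝ : ℂ) * S p := by
  refine ⟨fun h => h.eq, fun h p => ?_⟩
  rw [h, ← mul_assoc, mul_comm (Complex.exp _), exp_mul_exp_neg, one_mul]

lemma hasFDerivAt_exp_inner (ω p : V) : HasFDerivAt (fun p : V => Complex.exp (⟪ω, p⟫_ℝ : ℂ))
    (Complex.exp (⟪ω, p⟫_ℝ : ℂ) • (Complex.ofRealCLM ∘L innerSL ℝ ω)) p :=
  (Complex.ofRealCLM ∘L innerSL ℝ ω).hasFDerivAt.cexp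

lemma IsConj.hasFDerivAt {ω : V} {F : V → ℂ} {S : 𝓢(V, ℂ)} (h : IsConj ω F S) (p : V) :
    HasFDerivAt F (Complex.exp (⟪ω, p⟫_ℝ : ℂ) • fderiv ℝ S p + S p •
      (Complex.exp (⟪ω, p⟫_ℝ : ℂ) • (Complex.ofRealCLM ∘L innerSL ℝ ω))) p :=
  ((hasFDerivAt_exp_inner ω p).mul S.differentiableAt.hasFDerivAt).congr_of_eventuallyEq
    (.of_forall h.eq)

lemma IsConj.fderiv {ω : V} {F : V → ℂ} {S : 𝓢(V, ℂ)} (h : IsConj ω F S) (v : V) :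
    IsConj ω (fun p => fderiv ℝ F p v) (D ω v S) := by
  rw [isConj_iff]
  intro p
  rw [(h.hasFDerivAt p).fderiv, D_apply]
  simp
  ring

lemma IsConj.euler {ι : Type*} [Fintype ι] (b : OrthonormalBasis ι ℝ V)
    {ω : V} {F : V → ℂ} {S : 𝓢(V, ℂ)} (h : IsConj ω F S) : IsConj ω (euler F) (eul b ω S) := by
  rw [isConj_iff]
  intro p
  rw [LightCone.euler, (h.hasFDerivAt p).fderiv, eul_apply]
  simp
  ring

lemma IsConj.add {ω : V} {F G : V → ℂ} {S R : 𝓢(V, ℂ)} (h : IsConj ω F S) (h' : IsConj ω G R) :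
    IsConj ω (fun p => F p + G p) (S + R) := fun p => by
  rw [add_apply, h p, h' p, mul_add]

lemma IsConj.const_mul {ω : V} {F : V → ℂ} {S : 𝓢(V, ℂ)} (c : ℂ) (h : IsConj ω F S) :
    IsConj ω (fun p => c * F p) (c • S) := fun p => by
  rw [smul_apply, h p, smul_eq_mul]; ring

lemma IsConj.sum {κ : Type*} {s : Finset κ} {ω : V} {F : κ → V → ℂ} {S : κ → 𝓢(V, ℂ)}
    (h : ∀ i ∈ s, IsConj ω (F i) (S i)) : IsConj ω (fun p => ∑ i ∈ s, F i p) (∑ i ∈ s, S i) :=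
  fun p => by
  rw [sum_apply, Finset.mul_sum]
  exact Finset.sum_congr rfl fun i hi => h i hi p

lemma IsConj.mulLor {ω : V} {F : V → ℂ} {S : 𝓢(V, ℂ)} (h : IsConj ω F S) :
    IsConj ω (fun p => (lor e p p : ℂ) * F p) (mulLor e S) := fun p => by
  rw [mulLor_apply, h p]; ring

lemma IsConj.box {ι : Type*} [Fintype ι] (b : OrthonormalBasis ι ℝ V)
    {ω : V} {F : V → ℂ} {S : 𝓢(V, ℂ)} (h : IsConj ω F S) :
    IsConj ω (box e b F) (∑ i, D ω (b i) (D ω (refl e (b i)) S)) :=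
  IsConj.sum fun i _ => (h.fderiv _).fderiv _

lemma IsConj.contDiff {ω : V} {F : V → ℂ} {S : 𝓢(V, ℂ)} (h : IsConj ω F S) :
    ContDiff ℝ (⊤ : ℕ∞) F := by
  rw [funext h.eq]
  have : ContDiff ℝ (⊤ : ℕ∞) fun p : V => Complex.exp (⟪ω, p⟫_ℝ : ℂ) :=
    (Complex.ofRealCLM ∘L innerSL ℝ ω).contDiff.cexp
  exact this.mul (S.smooth _)

lemma tsupport_of_supp {G : Type*} [Zero G] {ε : ℝ} {F : V → G} (h : ∀ p, F p ≠ 0 → p - ε • e ∈ ccone e) {p : V}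
    (hp : p ∈ tsupport F) : p - ε • e ∈ ccone e := by
  have : tsupport F ⊆ (fun p => p - ε • e) ⁻¹' ccone e :=
    closure_minimal h ((isClosed_ccone e).preimage (by fun_prop))
  exact this hp

lemma fderiv_supp {ε : ℝ} {F : V → ℂ} (h : ∀ p, F p ≠ 0 → p - ε • e ∈ ccone e) (v : V) (p : V)
    (hp : fderiv ℝ F p v ≠ 0) : p - ε • e ∈ ccone e := by
  refine tsupport_of_supp h (support_fderiv_subset ℝ (f := F) ?_)
  intro h0
  exact hp (by rw [h0]; rfl)

lemma euler_supp {ε : ℝ} {F : V → ℂ} (h : ∀ p, F p ≠ 0 → p - ε • e ∈ ccone e) (p : V)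
    (hp : euler F p ≠ 0) : p - ε • e ∈ ccone e :=
  fderiv_supp h p p hp

lemma box_supp {ι : Type*} [Fintype ι] (b : OrthonormalBasis ι ℝ V) {ε : ℝ} {F : V → ℂ}
    (h : ∀ p, F p ≠ 0 → p - ε • e ∈ ccone e) (p : V)
    (hp : box e b F p ≠ 0) : p - ε • e ∈ ccone e := by
  obtain ⟨i, -, hi⟩ := Finset.exists_ne_zero_of_sum_ne_zero hp
  exact fderiv_supp (fderiv_supp h _) _ _ hi

lemma ccone_mono {ε δ : ℝ} (he : ‖e‖ = 1) (hδ : δ ≤ ε) {p : V} (hp : p - ε • e ∈ ccone e) :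
    p - δ • e ∈ ccone e := by
  have h : (ε - δ) • e ∈ ccone e := by
    rcases hδ.eq_or_lt with rfl | h
    · simp [ccone, sp]
    · exact cone_subset_ccone e (smul_mem_cone (sub_pos.2 h) (axis_mem_cone he))
  have := add_mem_ccone hp h
  convert this using 1
  module

namespace Cls

variable {F G : V → ℂ} (hF : Cls e F)
include hF

lemma contDiff (he : ‖e‖ = 1) : ContDiff ℝ (⊤ : ℕ∞) F :=
  (hF.conj e (axis_mem_cone he)).choose_spec.contDiff

lemma const_mul (c : ℂ) : Cls e (fun p => c * F p) where
  supp := by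
    obtain ⟨ε, h0, h⟩ := hF.supp
    exact ⟨ε, h0, fun p hp => h p (right_ne_zero_of_mul hp)⟩
  conj ω hω := by
    obtain ⟨S, hS⟩ := hF.conj ω hω
    exact ⟨_, hS.const_mul c⟩

lemma mulLor : Cls e (fun p => (lor e p p : ℂ) * F p) where
  supp := by
    obtain ⟨ε, h0, h⟩ := hF.supp
    exact ⟨ε, h0, fun p hp => h p (right_ne_zero_of_mul hp)⟩
  conj ω hω := by
    obtain ⟨S, hS⟩ := hF.conj ω hω
    exact ⟨_, hS.mulLor⟩

lemma euler : Cls e (euler F) where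
  supp := by
    obtain ⟨ε, h0, h⟩ := hF.supp
    exact ⟨ε, h0, euler_supp h⟩
  conj ω hω := by
    obtain ⟨S, hS⟩ := hF.conj ω hω
    exact ⟨_, hS.euler (stdOrthonormalBasis ℝ V)⟩

lemma box {ι : Type*} [Fintype ι] (b : OrthonormalBasis ι ℝ V) : Cls e (box e b F) where
  supp := by
    obtain ⟨ε, h0, h⟩ := hF.supp
    exact ⟨ε, h0, box_supp b h⟩
  conj ω hω := by
    obtain ⟨S, hS⟩ := hF.conj ω hω
    exact ⟨_, hS.box b⟩

lemma add (he : ‖e‖ = 1) (hG : Cls e G) : Cls e (fun p => F p + G p) where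
  supp := by
    obtain ⟨ε, h0, h⟩ := hF.supp
    obtain ⟨δ, h1, h'⟩ := hG.supp
    refine ⟨min ε δ, lt_min h0 h1, fun p hp => ?_⟩
    by_cases hz : F p = 0
    · exact ccone_mono he (min_le_right _ _) (h' p fun h2 => hp (by rw [hz, h2, add_zero]))
    · exact ccone_mono he (min_le_left _ _) (h p hz)
  conj ω hω := by
    obtain ⟨S, hS⟩ := hF.conj ω hω
    obtain ⟨R, hR⟩ := hG.conj ω hω
    exact ⟨_, hS.add hR⟩

variable (he : ‖e‖ = 1)
include he

lemma isConj_RP {ω : V} (hω : ω ∈ cone e) (α : ℂ) {S : 𝓢(V, ℂ)} (hS : IsConj ω F S) :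
    IsConj ω (RP e α F) (T e ω α S) := by
  rw [isConj_iff]
  intro p
  have h := hF.conj e (axis_mem_cone he)
  rw [RP, dif_pos h]
  refine exp_mul_T_eq he (axis_mem_cone he) hω α _ S p fun p' _ => ?_
  rw [← hS.eq, ← h.choose_spec.eq]

lemma RP_eq_zero (α : ℂ) {p : V} (h : ∀ p' ∈ cone e, F (p - p') = 0) : RP e α F p = 0 := by
  obtain ⟨S, hS⟩ := hF.conj e (axis_mem_cone he)
  rw [(hF.isConj_RP he (axis_mem_cone he) α hS).eq, exp_mul_T_eq he (axis_mem_cone he)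
    (axis_mem_cone he) α S 0 p fun p' hp' => by rw [← hS.eq, h p' hp']; simp]
  simp

lemma RP_supp (α : ℂ) {ε : ℝ} (h : ∀ p, F p ≠ 0 → p - ε • e ∈ ccone e) (p : V)
    (hp : RP e α F p ≠ 0) : p - ε • e ∈ ccone e := by
  by_contra hc
  refine hp (hF.RP_eq_zero he α fun p' hp' => ?_)
  by_contra h2
  have := add_mem_ccone (h _ h2) (cone_subset_ccone e hp')
  refine hc ?_
  convert this using 1
  module

lemma RP (α : ℂ) : Cls e (RP e α F) where
  supp := by
    obtain ⟨ε, h0, h⟩ := hF.supp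
    exact ⟨ε, h0, hF.RP_supp he α h⟩
  conj ω hω := by
    obtain ⟨S, hS⟩ := hF.conj ω hω
    exact ⟨_, hF.isConj_RP he hω α hS⟩

lemma box_RP {ι : Type*} [Fintype ι] (b : OrthonormalBasis ι ℝ V) (p : V) :
    LightCone.box e b (LightCone.RP e 2 F) p = F p := by
  have hm := axis_mem_cone he
  obtain ⟨S, hS⟩ := hF.conj e hm
  have h := (hF.isConj_RP he hm 2 hS).box (e := e) b
  have h2 := sum_D_D he hm b 0 S
  rw [zero_add, T_zero he hm] at h2
  rw [h.eq, h2, hS.eq]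

lemma RP_box {ι : Type*} [Fintype ι] (b : OrthonormalBasis ι ℝ V) (p : V) :
    LightCone.RP e 2 (LightCone.box e b F) p = F p := by
  have hm := axis_mem_cone he
  obtain ⟨S, hS⟩ := hF.conj e hm
  have h := (hF.box b).isConj_RP he hm 2 (hS.box b)
  have h2 := sum_D_D he hm b 0 S
  rw [zero_add, T_zero he hm] at h2
  have h3 := h2
  simp only [← T_D he hm, ← map_sum] at h3
  rw [h.eq, hS.eq, h3]

lemma lor_mul_RP (α : ℂ) (p : V) :
    (lor e p p : ℂ) * LightCone.RP e α F p =
      LightCone.RP e α (fun p => (lor e p p : ℂ) * F p) p + α * LightCone.RP e α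
      (fun p => 2 * LightCone.euler (LightCone.RP e 2 F) p +
        ((Module.finrank ℝ V : ℂ) - 2 + α) * LightCone.RP e 2 F p) p := by
  have hm := axis_mem_cone he
  obtain ⟨S, hS⟩ := hF.conj e hm
  set b := stdOrthonormalBasis ℝ V
  have h2 := hF.isConj_RP he hm 2 hS
  have h3 := (((hF.RP he 2).euler.const_mul 2).add he
    ((hF.RP he 2).const_mul ((Module.finrank ℝ V : ℂ) - 2 + α))).isConj_RP he hm α
    (((h2.euler b).const_mul 2).add (h2.const_mul ((Module.finrank ℝ V : ℂ) - 2 + α)))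
  have h4 := hF.mulLor.isConj_RP he hm α hS.mulLor
  have h5 := (hF.isConj_RP he hm α hS).mulLor (e := e)
  rw [h5.eq, h4.eq, h3.eq, mulLor_T he hm b]
  simp
  ring

lemma RP_sum {κ : Type*} {s : Finset κ} {H : κ → V → ℂ} (hH : ∀ i ∈ s, Cls e (H i)) (c : κ → ℂ)
    (hsum : ∀ p, F p = ∑ i ∈ s, c i * H i p) (α : ℂ) (p : V) :
    LightCone.RP e α F p = ∑ i ∈ s, c i * LightCone.RP e α (H i) p := by
  have hm := axis_mem_cone he
  choose! S hS using fun i (hi : i ∈ s) => (hH i hi).conj e hm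
  have h1 : IsConj e F (∑ i ∈ s, c i • S i) := by
    rw [funext hsum]
    exact IsConj.sum fun i hi => (hS i hi).const_mul (c i)
  rw [(hF.isConj_RP he hm α h1).eq, map_sum, sum_apply, Finset.mul_sum]
  refine Finset.sum_congr rfl fun i hi => ?_
  rw [((hH i hi).isConj_RP he hm α (hS i hi)).eq, map_smul, smul_apply, smul_eq_mul]
  ring

lemma differentiable_RP (p : V) : Differentiable ℂ fun α => LightCone.RP e α F p := by
  have hm := axis_mem_cone he
  obtain ⟨S, hS⟩ := hF.conj e hm
  simp only [fun α => (hF.isConj_RP he hm α hS).eq p]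
  exact (differentiable_T he hm S p).const_mul _

end Cls

lemma exists_supp_of_compact {K : Set V} (hK : IsCompact K) (hKc : K ⊆ cone e) (he : ‖e‖ = 1) :
    ∃ ε : ℝ, 0 < ε ∧ ∀ p ∈ K, p - ε • e ∈ ccone e := by
  rcases K.eq_empty_or_nonempty with rfl | hne
  · exact ⟨1, one_pos, by simp⟩
  obtain ⟨q, hq, hmin⟩ := hK.exists_isMinOn hne
    (f := fun p => ⟪e, p⟫_ℝ - ‖sp e p‖) (by have := continuous_sp e; fun_prop)
  refine ⟨⟪e, q⟫_ℝ - ‖sp e q‖, sub_pos.2 (hKc hq), fun p hp => ?_⟩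
  have h := hmin hp
  simp only [mem_ofPred_eq] at h
  have h1 : sp e (p - (⟪e, q⟫_ℝ - ‖sp e q‖) • e) = sp e p := by
    simp [sp, inner_sub_right, inner_smul_right, he, sub_smul]
  show ‖sp e _‖ ≤ ⟪e, _⟫_ℝ
  rw [h1, inner_sub_right, inner_smul_right, real_inner_self_eq_norm_sq, he]
  linarith

lemma Cls.of_compact (he : ‖e‖ = 1) {F : V → ℂ} (hF : ContDiff ℝ (⊤ : ℕ∞) F)
    (hc : HasCompactSupport F) (hs : tsupport F ⊆ cone e) : Cls e F where
  supp := by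
    obtain ⟨ε, h0, h⟩ := exists_supp_of_compact hc hs he
    exact ⟨ε, h0, fun p hp => h p (subset_tsupport F hp)⟩
  conj ω hω := by
    have h1 : ContDiff ℝ (⊤ : ℕ∞) fun p : V => Complex.exp (-(⟪ω, p⟫_ℝ : ℂ)) * F p := by
      have : ContDiff ℝ (⊤ : ℕ∞) fun p : V => Complex.exp (-(⟪ω, p⟫_ℝ : ℂ)) :=
        (Complex.ofRealCLM ∘L innerSL ℝ ω).contDiff.neg.cexp
      exact this.mul hF
    have h2 : HasCompactSupport fun p : V => Complex.exp (-(⟪ω, p⟫_ℝ : ℂ)) * F p :=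
      hc.mul_left
    exact ⟨h2.toSchwartzMap h1, fun p => rfl⟩

end Riesz

section Energy

variable {V : Type*} [NormedAddCommGroup V] [InnerProductSpace ℝ V] {e : V}
  [FiniteDimensional ℝ V] [MeasurableSpace V] [BorelSpace V] {ι : Type*} [Fintype ι]
  (b : OrthonormalBasis ι ℝ V)

lemma integral_fderiv_eq_zero {f : V → ℝ} (hf : ContDiff ℝ 1 f) (hc : HasCompactSupport f) (v : V) :
    ∫ p, fderiv ℝ f p v = 0 := by
  have h := integral_mul_fderiv_eq_neg_fderiv_mul_of_integrable (μ := volume) (𝕜 := ℝ)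
    (f := fun _ : V => (1 : ℝ)) (g := f) (v := v) (by simp) ?_ ?_ (by intros; fun_prop)
    (fun x _ => hf.differentiable one_ne_zero x)
  · simpa using h
  · simp only [one_mul]
    exact ((hf.continuous_fderiv one_ne_zero).clm_apply continuous_const).integrable_of_hasCompactSupport
      (hc.fderiv_apply (𝕜 := ℝ) v)
  · simp only [one_mul]
    exact hf.continuous.integrable_of_hasCompactSupport hc

lemma integral_fderiv_mul {f g : V → ℝ} (hf : ContDiff ℝ 1 f) (hc : HasCompactSupport f)
    (hg : ContDiff ℝ 1 g) (v : V) :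
    ∫ p, f p * fderiv ℝ g p v = - ∫ p, fderiv ℝ f p v * g p := by
  have hf' := (hf.continuous_fderiv one_ne_zero).clm_apply (continuous_const (y := v))
  have hg' := (hg.continuous_fderiv one_ne_zero).clm_apply (continuous_const (y := v))
  refine integral_mul_fderiv_eq_neg_fderiv_mul_of_integrable ?_ ?_ ?_
    (fun x _ => hf.differentiable one_ne_zero x) (fun x _ => hg.differentiable one_ne_zero x)
  · exact (hf'.mul hg.continuous).integrable_of_hasCompactSupport
      ((hc.fderiv_apply (𝕜 := ℝ) v).mul_right)
  · exact (hf.continuous.mul hg').integrable_of_hasCompactSupport hc.mul_right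
  · exact (hf.continuous.mul hg.continuous).integrable_of_hasCompactSupport hc.mul_right

include b in
lemma integral_euler {f : V → ℝ} (hf : ContDiff ℝ 1 f) (hc : HasCompactSupport f) :
    ∫ p, fderiv ℝ f p p = - Module.finrank ℝ V * ∫ p, f p := by
  have h1 : ∀ p, fderiv ℝ f p p = ∑ i, ⟪b i, p⟫_ℝ * fderiv ℝ f p (b i) := fun p => by
    conv_lhs => arg 2; rw [← b.sum_repr' p]
    simp
  have h2 : ∀ i, ∫ p, fderiv ℝ f p (b i) * ⟪b i, p⟫_ℝ = - ∫ p, f p := fun i => by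
    have := integral_fderiv_mul hf hc (g := fun p => ⟪b i, p⟫_ℝ)
      (contDiff_const.inner ℝ contDiff_id) (b i)
    have h3 : ∀ p, fderiv ℝ (fun p => ⟪b i, p⟫_ℝ) p (b i) = 1 := fun p => by
      have h4 : HasFDerivAt (fun p => ⟪b i, p⟫_ℝ) (innerSL ℝ (b i)) p :=
        (innerSL ℝ (b i)).hasFDerivAt
      rw [h4.fderiv]
      simp
    simp only [h3, mul_one] at this
    linarith
  simp only [h1]
  rw [integral_finsetSum]
  · simp only [mul_comm ⟪b _, _⟫_ℝ, h2]
    simp [Module.finrank_eq_card_basis b.toBasis]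
  · intro i _
    exact Continuous.integrable_of_hasCompactSupport (by
      have := hf.continuous_fderiv one_ne_zero
      fun_prop) ((hc.fderiv_apply (𝕜 := ℝ) (b i)).mul_left)

/-- The gradient, expanded in an orthonormal basis. -/
noncomputable def grad (u : V → ℝ) (p : V) : V := ∑ i, fderiv ℝ u p (b i) • b i

lemma inner_grad (u : V → ℝ) (p v : V) : ⟪grad b u p, v⟫_ℝ = fderiv ℝ u p v := by
  conv_rhs => rw [← b.sum_repr' v]
  simp only [grad, sum_inner, inner_smul_left, map_sum, map_smul, smul_eq_mul]
  refine Finset.sum_congr rfl fun i _ => ?_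
  simp [mul_comm]

lemma contDiff_grad {u : V → ℝ} (hu : ContDiff ℝ (⊤ : ℕ∞) u) : ContDiff ℝ (⊤ : ℕ∞) (grad b u) := by
  refine ContDiff.sum fun i _ => ?_
  have : ContDiff ℝ (⊤ : ℕ∞) (fderiv ℝ u) := hu.fderiv_right (m := (⊤ : ℕ∞)) (by simp)
  fun_prop

lemma inner_fderiv_grad {u : V → ℝ} (hu : ContDiff ℝ (⊤ : ℕ∞) u) (p v w : V) :
    ⟪fderiv ℝ (grad b u) p v, w⟫_ℝ = fderiv ℝ (fun y => fderiv ℝ u y w) p v := by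
  have h := ((contDiff_grad b hu).differentiable (by simp) p).hasFDerivAt.inner ℝ
    (hasFDerivAt_const w p)
  simp only [inner_grad] at h
  rw [h.fderiv]
  simp

lemma inner_fderiv_grad_symm {u : V → ℝ} (hu : ContDiff ℝ (⊤ : ℕ∞) u) (p v w : V) :
    ⟪fderiv ℝ (grad b u) p v, w⟫_ℝ = ⟪v, fderiv ℝ (grad b u) p w⟫_ℝ := by
  have hd : DifferentiableAt ℝ (fderiv ℝ u) p :=
    (hu.fderiv_right (m := (⊤ : ℕ∞)) (by simp)).differentiable (by simp) p
  have h : ∀ v w, fderiv ℝ (fun y => fderiv ℝ u y w) p v = fderiv ℝ (fderiv ℝ u) p v w := by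
    intro v w
    rw [fderiv_clm_apply hd (by fun_prop)]
    simp
  rw [real_inner_comm _ v, inner_fderiv_grad b hu, inner_fderiv_grad b hu, h, h]
  exact (hu.contDiffAt.isSymmSndFDerivAt
    (by simpa using WithTop.coe_le_coe.2 (le_top (a := (2 : ℕ∞))))).eq v w

lemma integral_mul_box {f u : V → ℝ} (hf : ContDiff ℝ 1 f) (hc : HasCompactSupport f)
    (hu : ContDiff ℝ (⊤ : ℕ∞) u) :
    ∫ p, f p * box e b u p = - ∫ p, lor e (grad b f p) (grad b u p) := by
  have hu' : ContDiff ℝ (⊤ : ℕ∞) (fderiv ℝ u) := hu.fderiv_right (m := (⊤ : ℕ∞)) (by simp)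
  have hf' := hf.continuous_fderiv one_ne_zero
  have h1 : ∀ v, ContDiff ℝ (⊤ : ℕ∞) fun y => fderiv ℝ u y v := fun v => by fun_prop
  have h2 : ∀ p, lor e (grad b f p) (grad b u p)
      = ∑ i, fderiv ℝ f p (b i) * fderiv ℝ u p (refl e (b i)) := fun p => by
    rw [lor_eq_inner_refl, ← b.sum_inner_mul_inner]
    refine Finset.sum_congr rfl fun i _ => ?_
    rw [inner_grad, ← lor_eq_inner_refl, lor_comm, lor_eq_inner_refl, inner_grad]
  simp only [h2, box, Finset.mul_sum]
  rw [integral_finsetSum, integral_finsetSum, ← Finset.sum_neg_distrib]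
  · exact Finset.sum_congr rfl fun i _ => integral_fderiv_mul hf hc ((h1 _).of_le (by simp)) (b i)
  · intro i _
    exact Continuous.integrable_of_hasCompactSupport (by
      have := hu'.continuous
      fun_prop) ((hc.fderiv_apply (𝕜 := ℝ) (b i)).mul_right)
  · intro i _
    refine Continuous.integrable_of_hasCompactSupport ?_ hc.mul_right
    have h3 := (h1 (refl e (b i))).continuous_fderiv (by simp)
    have := hf.continuous
    fun_prop

lemma hasFDerivAt_lor (p : V) : HasFDerivAt (fun p : V => lor e p p)
    ((2 : ℝ) • innerSL ℝ (refl e p)) p := by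
  have h : HasFDerivAt (fun p : V => ⟪e, p⟫_ℝ) (innerSL ℝ e) p := (innerSL ℝ e).hasFDerivAt
  have h2 := ((h.const_mul 2).mul h).sub ((hasFDerivAt_id p).inner ℝ (hasFDerivAt_id p))
  refine h2.congr_fderiv ?_
  ext v
  simp [refl, inner_sub_left, inner_smul_left, real_inner_comm v p]
  ring

lemma hasFDerivAt_comp_lor {Ψ : ℝ → ℝ} (hΨ : Differentiable ℝ Ψ) (p : V) :
    HasFDerivAt (fun p : V => Ψ (lor e p p))
      ((2 * deriv Ψ (lor e p p)) • innerSL ℝ (refl e p)) p := by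
  have := HasDerivAt.comp_hasFDerivAt (f := fun p : V => lor e p p) p
    (hΨ (lor e p p)).hasDerivAt (hasFDerivAt_lor (e := e) p)
  refine this.congr_fderiv ?_
  rw [smul_smul, mul_comm]

lemma contDiff_lor {n : WithTop ℕ∞} : ContDiff ℝ n fun p : V => lor e p p := by
  unfold lor
  have : ContDiff ℝ n fun p : V => ⟪e, p⟫_ℝ := contDiff_const.inner ℝ contDiff_id
  exact ((contDiff_const.mul this).mul this).sub (contDiff_id.inner ℝ contDiff_id)

variable (he : ‖e‖ = 1)
include he

lemma isCompact_trunc {ε : ℝ} (hε : 0 < ε) (R : ℝ) :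
    IsCompact {p : V | p - ε • e ∈ ccone e ∧ lor e p p ≤ R} := by
  refine Metric.isCompact_of_isClosed_isBounded ?_ ?_
  · exact ((isClosed_ccone e).preimage (by fun_prop)).inter
      (isClosed_le (continuous_lor e) continuous_const)
  · refine (Metric.isBounded_closedBall (x := (0 : V)) (r := 2 * (ε + R / ε))).subset ?_
    rintro p ⟨hp, hR⟩
    obtain ⟨h1, h2⟩ := (mem_ccone_iff he).1 hp
    have h3 := inner_self_axis he
    have h4 : lor e (p - ε • e) (p - ε • e) = lor e p p - 2 * ε * ⟪e, p⟫_ℝ + ε ^ 2 := by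
      simp only [lor_sub_left, lor_sub_right, lor_smul_left, lor_smul_right, lor_axis he,
        lor_comm e p e, h3]; ring
    have h5 : ⟪e, p - ε • e⟫_ℝ = ⟪e, p⟫_ℝ - ε := by simp [inner_sub_right, inner_smul_right, h3, he]
    rw [h4] at h2
    rw [h5] at h1
    have h6 : ⟪e, p⟫_ℝ ≤ ε + R / ε := by
      have : ε * ⟪e, p⟫_ℝ ≤ ε * (ε + R / ε) := by
        rw [mul_add, mul_div_cancel₀ _ hε.ne']; nlinarith
      exact le_of_mul_le_mul_left this hε
    have h7 := norm_sq_eq_sp he p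
    have h8 : p ∈ ccone e := by
      have := add_mem_ccone hp (smul_mem_cone hε (axis_mem_cone he) |> cone_subset_ccone e)
      simpa using this
    have h9 : ‖sp e p‖ ≤ ⟪e, p⟫_ℝ := h8
    have h10 := norm_nonneg (sp e p)
    rw [mem_closedBall_zero_iff]
    refine abs_le_of_sq_le_sq' ?_ (by linarith) |>.2
    nlinarith

variable {ε R : ℝ} (hε : 0 < ε)
include hε

lemma hasCompactSupport_trunc {H : V → ℝ} (hH : ∀ p, H p ≠ 0 → p - ε • e ∈ ccone e ∧ lor e p p ≤ R) :
    HasCompactSupport H :=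
  HasCompactSupport.intro (isCompact_trunc he hε R) fun p hp => by
    by_contra h
    exact hp (hH p h)

lemma integrable_trunc {H : V → ℝ} (hc : Continuous H)
    (hH : ∀ p, H p ≠ 0 → p - ε • e ∈ ccone e ∧ lor e p p ≤ R) : Integrable H :=
  hc.integrable_of_hasCompactSupport (hasCompactSupport_trunc he hε hH)

omit hε in
lemma deriv_eq_zero_of_lt {Ψ : ℝ → ℝ} (hR : ∀ s, R < s → Ψ s = 0) {s : ℝ} (hs : R < s) :
    deriv Ψ s = 0 := by
  have : Ψ =ᶠ[𝓝 s] fun _ => 0 := by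
    filter_upwards [Ioi_mem_nhds hs] with x hx using hR x hx
  rw [this.deriv_eq]; simp

omit he hε in
lemma eventuallyEq_zero_of_supp {u : V → ℝ} (hs : ∀ p, u p ≠ 0 → p - ε • e ∈ ccone e) {p : V}
    (hp : p - ε • e ∉ ccone e) : u =ᶠ[𝓝 p] fun _ => 0 :=
  notMem_tsupport_iff_eventuallyEq.1 fun h => hp (tsupport_of_supp hs h)

omit he hε in
lemma grad_eventuallyEq_zero {u : V → ℝ} (hs : ∀ p, u p ≠ 0 → p - ε • e ∈ ccone e) {p : V}
    (hp : p - ε • e ∉ ccone e) : grad b u =ᶠ[𝓝 p] fun _ => 0 := by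
  have h := (eventuallyEq_zero_of_supp hs hp).eventuallyEq_nhds
  filter_upwards [h] with y hy
  simp [grad, hy.fderiv_eq]

omit hε he in
lemma lor_zero (p : V) : lor e p 0 = 0 := by simp [lor]

omit hε he in
lemma integral_lin2 {f g : V → ℝ} (hf : Integrable f) (hg : Integrable g) (a c : ℝ) :
    ∫ p, (a * f p + c * g p) = a * (∫ p, f p) + c * ∫ p, g p := by
  rw [integral_add (hf.const_mul a) (hg.const_mul c), integral_const_mul, integral_const_mul]

omit hε he in
lemma integral_lin3 {f g h : V → ℝ} (hf : Integrable f) (hg : Integrable g) (hh : Integrable h)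
    (a c d : ℝ) :
    ∫ p, (a * f p + c * g p + d * h p) = a * (∫ p, f p) + c * (∫ p, g p) + d * ∫ p, h p := by
  rw [integral_add (f := fun p => a * f p + c * g p) ((hf.const_mul a).add (hg.const_mul c))
    (hh.const_mul d), integral_lin2 hf hg, integral_const_mul]

/-- The multiplier identity for the wave operator with multiplier `Ψ(lor p p) (E + ρ)`. -/
theorem energy_identity {u : V → ℝ} {Ψ : ℝ → ℝ} (hu : ContDiff ℝ (⊤ : ℕ∞) u)
    (hs : ∀ p, u p ≠ 0 → p - ε • e ∈ ccone e) (hΨ : ContDiff ℝ (⊤ : ℕ∞) Ψ)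
    (hR : ∀ s, R < s → Ψ s = 0) {ρ : ℝ} (hρ : 2 * ρ = Module.finrank ℝ V - 2) :
    ∫ p, Ψ (lor e p p) * (fderiv ℝ u p p + ρ * u p) * box e b u p =
      ∫ p, -deriv Ψ (lor e p p) * ((fderiv ℝ u p p + ρ * u p) ^ 2 +
        ((fderiv ℝ u p p) ^ 2 - lor e p p * lor e (grad b u p) (grad b u p)
          - ρ ^ 2 * u p ^ 2)) := by
  set a := grad b u with ha
  have hac : ContDiff ℝ (⊤ : ℕ∞) a := contDiff_grad b hu
  have had : Differentiable ℝ a := hac.differentiable (by simp)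
  have hΨd : Differentiable ℝ Ψ := hΨ.differentiable (by simp)
  have hEu : ∀ p, fderiv ℝ u p p = ⟪a p, p⟫_ℝ := fun p => (inner_grad b u p p).symm
  have hEuc : ContDiff ℝ (⊤ : ℕ∞) fun p => ⟪a p, p⟫_ℝ := hac.inner ℝ contDiff_id
  have hΨσ : ContDiff ℝ (⊤ : ℕ∞) fun p : V => Ψ (lor e p p) := hΨ.comp contDiff_lor
  have hΨ' : Continuous fun p : V => deriv Ψ (lor e p p) :=
    (hΨ.continuous_deriv (by simp)).comp (continuous_lor e)
  have hre : ContDiff ℝ (⊤ : ℕ∞) (refl e) := by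
    unfold refl
    exact ((contDiff_const.mul (contDiff_const.inner ℝ contDiff_id)).smul contDiff_const).sub
      contDiff_id
  have hQc : ContDiff ℝ (⊤ : ℕ∞) fun p => lor e (a p) (a p) := contDiff_lor.comp hac
  have hX : Continuous fun p => ⟪fderiv ℝ a p p, refl e (a p)⟫_ℝ :=
    ((hac.continuous_fderiv (by simp)).clm_apply continuous_id).inner
      (hre.continuous.comp hac.continuous)
  have hσ := continuous_lor e
  have z0 : ∀ p, ¬ (p - ε • e ∈ ccone e ∧ lor e p p ≤ R) →
      (u p = 0 ∧ a p = 0 ∧ fderiv ℝ a p = 0) ∨ (Ψ (lor e p p) = 0 ∧ deriv Ψ (lor e p p) = 0) := by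
    intro p hp
    by_cases h : p - ε • e ∈ ccone e
    · have h' : R < lor e p p := by
        by_contra h2
        exact hp ⟨h, not_lt.1 h2⟩
      exact Or.inr ⟨hR _ h', deriv_eq_zero_of_lt he hR h'⟩
    · have h1 := grad_eventuallyEq_zero b hs h
      exact Or.inl ⟨(eventuallyEq_zero_of_supp hs h).eq_of_nhds, h1.eq_of_nhds, by
        rw [h1.fderiv_eq]; simp⟩
  have key : ∀ {H : V → ℝ}, (∀ p, ¬ (p - ε • e ∈ ccone e ∧ lor e p p ≤ R) → H p = 0) →
      ∀ p, H p ≠ 0 → p - ε • e ∈ ccone e ∧ lor e p p ≤ R := fun h p hp => by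
    by_contra h2
    exact hp (h p h2)
  -- the three integrations by parts
  have f1 : ∀ p, lor e (grad b (fun p => Ψ (lor e p p) * ⟪a p, p⟫_ℝ) p) (a p) =
      2 * (deriv Ψ (lor e p p) * ⟪a p, p⟫_ℝ ^ 2)
        + Ψ (lor e p p) * ⟪fderiv ℝ a p p, refl e (a p)⟫_ℝ
        + Ψ (lor e p p) * lor e (a p) (a p) := fun p => by
    have h := ((hasFDerivAt_comp_lor (e := e) hΨd p).mul
      ((had p).hasFDerivAt.inner ℝ (hasFDerivAt_id p))).fderiv
    rw [lor_eq_inner_refl, inner_grad]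
    erw [h]
    have h3 := inner_fderiv_grad_symm b hu p (refl e (a p)) p
    rw [← ha] at h3
    have h4 : ⟪refl e p, refl e (a p)⟫_ℝ = ⟪a p, p⟫_ℝ := by
      rw [← lor_eq_inner_refl, lor_refl_left he, real_inner_comm]
    simp only [add_apply, smul_apply, ContinuousLinearMap.comp_apply, smul_eq_mul,
      innerSL_apply_apply, h4, fderivInnerCLM_apply, ContinuousLinearMap.prod_apply, id,
      ContinuousLinearMap.coe_id', lor_eq_inner_refl e (a p)]
    rw [h3, real_inner_comm (fderiv ℝ a p p)]
    ring
  have f2 : ∀ p, lor e (grad b (fun p => Ψ (lor e p p) * u p) p) (a p) =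
      2 * (deriv Ψ (lor e p p) * (⟪a p, p⟫_ℝ * u p))
        + Ψ (lor e p p) * lor e (a p) (a p) := fun p => by
    have h := ((hasFDerivAt_comp_lor (e := e) hΨd p).mul
      (hu.differentiable (by simp) p).hasFDerivAt).fderiv
    rw [lor_eq_inner_refl, inner_grad]
    erw [h]
    have h4 : ⟪refl e p, refl e (a p)⟫_ℝ = ⟪a p, p⟫_ℝ := by
      rw [← lor_eq_inner_refl, lor_refl_left he, real_inner_comm]
    simp only [add_apply, smul_apply, smul_eq_mul,
      innerSL_apply_apply, h4, ← inner_grad b u, ← ha, lor_eq_inner_refl e (a p)]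
    ring
  have f3 : ∀ p, fderiv ℝ (fun p => Ψ (lor e p p) * lor e (a p) (a p)) p p =
      2 * (deriv Ψ (lor e p p) * (lor e p p * lor e (a p) (a p)))
        + 2 * (Ψ (lor e p p) * ⟪fderiv ℝ a p p, refl e (a p)⟫_ℝ) := fun p => by
    have h := ((hasFDerivAt_comp_lor (e := e) hΨd p).mul
      ((hasFDerivAt_lor (e := e) (a p)).comp p (had p).hasFDerivAt)).fderiv
    erw [h]
    simp only [add_apply, smul_apply, ContinuousLinearMap.comp_apply, smul_eq_mul,
      innerSL_apply_apply, Function.comp]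
    rw [real_inner_comm p, ← lor_eq_inner_refl e p p, real_inner_comm (fderiv ℝ a p p)]
    ring
  have i1 := integral_mul_box (e := e) b (f := fun p => Ψ (lor e p p) * ⟪a p, p⟫_ℝ)
    ((hΨσ.mul hEuc).of_le (by simp)) (hasCompactSupport_trunc (R := R) he hε (key fun p hp => by
      rcases z0 p hp with ⟨-, h, -⟩ | ⟨h, -⟩ <;> simp [h])) hu
  have i2 := integral_mul_box (e := e) b (f := fun p => Ψ (lor e p p) * u p)
    ((hΨσ.mul hu).of_le (by simp)) (hasCompactSupport_trunc (R := R) he hε (key fun p hp => by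
      rcases z0 p hp with ⟨h, -⟩ | ⟨h, -⟩ <;> simp [h])) hu
  have i3 := integral_euler b (f := fun p => Ψ (lor e p p) * lor e (a p) (a p))
    ((hΨσ.mul hQc).of_le (by simp)) (hasCompactSupport_trunc (R := R) he hε (key fun p hp => by
      rcases z0 p hp with ⟨-, h, -⟩ | ⟨h, -⟩ <;> simp [h, lor_zero]))
  rw [← ha] at i1 i2
  simp only [f1] at i1
  simp only [f2] at i2
  simp only [f3] at i3
  have jA : Integrable fun p => deriv Ψ (lor e p p) * ⟪a p, p⟫_ℝ ^ 2 :=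
    integrable_trunc (R := R) he hε (hΨ'.mul (hEuc.continuous.pow 2)) (key fun p hp => by
      rcases z0 p hp with ⟨-, h, -⟩ | ⟨-, h⟩ <;> simp [h])
  have jX : Integrable fun p => Ψ (lor e p p) * ⟪fderiv ℝ a p p, refl e (a p)⟫_ℝ :=
    integrable_trunc (R := R) he hε (hΨσ.continuous.mul hX) (key fun p hp => by
      rcases z0 p hp with ⟨-, -, h⟩ | ⟨h, -⟩ <;> simp [h])
  have jQ : Integrable fun p => Ψ (lor e p p) * lor e (a p) (a p) :=
    integrable_trunc (R := R) he hε (hΨσ.continuous.mul hQc.continuous) (key fun p hp => by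
      rcases z0 p hp with ⟨-, h, -⟩ | ⟨h, -⟩ <;> simp [h, lor_zero])
  have jD : Integrable fun p => deriv Ψ (lor e p p) * (lor e p p * lor e (a p) (a p)) :=
    integrable_trunc (R := R) he hε (hΨ'.mul (hσ.mul hQc.continuous)) (key fun p hp => by
      rcases z0 p hp with ⟨-, h, -⟩ | ⟨-, h⟩ <;> simp [h, lor_zero])
  have jF : Integrable fun p => deriv Ψ (lor e p p) * (⟪a p, p⟫_ℝ * u p) :=
    integrable_trunc (R := R) he hε (hΨ'.mul (hEuc.continuous.mul hu.continuous))
    (key fun p hp => by rcases z0 p hp with ⟨-, h, -⟩ | ⟨-, h⟩ <;> simp [h])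
  have hb : Continuous (box e b u) := by
    have : ∀ p, box e b u p = ∑ i, ⟪fderiv ℝ a p (b i), refl e (b i)⟫_ℝ := fun p => by
      simp only [box, ha, inner_fderiv_grad b hu]
    rw [funext this]
    have := hac.continuous_fderiv (by simp)
    fun_prop
  have jB1 : Integrable fun p => Ψ (lor e p p) * ⟪a p, p⟫_ℝ * box e b u p :=
    integrable_trunc (R := R) he hε ((hΨσ.continuous.mul hEuc.continuous).mul hb)
    (key fun p hp => by rcases z0 p hp with ⟨-, h, -⟩ | ⟨h, -⟩ <;> simp [h])
  have jB2 : Integrable fun p => Ψ (lor e p p) * u p * box e b u p :=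
    integrable_trunc (R := R) he hε ((hΨσ.continuous.mul hu.continuous).mul hb)
    (key fun p hp => by rcases z0 p hp with ⟨h, -⟩ | ⟨h, -⟩ <;> simp [h])
  have k1 := integral_lin3 jA jX jQ 2 1 1
  have k2 := integral_lin2 jF jQ 2 1
  have k3 := integral_lin2 jD jX 2 2
  simp only [one_mul] at k1 k2
  rw [k1] at i1
  rw [k2] at i2
  rw [k3] at i3
  have l : ∫ p, Ψ (lor e p p) * (fderiv ℝ u p p + ρ * u p) * box e b u p =
      1 * (∫ p, Ψ (lor e p p) * ⟪a p, p⟫_ℝ * box e b u p)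
        + ρ * ∫ p, Ψ (lor e p p) * u p * box e b u p := by
    rw [← integral_lin2 jB1 jB2]
    refine integral_congr_ae (.of_forall fun p => ?_)
    simp only [hEu]
    ring
  have r : (∫ p, -deriv Ψ (lor e p p) * ((fderiv ℝ u p p + ρ * u p) ^ 2 +
        ((fderiv ℝ u p p) ^ 2 - lor e p p * lor e (a p) (a p) - ρ ^ 2 * u p ^ 2))) =
      (-2) * (∫ p, deriv Ψ (lor e p p) * ⟪a p, p⟫_ℝ ^ 2)
      + 1 * (∫ p, deriv Ψ (lor e p p) * (lor e p p * lor e (a p) (a p)))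
      + (-2 * ρ) * ∫ p, deriv Ψ (lor e p p) * (⟪a p, p⟫_ℝ * u p) := by
    rw [← integral_lin3 jA jD jF]
    refine integral_congr_ae (.of_forall fun p => ?_)
    simp only [hEu]
    ring
  rw [l, r, i1, i2]
  have hN : (Module.finrank ℝ V : ℝ) = 2 * ρ + 2 := by linarith
  rw [hN] at i3
  linarith

end Energy

section Gap

variable {V : Type*} [NormedAddCommGroup V] [InnerProductSpace ℝ V] {e : V}
  [FiniteDimensional ℝ V] [MeasurableSpace V] [BorelSpace V] {ι : Type*} [Fintype ι]
  (b : OrthonormalBasis ι ℝ V) (he : ‖e‖ = 1) {ε R : ℝ} (hε : 0 < ε)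
include he

lemma inner_null_pos {e₁ p : V} (h1 : ‖e₁‖ = 1) (h0 : ⟪e, e₁⟫_ℝ = 0) (hp : p ∈ cone e) :
    0 < ⟪e - e₁, p⟫_ℝ := by
  have h2 : ⟪e₁, p⟫_ℝ = ⟪e₁, sp e p⟫_ℝ := by
    simp [sp, inner_sub_right, inner_smul_right, real_inner_comm e e₁, h0]
  have h3 : ‖sp e p‖ < ⟪e, p⟫_ℝ := hp
  have h4 := real_inner_le_norm e₁ (sp e p)
  rw [inner_sub_left, h2]
  rw [h1] at h4
  linarith

include hε

include b in
lemma integral_comp_lor_mul_euler {u : V → ℝ} {Φ : ℝ → ℝ} (hu : ContDiff ℝ (⊤ : ℕ∞) u)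
    (hs : ∀ p, u p ≠ 0 → p - ε • e ∈ ccone e) (hΦ : ContDiff ℝ (⊤ : ℕ∞) Φ)
    (hR : ∀ s, R < s → Φ s = 0) :
    ∫ p, Φ (lor e p p) * (u p * fderiv ℝ u p p) =
      - (∫ p, deriv Φ (lor e p p) * lor e p p * u p ^ 2)
        - Module.finrank ℝ V / 2 * ∫ p, Φ (lor e p p) * u p ^ 2 := by
  have hΦd : Differentiable ℝ Φ := hΦ.differentiable (by simp)
  have hud : Differentiable ℝ u := hu.differentiable (by simp)
  have hΦσ : ContDiff ℝ (⊤ : ℕ∞) fun p : V => Φ (lor e p p) := hΦ.comp contDiff_lor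
  have hΦ' : Continuous fun p : V => deriv Φ (lor e p p) :=
    (hΦ.continuous_deriv (by simp)).comp (continuous_lor e)
  have key : ∀ {H : V → ℝ}, (∀ p, u p = 0 ∨ (Φ (lor e p p) = 0 ∧ deriv Φ (lor e p p) = 0) →
      H p = 0) → ∀ p, H p ≠ 0 → p - ε • e ∈ ccone e ∧ lor e p p ≤ R := fun h p hp => by
    refine ⟨hs p fun h0 => hp (h p (Or.inl h0)), ?_⟩
    by_contra hlt
    exact hp (h p (Or.inr ⟨hR _ (not_le.1 hlt), deriv_eq_zero_of_lt he hR (not_le.1 hlt)⟩))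
  have hE : Continuous fun p => fderiv ℝ u p p :=
    (hu.continuous_fderiv (by simp)).clm_apply continuous_id
  have h1 := integral_euler b (f := fun p => Φ (lor e p p) * (u p * u p))
    ((hΦσ.mul (hu.mul hu)).of_le (by simp)) (hasCompactSupport_trunc (R := R) he hε
      (key fun p hp => by rcases hp with h | ⟨h, -⟩ <;> simp [h]))
  have h2 : ∀ p, fderiv ℝ (fun p => Φ (lor e p p) * (u p * u p)) p p =
      2 * (deriv Φ (lor e p p) * lor e p p * u p ^ 2)
        + 2 * (Φ (lor e p p) * (u p * fderiv ℝ u p p)) := fun p => by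
    have h := ((hasFDerivAt_comp_lor (e := e) hΦd p).mul
      ((hud p).hasFDerivAt.mul (hud p).hasFDerivAt)).fderiv
    erw [h]
    simp only [add_apply, smul_apply, smul_eq_mul, innerSL_apply_apply, Pi.mul_apply]
    rw [real_inner_comm p, ← lor_eq_inner_refl e p p]
    ring
  simp only [h2] at h1
  rw [integral_lin2] at h1
  · simp only [← sq] at h1
    linarith
  · exact integrable_trunc (R := R) he hε ((hΦ'.mul (continuous_lor e)).mul (hu.continuous.pow 2))
      (key fun p hp => by rcases hp with h | ⟨-, h⟩ <;> simp [h])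
  · exact integrable_trunc (R := R) he hε (hΦσ.continuous.mul (hu.continuous.mul hE))
      (key fun p hp => by rcases hp with h | ⟨h, -⟩ <;> simp [h])

/-- The spectral gap on hyperboloids. -/
theorem spectral_gap {e₁ : V} (h1 : ‖e₁‖ = 1) (h0 : ⟪e, e₁⟫_ℝ = 0) {u : V → ℝ} {Φ : ℝ → ℝ}
    (hu : ContDiff ℝ (⊤ : ℕ∞) u)
    (hs : ∀ p, u p ≠ 0 → p - ε • e ∈ ccone e) (hΦ : ContDiff ℝ (⊤ : ℕ∞) Φ)
    (hR : ∀ s, R < s → Φ s = 0) (hΦ0 : ∀ p, p - ε • e ∈ ccone e → 0 ≤ Φ (lor e p p))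
    {ρ : ℝ} (hρ : 2 * ρ = Module.finrank ℝ V - 2) :
    0 ≤ ∫ p, Φ (lor e p p) * ((fderiv ℝ u p p) ^ 2
      - lor e p p * lor e (grad b u p) (grad b u p) - ρ ^ 2 * u p ^ 2) := by
  set a := grad b u with ha
  set k := e - e₁ with hk
  have hkk : lor e k k = 0 := by
    have h2 : lor e e₁ e₁ = -1 := by simp [lor, h0, h1]
    simp only [hk, lor_sub_left, lor_sub_right, lor_axis he, lor_comm e e₁ e, h2, h0,
      inner_self_axis he]
    norm_num
  have hcone : ∀ p, p - ε • e ∈ ccone e → p ∈ cone e := fun p hp => by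
    simpa using add_mem_cone hp (smul_mem_cone hε (axis_mem_cone he))
  have hℓ : ∀ p, p - ε • e ∈ ccone e → 0 < ⟪k, p⟫_ℝ := fun p hp =>
    inner_null_pos he h1 h0 (hcone p hp)
  have hℓc : ContDiff ℝ (⊤ : ℕ∞) fun p => ⟪k, p⟫_ℝ := contDiff_const.inner ℝ contDiff_id
  set v : V → ℝ := fun p => u p / ⟪k, p⟫_ℝ with hv
  have huv : ∀ p, u p = ⟪k, p⟫_ℝ * v p := fun p => by
    by_cases h : u p = 0
    · simp [hv, h]
    · rw [hv, mul_div_cancel₀ _ (hℓ p (hs p h)).ne']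
  have hvc : ContDiff ℝ (⊤ : ℕ∞) v := by
    refine contDiff_iff_contDiffAt.2 fun p => ?_
    by_cases hp : p ∉ tsupport v
    · exact contDiffAt_const.congr_of_eventuallyEq (notMem_tsupport_iff_eventuallyEq.1 hp)
    have h2 : p - ε • e ∈ ccone e := tsupport_of_supp (F := v)
      (fun p hp => hs p fun h => hp (by simp [hv, h])) (not_not.1 hp)
    exact hu.contDiffAt.div hℓc.contDiffAt (hℓ p h2).ne'
  have hac : ContDiff ℝ (⊤ : ℕ∞) a := contDiff_grad b hu
  have hΦd : Differentiable ℝ Φ := hΦ.differentiable (by simp)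
  have hud : Differentiable ℝ u := hu.differentiable (by simp)
  have hvd : Differentiable ℝ v := hvc.differentiable (by simp)
  have hℓd (p : V) : HasFDerivAt (fun p => ⟪k, p⟫_ℝ) (innerSL ℝ k) p := (innerSL ℝ k).hasFDerivAt
  have hΦσ : ContDiff ℝ (⊤ : ℕ∞) fun p : V => Φ (lor e p p) := hΦ.comp contDiff_lor
  have hΦ' : Continuous fun p : V => deriv Φ (lor e p p) :=
    (hΦ.continuous_deriv (by simp)).comp (continuous_lor e)
  have hE : Continuous fun p => fderiv ℝ u p p :=
    (hu.continuous_fderiv (by simp)).clm_apply continuous_id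
  have hQc : Continuous fun p => lor e (a p) (a p) := (continuous_lor e).comp hac.continuous
  have hL : Continuous fun p => lor e (a p) k := by
    have := hac.continuous
    unfold lor; fun_prop
  have z0 : ∀ p, ¬ (p - ε • e ∈ ccone e ∧ lor e p p ≤ R) →
      (u p = 0 ∧ a p = 0) ∨ (Φ (lor e p p) = 0 ∧ deriv Φ (lor e p p) = 0) := by
    intro p hp
    by_cases h : p - ε • e ∈ ccone e
    · have h' : R < lor e p p := by
        by_contra h2
        exact hp ⟨h, not_lt.1 h2⟩
      exact Or.inr ⟨hR _ h', deriv_eq_zero_of_lt he hR h'⟩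
    · exact Or.inl ⟨(eventuallyEq_zero_of_supp hs h).eq_of_nhds,
        (grad_eventuallyEq_zero b hs h).eq_of_nhds⟩
  have key : ∀ {H : V → ℝ}, (∀ p, (u p = 0 ∧ a p = 0) ∨
      (Φ (lor e p p) = 0 ∧ deriv Φ (lor e p p) = 0) → H p = 0) →
      ∀ p, H p ≠ 0 → p - ε • e ∈ ccone e ∧ lor e p p ≤ R := fun h p hp => by
    by_contra h2
    exact hp (h p (z0 p h2))
  have j1 : Integrable fun p => deriv Φ (lor e p p) * lor e p p * u p ^ 2 :=
    integrable_trunc (R := R) he hε ((hΦ'.mul (continuous_lor e)).mul (hu.continuous.pow 2))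
      (key fun p hp => by rcases hp with ⟨h, -⟩ | ⟨-, h⟩ <;> simp [h])
  have j2 : Integrable fun p => Φ (lor e p p) * u p ^ 2 :=
    integrable_trunc (R := R) he hε (hΦσ.continuous.mul (hu.continuous.pow 2))
      (key fun p hp => by rcases hp with ⟨h, -⟩ | ⟨h, -⟩ <;> simp [h])
  have j3 : Integrable fun p => Φ (lor e p p) * lor e p p * v p * lor e (a p) k :=
    integrable_trunc (R := R) he hε
      (((hΦσ.continuous.mul (continuous_lor e)).mul hvc.continuous).mul hL)
      (key fun p hp => by rcases hp with ⟨h, -⟩ | ⟨h, -⟩ <;> simp [hv, h])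
  have j4 : Integrable fun p => Φ (lor e p p) * (u p * fderiv ℝ u p p) :=
    integrable_trunc (R := R) he hε (hΦσ.continuous.mul (hu.continuous.mul hE))
      (key fun p hp => by rcases hp with ⟨h, -⟩ | ⟨h, -⟩ <;> simp [h])
  have j5 : Integrable fun p => Φ (lor e p p) * ((fderiv ℝ u p p) ^ 2
      - lor e p p * lor e (a p) (a p) - ρ ^ 2 * u p ^ 2) := by
    refine integrable_trunc (R := R) he hε (hΦσ.continuous.mul (((hE.pow 2).sub
      ((continuous_lor e).mul hQc)).sub (continuous_const.mul (hu.continuous.pow 2))))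
      (key fun p hp => ?_)
    rcases hp with ⟨h, h'⟩ | ⟨h, -⟩
    · simp [h, ← inner_grad b u, ← ha, h', lor_zero]
    · simp [h]
  have f1 : ∀ p, fderiv ℝ (fun p => Φ (lor e p p) * (lor e p p * (⟪k, p⟫_ℝ * (v p * v p)))) p
      (refl e k) = 2 * (deriv Φ (lor e p p) * lor e p p * u p ^ 2)
        + 2 * (Φ (lor e p p) * u p ^ 2)
        + 2 * (Φ (lor e p p) * lor e p p * v p * lor e (a p) k) := fun p => by
    have h := ((hasFDerivAt_comp_lor (e := e) hΦd p).mul ((hasFDerivAt_lor (e := e) p).mul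
      ((hℓd p).mul ((hvd p).hasFDerivAt.mul (hvd p).hasFDerivAt)))).fderiv
    erw [h]
    have h2 : lor e (a p) k = ⟪k, p⟫_ℝ * fderiv ℝ v p (refl e k) := by
      rw [lor_eq_inner_refl, ha, inner_grad, show u = fun p => ⟪k, p⟫_ℝ * v p from funext huv]
      erw [((hℓd p).mul (hvd p).hasFDerivAt).fderiv]
      simp only [add_apply, smul_apply, smul_eq_mul, innerSL_apply_apply, ← lor_eq_inner_refl, hkk]
      ring
    have h3 : ⟪refl e p, refl e k⟫_ℝ = ⟪k, p⟫_ℝ := by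
      rw [← lor_eq_inner_refl, lor_refl_left he, real_inner_comm]
    rw [h2, huv]
    simp only [add_apply, smul_apply, smul_eq_mul, innerSL_apply_apply, h3, Pi.mul_apply,
      ← lor_eq_inner_refl e k k, hkk]
    ring
  have i1 := integral_fderiv_eq_zero
    (f := fun p => Φ (lor e p p) * (lor e p p * (⟪k, p⟫_ℝ * (v p * v p))))
    ((hΦσ.mul (contDiff_lor.mul (hℓc.mul (hvc.mul hvc)))).of_le (by simp))
    (hasCompactSupport_trunc (R := R) he hε
      (key fun p hp => by rcases hp with ⟨h, -⟩ | ⟨h, -⟩ <;> simp [hv, h])) (refl e k)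
  simp only [f1] at i1
  rw [integral_lin3 j1 j2 j3] at i1
  have i2 := integral_comp_lor_mul_euler b he hε hu hs hΦ hR
  have hN : (Module.finrank ℝ V : ℝ) = 2 * ρ + 2 := by linarith
  rw [hN] at i2
  have i3 : ∫ p, ((-2 * ρ) * (Φ (lor e p p) * (u p * fderiv ℝ u p p))
      + (2 * ρ) * (Φ (lor e p p) * lor e p p * v p * lor e (a p) k)
      + (-2 * ρ ^ 2) * (Φ (lor e p p) * u p ^ 2)) = 0 := by
    rw [integral_lin3 j4 j3 j2, i2]
    linear_combination ρ * i1
  rw [← i3]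
  refine integral_mono (((j4.const_mul _).add (j3.const_mul _)).add (j2.const_mul _)) j5
    fun p => ?_
  by_cases hp : p - ε • e ∈ ccone e
  · have h2 := lor_mul_le_sq he (hcone p hp) (refl e (a p + (ρ * v p) • k))
    rw [lor_refl_refl he, lor_comm e p (refl e _), lor_refl_left he] at h2
    simp only [lor_add_left, lor_add_right, lor_smul_left, lor_smul_right, hkk, lor_comm e k (a p),
      inner_add_left, inner_smul_left, ha, inner_grad b u p p] at h2
    rw [← ha] at h2
    have h3 := hΦ0 p hp
    have h4 := huv p
    rw [lor_comm e k (a p)] at h2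
    simp only [RCLike.conj_to_real] at h2
    have h5 : lor e p p * (lor e (a p) (a p) + 2 * ρ * v p * lor e (a p) k)
        ≤ (fderiv ℝ u p p + ρ * u p) ^ 2 := by
      rw [h4]; linarith
    have h6 := mul_le_mul_of_nonneg_left h5 h3
    simp only
    linarith
  · have h2 := (grad_eventuallyEq_zero b hs hp).eq_of_nhds
    rw [← ha] at h2
    have h3 : u p = 0 := (eventuallyEq_zero_of_supp hs hp).eq_of_nhds
    simp [h3, ← inner_grad b u, ← ha, h2, lor_zero, hv]

end Gap

section CutPow

/-- A smooth nonincreasing cutoff. -/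
noncomputable def cut (R s : ℝ) : ℝ := Real.smoothTransition (R + 1 - s)

/-- The power `s ^ c`, smoothly cut off near zero and near infinity. -/
noncomputable def cutPow (δ R c s : ℝ) : ℝ :=
  Real.smoothTransition (4 * s / δ - 1) * cut R s * s ^ c

lemma cut_nonneg (R s : ℝ) : 0 ≤ cut R s := Real.smoothTransition.nonneg _

lemma cut_le_one (R s : ℝ) : cut R s ≤ 1 := Real.smoothTransition.le_one _

lemma cut_eq_one {R s : ℝ} (h : s ≤ R) : cut R s = 1 :=
  Real.smoothTransition.one_of_one_le (by linarith)

lemma contDiff_cut (R : ℝ) : ContDiff ℝ (⊤ : ℕ∞) (cut R) :=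
  Real.smoothTransition.contDiff.comp (by fun_prop)

lemma deriv_cut_nonpos (R s : ℝ) : deriv (cut R) s ≤ 0 := by
  have : Antitone (cut R) := fun x y h => Real.smoothTransition.monotone (by linarith)
  exact this.deriv_nonpos

variable {δ : ℝ} (hδ : 0 < δ) (R c : ℝ)
include hδ

lemma contDiff_cutPow : ContDiff ℝ (⊤ : ℕ∞) (cutPow δ R c) := by
  refine contDiff_iff_contDiffAt.2 fun s => ?_
  by_cases hs : s = 0
  · subst hs
    refine contDiffAt_const (c := (0 : ℝ)) |>.congr_of_eventuallyEq ?_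
    filter_upwards [Iio_mem_nhds (show 0 < δ / 4 by positivity)] with s hs
    have : Real.smoothTransition (4 * s / δ - 1) = 0 :=
      Real.smoothTransition.zero_of_nonpos (by
        have hs' : s < δ / 4 := hs
        rw [sub_nonpos, div_le_one hδ]; linarith)
    simp [cutPow, this]
  · refine ((Real.smoothTransition.contDiff.comp ?_).mul (contDiff_cut R)).contDiffAt.mul
      (Real.contDiffAt_rpow_const_of_ne hs)
    fun_prop

lemma cutPow_of_gt : ∀ s, R + 1 < s → cutPow δ R c s = 0 := fun s hs => by
  simp [cutPow, cut, Real.smoothTransition.zero_of_nonpos (show R + 1 - s ≤ 0 by linarith)]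

lemma cutPow_eq {s : ℝ} (hs : δ / 2 ≤ s) : cutPow δ R c s = cut R s * s ^ c := by
  rw [cutPow, Real.smoothTransition.one_of_one_le, one_mul]
  rw [le_sub_iff_add_le, le_div_iff₀ hδ]; linarith

lemma deriv_cutPow {s : ℝ} (hs : δ ≤ s) :
    deriv (cutPow δ R c) s = deriv (cut R) s * s ^ c + cut R s * (c * s ^ (c - 1)) := by
  have h : cutPow δ R c =ᶠ[𝓝 s] fun s => cut R s * s ^ c := by
    filter_upwards [Ioi_mem_nhds (show δ / 2 < s by linarith)] with t ht
    exact cutPow_eq hδ R c (le_of_lt ht)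
  rw [h.deriv_eq]
  have h1 : HasDerivAt (cut R) (deriv (cut R) s) s :=
    ((contDiff_cut R).differentiable (by simp) s).hasDerivAt
  exact (h1.mul (Real.hasDerivAt_rpow_const (Or.inl (by linarith)))).deriv

/-- Both the multiplier and its derivative are controlled by cut-off powers. -/
lemma le_neg_deriv_cutPow {β s : ℝ} (hs : δ ≤ s) :
    β * cutPow δ R (-β - 1) s ≤ -deriv (cutPow δ R (-β)) s := by
  rw [deriv_cutPow hδ R _ hs, cutPow_eq hδ R _ (by linarith)]
  have h1 := deriv_cut_nonpos R s
  have h2 : 0 ≤ s ^ (-β) := Real.rpow_nonneg (by linarith) _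
  nlinarith [mul_nonneg (neg_nonneg.2 h1) h2]

lemma cutPow_nonneg {s : ℝ} (hs : δ ≤ s) : 0 ≤ cutPow δ R c s := by
  rw [cutPow_eq hδ R _ (by linarith)]
  exact mul_nonneg (cut_nonneg _ _) (Real.rpow_nonneg (by linarith) _)

lemma cutPow_add_one {s : ℝ} (hs : δ ≤ s) : cutPow δ R (c + 1) s = s * cutPow δ R c s := by
  rw [cutPow_eq hδ R _ (by linarith), cutPow_eq hδ R _ (by linarith),
    Real.rpow_add_one (by linarith)]
  ring

end CutPow

section Estimate

variable {V : Type*} [NormedAddCommGroup V] [InnerProductSpace ℝ V] {e : V}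
  [FiniteDimensional ℝ V] [MeasurableSpace V] [BorelSpace V] {ι : Type*} [Fintype ι]
  (b : OrthonormalBasis ι ℝ V) (he : ‖e‖ = 1) {ε : ℝ} (hε : 0 < ε)
include he hε

lemma sq_le_lor {p : V} (hp : p - ε • e ∈ ccone e) : ε ^ 2 ≤ lor e p p := by
  obtain ⟨h1, h2⟩ := (mem_ccone_iff he).1 hp
  have h3 := inner_self_axis he
  have h4 : lor e (p - ε • e) (p - ε • e) = lor e p p - 2 * ε * ⟪e, p⟫_ℝ + ε ^ 2 := by
    simp only [lor_sub_left, lor_sub_right, lor_smul_left, lor_smul_right, lor_axis he,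
      lor_comm e p e, h3]; ring
  have h5 : ⟪e, p - ε • e⟫_ℝ = ⟪e, p⟫_ℝ - ε := by simp [inner_sub_right, inner_smul_right, h3, he]
  rw [h4] at h2
  rw [h5] at h1
  nlinarith

variable {u : V → ℝ} (hu : ContDiff ℝ (⊤ : ℕ∞) u) (hs : ∀ p, u p ≠ 0 → p - ε • e ∈ ccone e)
include hu hs

lemma integrable_cutPow_mul (R c : ℝ) {H : V → ℝ} (hH : Continuous H)
    (hH0 : ∀ p, p - ε • e ∉ ccone e → H p = 0) :
    Integrable fun p => cutPow (ε ^ 2) R c (lor e p p) * H p := by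
  refine integrable_trunc (R := R + 1) he hε
    (((contDiff_cutPow (by positivity) R c).continuous.comp (continuous_lor e)).mul hH) fun p hp => ?_
  refine ⟨?_, ?_⟩
  · by_contra h; exact hp (by simp [hH0 p h])
  · by_contra h; exact hp (by simp [cutPow_of_gt (δ := ε ^ 2) (by positivity) R c _ (not_le.1 h)])

omit he hε hs hu in
lemma continuous_box {G : Type*} [NormedAddCommGroup G] [NormedSpace ℝ G] {u : V → G}
    (hu : ContDiff ℝ (⊤ : ℕ∞) u) : Continuous (box e b u) := by
  have hu' : ContDiff ℝ (⊤ : ℕ∞) (fderiv ℝ u) := hu.fderiv_right (m := (⊤ : ℕ∞)) (by simp)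
  unfold box
  refine continuous_finsetSum _ fun i _ => ?_
  have : ContDiff ℝ (⊤ : ℕ∞) fun y => fderiv ℝ u y (refl e (b i)) := by fun_prop
  exact (this.continuous_fderiv (by simp)).clm_apply continuous_const

omit he hε hu in
lemma box_eq_zero_of_notMem {p : V} (hp : p - ε • e ∉ ccone e) : box e b u p = 0 := by
  have h := (eventuallyEq_zero_of_supp hs hp).eventuallyEq_nhds
  refine Finset.sum_eq_zero fun i _ => ?_
  have h2 : (fun y => fderiv ℝ u y (refl e (b i))) =ᶠ[𝓝 p] fun _ => 0 := by
    filter_upwards [h] with y hy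
    simp [hy.fderiv_eq]
  simp [h2.fderiv_eq]

omit he hε hu in
lemma euler_eq_zero_of_notMem {p : V} (hp : p - ε • e ∉ ccone e) : fderiv ℝ u p p = 0 := by
  simp [(eventuallyEq_zero_of_supp hs hp).fderiv_eq]

variable {ρ : ℝ} (hρ : 2 * ρ = Module.finrank ℝ V - 2) {β : ℝ} (hβ : 0 < β)
include hρ hβ

lemma energy_trunc {e₁ : V} (h1 : ‖e₁‖ = 1) (h0 : ⟪e, e₁⟫_ℝ = 0) (R : ℝ) :
    ∫ p, cutPow (ε ^ 2) R (-β - 1) (lor e p p) * (fderiv ℝ u p p + ρ * u p) ^ 2 ≤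
      (1 / β ^ 2) * ∫ p, cutPow (ε ^ 2) R (1 - β) (lor e p p) * box e b u p ^ 2 := by
  have hδ : (0 : ℝ) < ε ^ 2 := by positivity
  have hE : Continuous fun p => fderiv ℝ u p p :=
    (hu.continuous_fderiv (by simp)).clm_apply continuous_id
  have hX : Continuous fun p => fderiv ℝ u p p + ρ * u p := hE.add (continuous_const.mul hu.continuous)
  have hX0 : ∀ p, p - ε • e ∉ ccone e → fderiv ℝ u p p + ρ * u p = 0 := fun p hp => by
    rw [euler_eq_zero_of_notMem hs hp, (eventuallyEq_zero_of_supp hs hp).eq_of_nhds]; simp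
  have hb := continuous_box (e := e) b hu
  have hΨ := contDiff_cutPow hδ R (-β)
  have hid := energy_identity (R := R + 1) b he hε hu hs hΨ (cutPow_of_gt hδ R (-β)) hρ
  have hΦ : ContDiff ℝ (⊤ : ℕ∞) fun s => -deriv (cutPow (ε ^ 2) R (-β)) s :=
    ((contDiff_infty_iff_deriv.1 hΨ).2).neg
  have hΦ0 : ∀ p, p - ε • e ∈ ccone e → β * cutPow (ε ^ 2) R (-β - 1) (lor e p p) ≤
      -deriv (cutPow (ε ^ 2) R (-β)) (lor e p p) := fun p hp =>
    le_neg_deriv_cutPow hδ R (sq_le_lor he hε hp)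
  have hnn : ∀ c p, p - ε • e ∈ ccone e → 0 ≤ cutPow (ε ^ 2) R c (lor e p p) := fun c p hp =>
    cutPow_nonneg hδ R c (sq_le_lor he hε hp)
  have hgap := spectral_gap (R := R + 1) b he hε h1 h0 hu hs hΦ
    (fun s hs => by rw [deriv_eq_zero_of_lt he (cutPow_of_gt hδ R (-β)) hs, neg_zero])
    (fun p hp => (mul_nonneg hβ.le (hnn _ p hp)).trans (hΦ0 p hp)) hρ
  have jm : Integrable fun p => cutPow (ε ^ 2) R (-β - 1) (lor e p p) *
      (fderiv ℝ u p p + ρ * u p) ^ 2 := integrable_cutPow_mul he hε hu hs R (-β - 1) (hX.pow 2)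
    (fun p hp => by simp [hX0 p hp])
  have jb : Integrable fun p => cutPow (ε ^ 2) R (1 - β) (lor e p p) *
      box e b u p ^ 2 := integrable_cutPow_mul he hε hu hs R (1 - β) (hb.pow 2)
    (fun p hp => by simp [box_eq_zero_of_notMem b hs hp])
  have jc : Integrable fun p => cutPow (ε ^ 2) R (-β) (lor e p p) *
      ((fderiv ℝ u p p + ρ * u p) * box e b u p) := integrable_cutPow_mul he hε hu hs R (-β) (hX.mul hb)
    (fun p hp => by simp [hX0 p hp])
  have hcΦ : Continuous fun p : V => -deriv (cutPow (ε ^ 2) R (-β)) (lor e p p) :=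
    hΦ.continuous.comp (continuous_lor e)
  have hQ0 : ∀ p, p - ε • e ∉ ccone e → ((fderiv ℝ u p p) ^ 2
      - lor e p p * lor e (grad b u p) (grad b u p) - ρ ^ 2 * u p ^ 2) = 0 := fun p hp => by
    have h2 : grad b u p = 0 := (grad_eventuallyEq_zero b hs hp).eq_of_nhds
    have h3 : u p = 0 := (eventuallyEq_zero_of_supp hs hp).eq_of_nhds
    simp [euler_eq_zero_of_notMem hs hp, h2, h3, lor_zero]
  have supp0 : ∀ {H : V → ℝ}, (∀ p, p - ε • e ∉ ccone e → H p = 0) →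
      ∀ p, -deriv (cutPow (ε ^ 2) R (-β)) (lor e p p) * H p ≠ 0 →
        p - ε • e ∈ ccone e ∧ lor e p p ≤ R + 1 := fun hH p hp => by
    refine ⟨?_, ?_⟩
    · by_contra h; exact hp (by simp [hH p h])
    · by_contra h
      exact hp (by simp [deriv_eq_zero_of_lt he (cutPow_of_gt hδ R (-β)) (not_le.1 h)])
  have jX : Integrable fun p => -deriv (cutPow (ε ^ 2) R (-β)) (lor e p p) *
      (fderiv ℝ u p p + ρ * u p) ^ 2 :=
    integrable_trunc he hε (hcΦ.mul (hX.pow 2)) (supp0 fun p hp => by simp [hX0 p hp])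
  have jQ : Integrable fun p => -deriv (cutPow (ε ^ 2) R (-β)) (lor e p p) *
      ((fderiv ℝ u p p) ^ 2 - lor e p p * lor e (grad b u p) (grad b u p) - ρ ^ 2 * u p ^ 2) :=
    integrable_trunc he hε (hcΦ.mul (((hE.pow 2).sub ((continuous_lor e).mul
      ((continuous_lor e).comp (contDiff_grad b hu).continuous))).sub
        (continuous_const.mul (hu.continuous.pow 2)))) (supp0 hQ0)
  simp only [mul_add _ ((fderiv ℝ u _ _ + ρ * u _) ^ 2)] at hid
  rw [integral_add jX jQ] at hid
  have s1 : β * ∫ p, cutPow (ε ^ 2) R (-β - 1) (lor e p p) * (fderiv ℝ u p p + ρ * u p) ^ 2 ≤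
      ∫ p, -deriv (cutPow (ε ^ 2) R (-β)) (lor e p p) * (fderiv ℝ u p p + ρ * u p) ^ 2 := by
    rw [← integral_const_mul]
    refine integral_mono (jm.const_mul _) jX fun p => ?_
    by_cases hp : p - ε • e ∈ ccone e
    · have := mul_le_mul_of_nonneg_right (hΦ0 p hp) (sq_nonneg (fderiv ℝ u p p + ρ * u p))
      simpa only [mul_assoc] using this
    · simp [hX0 p hp]
  have s2 : ∫ p, cutPow (ε ^ 2) R (-β) (lor e p p) * (fderiv ℝ u p p + ρ * u p) * box e b u p ≤
      β / 2 * (∫ p, cutPow (ε ^ 2) R (-β - 1) (lor e p p) * (fderiv ℝ u p p + ρ * u p) ^ 2)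
      + 1 / (2 * β) * ∫ p, cutPow (ε ^ 2) R (1 - β) (lor e p p) * box e b u p ^ 2 := by
    rw [← integral_lin2 jm jb]
    refine integral_mono (by simpa only [mul_assoc] using jc)
      ((jm.const_mul _).add (jb.const_mul _)) fun p => ?_
    by_cases hp : p - ε • e ∈ ccone e
    · have hσ := sq_le_lor he hε hp
      have e1 := cutPow_add_one hδ R (-β - 1) hσ
      have e2 := cutPow_add_one hδ R (-β) hσ
      rw [sub_add_cancel] at e1
      rw [neg_add_eq_sub] at e2
      simp only [e2, e1]
      have h2 := hnn (-β - 1) p hp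
      set m := cutPow (ε ^ 2) R (-β - 1) (lor e p p)
      set x := fderiv ℝ u p p + ρ * u p
      have h3 : 0 ≤ m * (β * x - lor e p p * box e b u p) ^ 2 / (2 * β) := by positivity
      have h4 : m * (β * x - lor e p p * box e b u p) ^ 2 / (2 * β) =
        β / 2 * (m * x ^ 2) + 1 / (2 * β) * (lor e p p * (lor e p p * m) * box e b u p ^ 2)
          - lor e p p * m * x * box e b u p := by field_simp; ring
      linarith
    · simp [hX0 p hp, box_eq_zero_of_notMem b hs hp]
  set I := ∫ p, cutPow (ε ^ 2) R (-β - 1) (lor e p p) * (fderiv ℝ u p p + ρ * u p) ^ 2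
  set J := ∫ p, cutPow (ε ^ 2) R (1 - β) (lor e p p) * box e b u p ^ 2
  have s3 : β / 2 * I ≤ 1 / (2 * β) * J := by linarith
  have s4 := mul_le_mul_of_nonneg_left s3 (show 0 ≤ 2 / β by positivity)
  calc I = 2 / β * (β / 2 * I) := by field_simp
    _ ≤ _ := s4
    _ = _ := by field_simp

include b in
lemma hardy_trunc (R : ℝ) :
    ∫ p, cutPow (ε ^ 2) R (-β - 1) (lor e p p) * u p ^ 2 ≤
      (1 / β ^ 2) *
        ∫ p, cutPow (ε ^ 2) R (-β - 1) (lor e p p) * (fderiv ℝ u p p + ρ * u p) ^ 2 := by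
  have hδ : (0 : ℝ) < ε ^ 2 := by positivity
  have hE : Continuous fun p => fderiv ℝ u p p :=
    (hu.continuous_fderiv (by simp)).clm_apply continuous_id
  have hX : Continuous fun p => fderiv ℝ u p p + ρ * u p := hE.add (continuous_const.mul hu.continuous)
  have hu0 : ∀ p, p - ε • e ∉ ccone e → u p = 0 := fun p hp =>
    (eventuallyEq_zero_of_supp hs hp).eq_of_nhds
  have hX0 : ∀ p, p - ε • e ∉ ccone e → fderiv ℝ u p p + ρ * u p = 0 := fun p hp => by
    rw [euler_eq_zero_of_notMem hs hp, hu0 p hp]; simp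
  have hΦ := contDiff_cutPow hδ R (-β - 1)
  have hid := integral_comp_lor_mul_euler (R := R + 1) b he hε hu hs hΦ (cutPow_of_gt hδ R (-β - 1))
  have jm : Integrable fun p => cutPow (ε ^ 2) R (-β - 1) (lor e p p) *
      (fderiv ℝ u p p + ρ * u p) ^ 2 := integrable_cutPow_mul he hε hu hs R (-β - 1) (hX.pow 2)
    (fun p hp => by simp [hX0 p hp])
  have ju : Integrable fun p => cutPow (ε ^ 2) R (-β - 1) (lor e p p) * u p ^ 2 := integrable_cutPow_mul he hε hu hs R (-β - 1) (hu.continuous.pow 2)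
    (fun p hp => by simp [hu0 p hp])
  have je : Integrable fun p => cutPow (ε ^ 2) R (-β - 1) (lor e p p) *
      (u p * fderiv ℝ u p p) := integrable_cutPow_mul he hε hu hs R (-β - 1) (hu.continuous.mul hE)
    (fun p hp => by simp [hu0 p hp])
  have jd : Integrable fun p => deriv (cutPow (ε ^ 2) R (-β - 1)) (lor e p p) * lor e p p *
      u p ^ 2 := by
    refine integrable_trunc (R := R + 1) he hε ((((hΦ.continuous_deriv (by simp)).comp
      (continuous_lor e)).mul (continuous_lor e)).mul (hu.continuous.pow 2)) fun p hp => ⟨?_, ?_⟩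
    · by_contra h; exact hp (by simp [hu0 p h])
    · by_contra h
      exact hp (by simp [deriv_eq_zero_of_lt he (cutPow_of_gt hδ R (-β - 1)) (not_le.1 h)])
  have hN : (Module.finrank ℝ V : ℝ) = 2 * ρ + 2 := by linarith
  rw [hN] at hid
  have s1 : (∫ p, deriv (cutPow (ε ^ 2) R (-β - 1)) (lor e p p) * lor e p p * u p ^ 2) ≤
      (-β - 1) * ∫ p, cutPow (ε ^ 2) R (-β - 1) (lor e p p) * u p ^ 2 := by
    rw [← integral_const_mul]
    refine integral_mono jd (ju.const_mul _) fun p => ?_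
    by_cases hp : p - ε • e ∈ ccone e
    · have hσ := sq_le_lor he hε hp
      have hσ0 := hδ.trans_le hσ
      have h2 := le_neg_deriv_cutPow (β := β + 1) hδ R hσ
      have e1 := cutPow_add_one hδ R (-(β + 1) - 1) hσ
      rw [show -(β + 1) - 1 + 1 = -β - 1 by ring] at e1
      rw [show -(β + 1) = -β - 1 by ring] at h2 e1
      have h3 := mul_le_mul_of_nonneg_right h2 (mul_nonneg hσ0.le (sq_nonneg (u p)))
      simp only [e1]
      linarith
    · simp [hu0 p hp]
  have s2 : ∫ p, cutPow (ε ^ 2) R (-β - 1) (lor e p p) * (u p * (fderiv ℝ u p p)) ≤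
      (β / 2 - ρ) * (∫ p, cutPow (ε ^ 2) R (-β - 1) (lor e p p) * u p ^ 2)
      + 1 / (2 * β) *
        ∫ p, cutPow (ε ^ 2) R (-β - 1) (lor e p p) * (fderiv ℝ u p p + ρ * u p) ^ 2 := by
    rw [← integral_lin2 ju jm]
    refine integral_mono je ((ju.const_mul _).add (jm.const_mul _)) fun p => ?_
    by_cases hp : p - ε • e ∈ ccone e
    · have h2 := cutPow_nonneg hδ R (-β - 1) (sq_le_lor he hε hp)
      simp only
      set m := cutPow (ε ^ 2) R (-β - 1) (lor e p p)
      set x := fderiv ℝ u p p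
      have h3 : 0 ≤ m * (β * u p - (x + ρ * u p)) ^ 2 / (2 * β) := by positivity
      have h4 : m * (β * u p - (x + ρ * u p)) ^ 2 / (2 * β) =
        β / 2 * (m * u p ^ 2) + 1 / (2 * β) * (m * (x + ρ * u p) ^ 2)
          - m * (u p * x) - ρ * (m * u p ^ 2) := by field_simp; ring
      linarith
    · simp [hu0 p hp, euler_eq_zero_of_notMem hs hp]
  set I := ∫ p, cutPow (ε ^ 2) R (-β - 1) (lor e p p) * u p ^ 2
  set J := ∫ p, cutPow (ε ^ 2) R (-β - 1) (lor e p p) * (fderiv ℝ u p p + ρ * u p) ^ 2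
  have s3 : β / 2 * I ≤ 1 / (2 * β) * J := by linarith
  have s4 := mul_le_mul_of_nonneg_left s3 (show 0 ≤ 2 / β by positivity)
  calc I = 2 / β * (β / 2 * I) := by field_simp
    _ ≤ _ := s4
    _ = _ := by field_simp

end Estimate

section Weighted

variable {V : Type*} [NormedAddCommGroup V] [InnerProductSpace ℝ V] {e : V}
  [FiniteDimensional ℝ V] [MeasurableSpace V] [BorelSpace V] {ι : Type*} [Fintype ι]

/-- The weighted square integral `∫ (lor e p p) ^ g * ‖F p‖ ^ 2` over the cone. -/
noncomputable def wsq {G : Type*} [NormedAddCommGroup G] (e : V) (g : ℝ) (F : V → G) : ℝ≥0∞ :=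
  ∫⁻ p in cone e, ENNReal.ofReal (lor e p p ^ g * ‖F p‖ ^ 2)

variable (b : OrthonormalBasis ι ℝ V) (he : ‖e‖ = 1) {ε : ℝ} (hε : 0 < ε)
include he

omit he in
lemma measurable_lor_rpow (e : V) (c : ℝ) : Measurable fun p : V => lor e p p ^ c :=
  (continuous_lor e).measurable.pow_const c

include hε

/-- Removing the truncation at infinity by monotone convergence. -/
lemma lintegral_le_of_trunc {H K : V → ℝ} (hH : Continuous H) (hK : Continuous K)
    (hH0 : ∀ p, 0 ≤ H p) (hK0 : ∀ p, 0 ≤ K p)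
    (hHs : ∀ p, p - ε • e ∉ ccone e → H p = 0) (hKs : ∀ p, p - ε • e ∉ ccone e → K p = 0)
    {c d C : ℝ} (hC : 0 ≤ C)
    (h : ∀ R : ℝ, ∫ p, cutPow (ε ^ 2) R c (lor e p p) * H p ≤
      C * ∫ p, cutPow (ε ^ 2) R d (lor e p p) * K p) :
    ∫⁻ p in cone e, ENNReal.ofReal (lor e p p ^ c * H p) ≤
      ENNReal.ofReal C * ∫⁻ p in cone e, ENNReal.ofReal (lor e p p ^ d * K p) := by
  have hδ : (0 : ℝ) < ε ^ 2 := by positivity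
  have hintg : ∀ (R c : ℝ) {H : V → ℝ}, Continuous H → (∀ p, p - ε • e ∉ ccone e → H p = 0) →
      Integrable fun p => cutPow (ε ^ 2) R c (lor e p p) * H p := fun R c H hH hHs =>
    integrable_cutPow_mul he hε (u := fun _ => 0) contDiff_const (by simp) R c hH hHs
  have hnn : ∀ (R c : ℝ) {H : V → ℝ}, (∀ p, 0 ≤ H p) → (∀ p, p - ε • e ∉ ccone e → H p = 0) →
      ∀ p, 0 ≤ cutPow (ε ^ 2) R c (lor e p p) * H p := fun R c H hH hHs p => by
    by_cases hp : p - ε • e ∈ ccone e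
    · exact mul_nonneg (cutPow_nonneg hδ R c (sq_le_lor he hε hp)) (hH p)
    · simp [hHs p hp]
  set S : ℕ → Set V := fun k => cone e ∩ {p | lor e p p ≤ k}
  have hSU : cone e = ⋃ k, S k := by
    rw [← inter_iUnion, eq_comm, inter_eq_left]
    intro p _
    obtain ⟨k, hk⟩ := exists_nat_ge (lor e p p)
    exact mem_iUnion.2 ⟨k, hk⟩
  have hSm : Monotone S := fun i j hij p hp =>
    ⟨hp.1, le_trans (show lor e p p ≤ i from hp.2) (by exact_mod_cast hij)⟩
  have key : ∀ k, ∫⁻ p in S k, ENNReal.ofReal (lor e p p ^ c * H p) ≤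
      ENNReal.ofReal C * ∫⁻ p in cone e, ENNReal.ofReal (lor e p p ^ d * K p) := fun k => by
    have hS : MeasurableSet (S k) := (measurableSet_cone e).inter
      (measurableSet_le (continuous_lor e).measurable measurable_const)
    calc ∫⁻ p in S k, ENNReal.ofReal (lor e p p ^ c * H p)
        ≤ ∫⁻ p in S k, ENNReal.ofReal (cutPow (ε ^ 2) k c (lor e p p) * H p) := by
          refine setLIntegral_mono' hS fun p hp => ENNReal.ofReal_le_ofReal ?_
          by_cases hp' : p - ε • e ∈ ccone e
          · rw [cutPow_eq hδ _ _ (by linarith [sq_le_lor he hε hp']), cut_eq_one hp.2, one_mul]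
          · simp [hHs p hp']
      _ ≤ ∫⁻ p, ENNReal.ofReal (cutPow (ε ^ 2) k c (lor e p p) * H p) := setLIntegral_le_lintegral _ _
      _ = ENNReal.ofReal (∫ p, cutPow (ε ^ 2) k c (lor e p p) * H p) :=
          (ofReal_integral_eq_lintegral_ofReal (hintg _ _ hH hHs)
            (.of_forall (hnn _ _ hH0 hHs))).symm
      _ ≤ ENNReal.ofReal (C * ∫ p, cutPow (ε ^ 2) k d (lor e p p) * K p) :=
          ENNReal.ofReal_le_ofReal (h k)
      _ = ENNReal.ofReal C * ∫⁻ p, ENNReal.ofReal (cutPow (ε ^ 2) k d (lor e p p) * K p) := by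
          rw [ENNReal.ofReal_mul hC, ofReal_integral_eq_lintegral_ofReal (hintg _ _ hK hKs)
            (.of_forall (hnn _ _ hK0 hKs))]
      _ ≤ _ := by
          refine mul_le_mul_right ?_ _
          rw [← lintegral_indicator (measurableSet_cone e)]
          refine lintegral_mono fun p => ?_
          by_cases hp' : p - ε • e ∈ ccone e
          · have hp : p ∈ cone e := by
              have := add_mem_cone hp' (smul_mem_cone hε (axis_mem_cone he))
              rwa [sub_add_cancel] at this
            rw [indicator_of_mem hp]
            refine ENNReal.ofReal_le_ofReal ?_
            have hσ := sq_le_lor he hε hp'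
            rw [cutPow_eq hδ _ _ (by linarith)]
            have h1 := cut_le_one k (lor e p p)
            have h2 : 0 ≤ lor e p p ^ d * K p :=
              mul_nonneg (Real.rpow_nonneg (by linarith) _) (hK0 p)
            nlinarith
          · simp [hKs p hp']
  conv_lhs => rw [hSU]
  rw [setLIntegral_iUnion_of_directed _ hSm.directed_le]
  exact iSup_le key

variable {ρ : ℝ} (hρ : 2 * ρ = Module.finrank ℝ V - 2) {g : ℝ} (hg : g < 1)
  {e₁ : V} (h1 : ‖e₁‖ = 1) (h0 : ⟪e, e₁⟫_ℝ = 0)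
include hρ hg h1 h0

lemma wsq_energy_real {u : V → ℝ} (hu : ContDiff ℝ (⊤ : ℕ∞) u)
    (hs : ∀ p, u p ≠ 0 → p - ε • e ∈ ccone e) :
    wsq e (g - 2) (fun p => fderiv ℝ u p p + ρ * u p) ≤
      ENNReal.ofReal (1 / (1 - g) ^ 2) * wsq e g (box e b u) := by
  have h := fun R => energy_trunc b he hε hu hs hρ (sub_pos.2 hg) h1 h0 R
  have hE : Continuous fun p => fderiv ℝ u p p :=
    (hu.continuous_fderiv (by simp)).clm_apply continuous_id
  have := lintegral_le_of_trunc he hε (H := fun p => (fderiv ℝ u p p + ρ * u p) ^ 2)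
    (K := fun p => box e b u p ^ 2) ((hE.add (continuous_const.mul hu.continuous)).pow 2)
    ((continuous_box (e := e) b hu).pow 2) (fun p => sq_nonneg _) (fun p => sq_nonneg _)
    (fun p hp => by
      simp [euler_eq_zero_of_notMem hs hp, (eventuallyEq_zero_of_supp hs hp).eq_of_nhds])
    (fun p hp => by simp [box_eq_zero_of_notMem b hs hp]) (by positivity) h
  simp only [show -(1 - g) - 1 = g - 2 by ring, sub_sub_cancel] at this
  simpa [wsq, sq_abs] using this

include b in
lemma wsq_hardy_real {u : V → ℝ} (hu : ContDiff ℝ (⊤ : ℕ∞) u)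
    (hs : ∀ p, u p ≠ 0 → p - ε • e ∈ ccone e) :
    wsq e (g - 2) u ≤
      ENNReal.ofReal (1 / (1 - g) ^ 2) * wsq e (g - 2) (fun p => fderiv ℝ u p p + ρ * u p) := by
  have h := fun R => hardy_trunc b he hε hu hs hρ (sub_pos.2 hg) R
  have hE : Continuous fun p => fderiv ℝ u p p :=
    (hu.continuous_fderiv (by simp)).clm_apply continuous_id
  have := lintegral_le_of_trunc he hε (H := fun p => u p ^ 2)
    (K := fun p => (fderiv ℝ u p p + ρ * u p) ^ 2) (hu.continuous.pow 2)
    ((hE.add (continuous_const.mul hu.continuous)).pow 2) (fun p => sq_nonneg _)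
    (fun p => sq_nonneg _)
    (fun p hp => by simp [(eventuallyEq_zero_of_supp hs hp).eq_of_nhds])
    (fun p hp => by
      simp [euler_eq_zero_of_notMem hs hp, (eventuallyEq_zero_of_supp hs hp).eq_of_nhds])
    (by positivity) h
  rw [show -(1 - g) - 1 = g - 2 by ring] at this
  simpa [wsq, sq_abs] using this

omit hε hρ hg h1 h0 in
lemma wsq_re_add_im {F : V → ℂ} (hF : Measurable F) (g : ℝ) :
    wsq e g F = wsq e g (fun p => (F p).re) + wsq e g (fun p => (F p).im) := by
  unfold wsq
  rw [← lintegral_add_left]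
  · refine setLIntegral_congr_fun (measurableSet_cone e) fun p hp => ?_
    have h0 : 0 ≤ lor e p p ^ g := Real.rpow_nonneg (lor_pos he hp).le _
    simp only
    rw [← ENNReal.ofReal_add (by positivity) (by positivity), ← mul_add, Real.norm_eq_abs,
      Real.norm_eq_abs, sq_abs, sq_abs, ← Complex.normSq_eq_norm_sq, Complex.normSq_apply]
    ring_nf
  · exact ((measurable_lor_rpow e g).mul
      ((Complex.measurable_re.comp hF).norm.pow_const 2)).ennreal_ofReal

omit he hε hρ hg h1 h0 in
lemma fderiv_re {U : V → ℂ} {p : V} (hU : DifferentiableAt ℝ U p) (v : V) :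
    fderiv ℝ (fun p => (U p).re) p v = (fderiv ℝ U p v).re := by
  have := (Complex.reCLM.hasFDerivAt.comp p hU.hasFDerivAt).fderiv
  erw [this]; rfl

omit he hε hρ hg h1 h0 in
lemma fderiv_im {U : V → ℂ} {p : V} (hU : DifferentiableAt ℝ U p) (v : V) :
    fderiv ℝ (fun p => (U p).im) p v = (fderiv ℝ U p v).im := by
  have := (Complex.imCLM.hasFDerivAt.comp p hU.hasFDerivAt).fderiv
  erw [this]; rfl

omit he hε hρ hg h1 h0 in
lemma box_re {U : V → ℂ} (hU : ContDiff ℝ (⊤ : ℕ∞) U) (p : V) :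
    box e b (fun p => (U p).re) p = (box e b U p).re := by
  have h2 : ContDiff ℝ (⊤ : ℕ∞) (fderiv ℝ U) := hU.fderiv_right (m := (⊤ : ℕ∞)) (by simp)
  simp only [box, Complex.re_sum]
  refine Finset.sum_congr rfl fun i _ => ?_
  rw [← fderiv_re ((h2.clm_apply contDiff_const).differentiable (by simp) p)]
  simp only [fderiv_re (hU.differentiable (by simp) _)]

omit he hε hρ hg h1 h0 in
lemma box_im {U : V → ℂ} (hU : ContDiff ℝ (⊤ : ℕ∞) U) (p : V) :
    box e b (fun p => (U p).im) p = (box e b U p).im := by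
  have h2 : ContDiff ℝ (⊤ : ℕ∞) (fderiv ℝ U) := hU.fderiv_right (m := (⊤ : ℕ∞)) (by simp)
  simp only [box, Complex.im_sum]
  refine Finset.sum_congr rfl fun i _ => ?_
  rw [← fderiv_im ((h2.clm_apply contDiff_const).differentiable (by simp) p)]
  simp only [fderiv_im (hU.differentiable (by simp) _)]

lemma wsq_energy {U : V → ℂ} (hU : ContDiff ℝ (⊤ : ℕ∞) U)
    (hs : ∀ p, U p ≠ 0 → p - ε • e ∈ ccone e) :
    wsq e (g - 2) (fun p => euler U p + ρ * U p) ≤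
      ENNReal.ofReal (1 / (1 - g) ^ 2) * wsq e g (box e b U) := by
  have hE : Continuous fun p => fderiv ℝ U p p :=
    (hU.continuous_fderiv (by simp)).clm_apply continuous_id
  rw [wsq_re_add_im he (show Measurable fun p => euler U p + ρ * U p from
    (hE.add (continuous_const.mul hU.continuous)).measurable),
    wsq_re_add_im he (continuous_box (e := e) b hU).measurable g, mul_add]
  have a := wsq_energy_real b he hε hρ hg h1 h0 (u := fun p => (U p).re)
    (Complex.reCLM.contDiff.comp hU) fun p hp => hs p fun h => hp (by simp [h])
  have a' := wsq_energy_real b he hε hρ hg h1 h0 (u := fun p => (U p).im)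
    (Complex.imCLM.contDiff.comp hU) fun p hp => hs p fun h => hp (by simp [h])
  have hd := fun p => hU.differentiable (by simp) p
  simp only [fderiv_re (hd _), fderiv_im (hd _), funext (box_re b hU), funext (box_im b hU)] at a a'
  refine add_le_add ?_ ?_
  · simpa [euler] using a
  · simpa [euler] using a'

include b in
lemma wsq_hardy {U : V → ℂ} (hU : ContDiff ℝ (⊤ : ℕ∞) U)
    (hs : ∀ p, U p ≠ 0 → p - ε • e ∈ ccone e) :
    wsq e (g - 2) U ≤
      ENNReal.ofReal (1 / (1 - g) ^ 2) * wsq e (g - 2) (fun p => euler U p + ρ * U p) := by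
  have hE : Continuous fun p => fderiv ℝ U p p :=
    (hU.continuous_fderiv (by simp)).clm_apply continuous_id
  rw [wsq_re_add_im he (show Measurable fun p => euler U p + ρ * U p from
    (hE.add (continuous_const.mul hU.continuous)).measurable),
    wsq_re_add_im he hU.continuous.measurable, mul_add]
  have a := wsq_hardy_real b he hε hρ hg h1 h0 (u := fun p => (U p).re)
    (Complex.reCLM.contDiff.comp hU) fun p hp => hs p fun h => hp (by simp [h])
  have a' := wsq_hardy_real b he hε hρ hg h1 h0 (u := fun p => (U p).im)
    (Complex.imCLM.contDiff.comp hU) fun p hp => hs p fun h => hp (by simp [h])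
  have hd := fun p => hU.differentiable (by simp) p
  simp only [fderiv_re (hd _), fderiv_im (hd _)] at a a'
  refine add_le_add ?_ ?_
  · simpa [euler] using a
  · simpa [euler] using a'

end Weighted

section WeightedLTwo

variable {V : Type*} [NormedAddCommGroup V] [InnerProductSpace ℝ V] {e : V}
  [FiniteDimensional ℝ V] [MeasurableSpace V] [BorelSpace V] (he : ‖e‖ = 1)
include he

lemma exists_lintegral_cone_eq {a : ℝ} (ha : 0 ≤ a) : ∃ c : ℝ, 0 < c ∧ ∀ p ∈ cone e,
    ∫⁻ ω in cone e, ENNReal.ofReal (lor e ω ω ^ a * Real.exp (-(2 * ⟪ω, p⟫_ℝ))) =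
      ENNReal.ofReal (c * lor e p p ^ (-a - Module.finrank ℝ V / 2)) := by
  have hm := axis_mem_cone he
  have key : ∀ p ∈ cone e,
      IntegrableOn (fun ω => lor e ω ω ^ a * Real.exp (-⟪ω, p⟫_ℝ)) (cone e) ∧
      ((∫ ω in cone e, lor e ω ω ^ a * Real.exp (-⟪ω, p⟫_ℝ) : ℝ) : ℂ) =
        coneGamma e (a : ℂ) * (lor e p p : ℂ) ^ (-(a : ℂ) - Module.finrank ℝ V / 2) := fun p hp => by
    have heq : ∀ ω ∈ cone e, Complex.exp (-(⟪p, ω⟫_ℝ : ℂ)) * (lor e ω ω : ℂ) ^ (a : ℂ) =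
      ((lor e ω ω ^ a * Real.exp (-⟪ω, p⟫_ℝ) : ℝ) : ℂ) := fun ω hω => by
      push_cast
      rw [Complex.ofReal_cpow (lor_pos he hω).le, real_inner_comm, mul_comm]
    refine ⟨?_, ?_⟩
    · have := integrableOn_cone_exp he hp (z := (a : ℂ)) (by simpa using ha)
        (f := fun ω => Complex.exp (-(⟪p, ω⟫_ℝ : ℂ))) (by fun_prop)
        (fun ω => by rw [Complex.norm_exp]; simp)
      rw [integrableOn_congr_fun heq (measurableSet_cone e)] at this
      exact this.re
    · rw [← setIntegral_cone_eq he hp, setIntegral_congr_fun (measurableSet_cone e) heq,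
        integral_complex_ofReal]
  set c := ∫ ω in cone e, lor e ω ω ^ a * Real.exp (-⟪ω, e⟫_ℝ) with hc
  have hcg : (c : ℂ) = coneGamma e (a : ℂ) := by
    rw [hc, (key e hm).2, lor_self_axis he]; simp
  have hc0 : 0 < c := by
    refine lt_of_le_of_ne (setIntegral_nonneg (measurableSet_cone e) fun ω hω => ?_) fun h => ?_
    · exact mul_nonneg (Real.rpow_nonneg (lor_pos he hω).le _) (Real.exp_nonneg _)
    · exact coneGamma_ofReal_ne_zero he ha (by rw [← hcg, ← h]; simp)
  refine ⟨c * 4 ^ (-a - Module.finrank ℝ V / 2 : ℝ), by positivity, fun p hp => ?_⟩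
  have hp2 : (2 : ℝ) • p ∈ cone e := smul_mem_cone two_pos hp
  obtain ⟨h1, h2⟩ := key _ hp2
  have h3 : ∀ ω : V, ⟪ω, (2 : ℝ) • p⟫_ℝ = 2 * ⟪ω, p⟫_ℝ := fun ω => inner_smul_right _ _ _
  simp only [h3] at h1 h2
  rw [← ofReal_integral_eq_lintegral_ofReal h1]
  · congr 1
    have h4 : lor e ((2 : ℝ) • p) ((2 : ℝ) • p) = 4 * lor e p p := by
      rw [lor_smul_left, lor_smul_right]; ring
    rw [h4, ← hcg] at h2
    have h5 := lor_pos he hp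
    rw [mul_assoc, ← Real.mul_rpow (by norm_num) h5.le]
    apply Complex.ofReal_injective
    rw [h2]
    push_cast
    rw [show ((4 : ℂ) * (lor e p p : ℂ)) = ((4 * lor e p p : ℝ) : ℂ) by push_cast; rfl,
      Complex.ofReal_cpow (by positivity)]
    push_cast
    rfl
  · filter_upwards [ae_restrict_mem (measurableSet_cone e)] with ω hω
    exact mul_nonneg (Real.rpow_nonneg (lor_pos he hω).le _) (Real.exp_nonneg _)

/-- Averaging the exponentially weighted norms over the cone gives a power weight. -/
lemma exists_wsq_eq {a : ℝ} (ha : 0 ≤ a) : ∃ c : ℝ, 0 < c ∧ ∀ F : V → ℂ, Continuous F →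
    (∀ p, F p ≠ 0 → p ∈ cone e) →
    ∫⁻ ω in cone e, ENNReal.ofReal (lor e ω ω ^ a) *
      ∫⁻ p, ENNReal.ofReal (Real.exp (-(2 * ⟪ω, p⟫_ℝ)) * ‖F p‖ ^ 2) =
      ENNReal.ofReal c * wsq e (-a - Module.finrank ℝ V / 2) F := by
  obtain ⟨c, hc, h⟩ := exists_lintegral_cone_eq he ha
  refine ⟨c, hc, fun F hF hs => ?_⟩
  have hmeas : Measurable fun x : V × V => ENNReal.ofReal (Real.exp (-(2 * ⟪x.1, x.2⟫_ℝ)) *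
      ‖F x.2‖ ^ 2) := by
    have : Continuous fun x : V × V => Real.exp (-(2 * ⟪x.1, x.2⟫_ℝ)) * ‖F x.2‖ ^ 2 := by fun_prop
    exact this.measurable.ennreal_ofReal
  have hmw : Measurable fun ω : V => ENNReal.ofReal (lor e ω ω ^ a) :=
    (measurable_lor_rpow e a).ennreal_ofReal
  calc ∫⁻ ω in cone e, ENNReal.ofReal (lor e ω ω ^ a) *
        ∫⁻ p, ENNReal.ofReal (Real.exp (-(2 * ⟪ω, p⟫_ℝ)) * ‖F p‖ ^ 2)
      = ∫⁻ ω in cone e, ∫⁻ p, ENNReal.ofReal (lor e ω ω ^ a) *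
          ENNReal.ofReal (Real.exp (-(2 * ⟪ω, p⟫_ℝ)) * ‖F p‖ ^ 2) := by
        refine lintegral_congr fun ω => ?_
        rw [lintegral_const_mul]
        exact hmeas.comp measurable_prodMk_left
    _ = ∫⁻ p, ∫⁻ ω in cone e, ENNReal.ofReal (lor e ω ω ^ a) *
          ENNReal.ofReal (Real.exp (-(2 * ⟪ω, p⟫_ℝ)) * ‖F p‖ ^ 2) := by
        refine lintegral_lintegral_swap ?_
        exact ((hmw.comp measurable_fst).mul hmeas).aemeasurable
    _ = ∫⁻ p, ENNReal.ofReal (‖F p‖ ^ 2) * ∫⁻ ω in cone e,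
          ENNReal.ofReal (lor e ω ω ^ a * Real.exp (-(2 * ⟪ω, p⟫_ℝ))) := by
        refine lintegral_congr fun p => ?_
        rw [← lintegral_const_mul]
        · refine setLIntegral_congr_fun (measurableSet_cone e) fun ω hω => ?_
          have h1 : 0 ≤ lor e ω ω ^ a := Real.rpow_nonneg (lor_pos he hω).le _
          rw [← ENNReal.ofReal_mul h1, ← ENNReal.ofReal_mul (by positivity)]
          congr 1; ring
        · refine Measurable.ennreal_ofReal ((measurable_lor_rpow e a).mul ?_)
          have : Continuous fun ω : V => Real.exp (-(2 * ⟪ω, p⟫_ℝ)) := by fun_prop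
          exact this.measurable
    _ = ∫⁻ p in cone e, ENNReal.ofReal (‖F p‖ ^ 2) * ∫⁻ ω in cone e,
          ENNReal.ofReal (lor e ω ω ^ a * Real.exp (-(2 * ⟪ω, p⟫_ℝ))) := by
        refine (setLIntegral_eq_of_support_subset fun p hp => hs p fun h0 => hp ?_).symm
        simp [h0]
    _ = ∫⁻ p in cone e, ENNReal.ofReal c *
          ENNReal.ofReal (lor e p p ^ (-a - Module.finrank ℝ V / 2 : ℝ) * ‖F p‖ ^ 2) := by
        refine setLIntegral_congr_fun (measurableSet_cone e) fun p hp => ?_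
        rw [h p hp, ← ENNReal.ofReal_mul (by positivity), ← ENNReal.ofReal_mul hc.le]
        congr 1; ring
    _ = _ := by
        rw [lintegral_const_mul, wsq]
        exact ((measurable_lor_rpow e _).mul (hF.norm.measurable.pow_const 2)).ennreal_ofReal

omit he in
lemma IsConj.lintegral_eq {ω : V} {F : V → ℂ} {S : 𝓢(V, ℂ)} (h : IsConj ω F S) :
    ∫⁻ p, ENNReal.ofReal (Real.exp (-(2 * ⟪ω, p⟫_ℝ)) * ‖F p‖ ^ 2) =
      ENNReal.ofReal (∫ p, ‖S p‖ ^ 2) := by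
  have hi : Integrable (fun p => ‖S p‖ ^ 2) (volume : Measure V) := by
    have := (S.memLp 2 volume).integrable_norm_pow (by norm_num)
    simpa using this
  rw [ofReal_integral_eq_lintegral_ofReal hi (.of_forall fun p => sq_nonneg _)]
  refine lintegral_congr fun p => ?_
  rw [h p, norm_mul, Complex.norm_exp, mul_pow, ← Real.exp_nat_mul]
  congr 3
  simp

lemma Cls.mem_cone {F : V → ℂ} (hF : Cls e F) {p : V} (hp : F p ≠ 0) : p ∈ cone e := by
  obtain ⟨ε, hε, h⟩ := hF.supp
  have := add_mem_cone (h p hp) (smul_mem_cone hε (axis_mem_cone he))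
  rwa [sub_add_cancel] at this

/-- The weighted estimate for very negative powers, from Plancherel's theorem. -/
lemma wsq_RP_le_of_le {g : ℝ} (hg : g ≤ -(Module.finrank ℝ V / 2)) {α₀ : ℝ} (hα : 0 ≤ α₀) :
    ∃ C : ℝ, 0 < C ∧ ∀ (F : V → ℂ) (_ : Cls e F) (y : ℝ),
      wsq e (g - α₀) (RP e (α₀ + y * Complex.I) F) ≤
        ENNReal.ofReal (C * Real.exp (C * |y|)) * wsq e g F := by
  obtain ⟨c, hc, h⟩ := exists_wsq_eq he (show 0 ≤ -g - Module.finrank ℝ V / 2 by linarith)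
  obtain ⟨c', hc', h'⟩ := exists_wsq_eq he
    (show 0 ≤ -g - Module.finrank ℝ V / 2 + α₀ by linarith)
  rw [show -(-g - Module.finrank ℝ V / 2 : ℝ) - Module.finrank ℝ V / 2 = g by ring] at h
  rw [show -(-g - Module.finrank ℝ V / 2 + α₀ : ℝ) - Module.finrank ℝ V / 2 = g - α₀ by ring] at h'
  refine ⟨c / c' + Real.pi, by positivity, fun F hF y => ?_⟩
  have key : ENNReal.ofReal c' * wsq e (g - α₀) (RP e (α₀ + y * Complex.I) F) ≤
      ENNReal.ofReal (Real.exp (Real.pi * |y|)) * (ENNReal.ofReal c * wsq e g F) := by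
    rw [← h' _ ((hF.RP he _).contDiff he).continuous (fun p hp => (hF.RP he _).mem_cone he hp),
      ← h _ (hF.contDiff he).continuous (fun p hp => hF.mem_cone he hp)]
    rw [← lintegral_const_mul' _ _ ENNReal.ofReal_ne_top]
    refine setLIntegral_mono' (measurableSet_cone e) fun ω hω => ?_
    obtain ⟨S, hS⟩ := hF.conj ω hω
    rw [hS.lintegral_eq, (hF.isConj_RP he hω _ hS).lintegral_eq]
    have hσ := lor_pos he hω
    have h3 := integral_norm_sq_T_le he hω (α := α₀ + y * Complex.I) (by simpa using hα) S
    rw [← ENNReal.ofReal_mul (by positivity), ← ENNReal.ofReal_mul (by positivity),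
      ← ENNReal.ofReal_mul (by positivity)]
    refine ENNReal.ofReal_le_ofReal ?_
    simp only [Complex.add_re, Complex.ofReal_re, Complex.mul_re, Complex.I_re, mul_zero,
      Complex.I_im, Complex.ofReal_im, Complex.add_im, Complex.mul_im, mul_one, zero_add,
      sub_self, add_zero] at h3
    rw [Real.rpow_add hσ]
    calc _ ≤ lor e ω ω ^ (-g - Module.finrank ℝ V / 2 : ℝ) * lor e ω ω ^ α₀ *
          (lor e ω ω ^ (-α₀) * Real.exp (Real.pi * |y|) * ∫ p, ‖S p‖ ^ 2) := by gcongr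
      _ = (lor e ω ω ^ α₀ * lor e ω ω ^ (-α₀)) * (Real.exp (Real.pi * |y|) *
          (lor e ω ω ^ (-g - Module.finrank ℝ V / 2 : ℝ) * ∫ p, ‖S p‖ ^ 2)) := by ring
      _ = _ := by rw [← Real.rpow_add hσ, add_neg_cancel, Real.rpow_zero, one_mul]
  have hc0 : ENNReal.ofReal c' ≠ 0 := by simpa using hc'
  have h4 : wsq e (g - α₀) (RP e (α₀ + y * Complex.I) F) =
      ENNReal.ofReal (1 / c') * (ENNReal.ofReal c' * wsq e (g - α₀)
        (RP e (α₀ + y * Complex.I) F)) := by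
    rw [← mul_assoc, ← ENNReal.ofReal_mul (by positivity), one_div_mul_cancel hc'.ne']
    simp
  rw [h4]
  refine (mul_le_mul_right key _).trans ?_
  rw [← mul_assoc, ← mul_assoc, ← ENNReal.ofReal_mul (by positivity),
    ← ENNReal.ofReal_mul (by positivity)]
  refine mul_le_mul_left (ENNReal.ofReal_le_ofReal ?_) _
  have h5 : 1 / c' * Real.exp (Real.pi * |y|) * c = c / c' * Real.exp (Real.pi * |y|) := by ring
  rw [h5]
  have := Real.pi_pos
  have h6 : 0 ≤ c / c' := by positivity
  gcongr <;> linarith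

omit he in
lemma wsq_add_le (g : ℝ) {F G : V → ℂ} (hF : Measurable F) (he : ‖e‖ = 1) :
    wsq e g (fun p => F p + G p) ≤ 2 * wsq e g F + 2 * wsq e g G := by
  have hm : Measurable fun p => ENNReal.ofReal (lor e p p ^ g * ‖F p‖ ^ 2) :=
    ((measurable_lor_rpow e g).mul (hF.norm.pow_const 2)).ennreal_ofReal
  unfold wsq
  rw [← lintegral_const_mul _ hm, ← lintegral_const_mul' _ _ (by simp), ← lintegral_add_left]
  · refine setLIntegral_mono' (measurableSet_cone e) fun p hp => ?_
    have h0 : 0 ≤ lor e p p ^ g := Real.rpow_nonneg (lor_pos he hp).le _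
    have h2 : (2 : ℝ≥0∞) = ENNReal.ofReal 2 := by simp
    rw [h2, ← ENNReal.ofReal_mul zero_le_two, ← ENNReal.ofReal_mul zero_le_two,
      ← ENNReal.ofReal_add (by positivity) (by positivity)]
    refine ENNReal.ofReal_le_ofReal ?_
    have h3 : ‖F p + G p‖ ^ 2 ≤ 2 * ‖F p‖ ^ 2 + 2 * ‖G p‖ ^ 2 := by
      have h4 := norm_add_le (F p) (G p)
      have h5 := norm_nonneg (F p + G p)
      nlinarith [sq_nonneg (‖F p‖ - ‖G p‖)]
    have := mul_le_mul_of_nonneg_left h3 h0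
    linarith
  · exact hm.const_mul _

omit he in
lemma wsq_const_mul (g : ℝ) (c : ℂ) (F : V → ℂ) :
    wsq e g (fun p => c * F p) = ENNReal.ofReal (‖c‖ ^ 2) * wsq e g F := by
  unfold wsq
  rw [← lintegral_const_mul' _ _ ENNReal.ofReal_ne_top]
  refine lintegral_congr fun p => ?_
  rw [← ENNReal.ofReal_mul (by positivity), norm_mul]
  congr 1; ring

lemma wsq_lor_mul (g : ℝ) (F : V → ℂ) :
    wsq e (g - 2) (fun p => (lor e p p : ℂ) * F p) = wsq e g F := by
  unfold wsq
  refine setLIntegral_congr_fun (measurableSet_cone e) fun p hp => ?_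
  have h0 := lor_pos he hp
  have h1 : lor e p p ^ g = lor e p p ^ (g - 2) * lor e p p ^ 2 := by
    rw [← Real.rpow_natCast, ← Real.rpow_add h0]; norm_num
  simp only
  rw [norm_mul, Complex.norm_real, Real.norm_eq_abs, mul_pow, sq_abs, h1]
  congr 1; ring

variable {e₁ : V} (h1 : ‖e₁‖ = 1) (h0 : ⟪e, e₁⟫_ℝ = 0)
include h1 h0

lemma wsq_commutator_le {g : ℝ} (hg : g < 1) {F : V → ℂ} (hF : Cls e F) (α : ℂ) :
    wsq e (g - 2) (fun p => 2 * euler (RP e 2 F) p +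
      ((Module.finrank ℝ V : ℂ) - 2 + α) * RP e 2 F p) ≤
      ENNReal.ofReal (8 * (1 / (1 - g) ^ 2) + 2 * ‖α‖ ^ 2 * (1 / (1 - g) ^ 2) ^ 2) *
        wsq e g F := by
  set b := stdOrthonormalBasis ℝ V
  set U := RP e 2 F with hUdef
  set ρ : ℝ := (Module.finrank ℝ V - 2) / 2 with hρ'
  have hρ : 2 * ρ = Module.finrank ℝ V - 2 := by rw [hρ']; ring
  have hU := hF.RP he 2
  have hUc := hU.contDiff he
  obtain ⟨ε, hε, hs⟩ := hU.supp
  have k1 := wsq_energy b he hε hρ hg h1 h0 hUc hs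
  have k2 := wsq_hardy b he hε hρ hg h1 h0 hUc hs
  rw [funext (hF.box_RP he b)] at k1
  set K := 1 / (1 - g) ^ 2 with hK
  have hK0 : 0 ≤ K := by positivity
  have hH : (fun p => 2 * euler U p + ((Module.finrank ℝ V : ℂ) - 2 + α) * U p) =
      fun p => 2 * (euler U p + ρ * U p) + α * U p := by
    funext p
    have : (Module.finrank ℝ V : ℂ) - 2 = 2 * ρ := by exact_mod_cast hρ.symm
    rw [this]; ring
  have hE : Measurable fun p => euler U p + ρ * U p :=
    ((hU.euler.contDiff he).continuous.add (continuous_const.mul hUc.continuous)).measurable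
  rw [hH]
  calc _ ≤ 2 * wsq e (g - 2) (fun p => 2 * (euler U p + ρ * U p)) +
        2 * wsq e (g - 2) (fun p => α * U p) := wsq_add_le _ (hE.const_mul _) he
    _ = ENNReal.ofReal 8 * wsq e (g - 2) (fun p => euler U p + ρ * U p) +
        ENNReal.ofReal (2 * ‖α‖ ^ 2) * wsq e (g - 2) U := by
        rw [wsq_const_mul, wsq_const_mul, ← mul_assoc, ← mul_assoc,
          show (2 : ℝ≥0∞) = ENNReal.ofReal 2 by simp, ← ENNReal.ofReal_mul zero_le_two,
          ← ENNReal.ofReal_mul zero_le_two]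
        norm_num
    _ ≤ ENNReal.ofReal 8 * (ENNReal.ofReal K * wsq e g F) + ENNReal.ofReal (2 * ‖α‖ ^ 2) *
        (ENNReal.ofReal K * (ENNReal.ofReal K * wsq e g F)) := by
        gcongr
        exact k2.trans (by gcongr)
    _ = _ := by
        rw [← mul_assoc, ← mul_assoc, ← mul_assoc, ← ENNReal.ofReal_mul (by norm_num),
          ← ENNReal.ofReal_mul (by positivity), ← ENNReal.ofReal_mul (by positivity), ← add_mul,
          ← ENNReal.ofReal_add (by positivity) (by positivity)]
        congr 2; ring

lemma wsq_RP_le_step {g : ℝ} (hg : g < 1) {α₀ : ℝ} (hα : 0 ≤ α₀)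
    (h : ∃ C : ℝ, 0 < C ∧ ∀ (F : V → ℂ) (_ : Cls e F) (y : ℝ),
      wsq e (g - 2 - α₀) (RP e (α₀ + y * Complex.I) F) ≤
        ENNReal.ofReal (C * Real.exp (C * |y|)) * wsq e (g - 2) F) :
    ∃ C : ℝ, 0 < C ∧ ∀ (F : V → ℂ) (_ : Cls e F) (y : ℝ),
      wsq e (g - α₀) (RP e (α₀ + y * Complex.I) F) ≤
        ENNReal.ofReal (C * Real.exp (C * |y|)) * wsq e g F := by
  obtain ⟨C, hC, h⟩ := h
  set K := 1 / (1 - g) ^ 2 with hK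
  have hK0 : 0 ≤ K := by positivity
  set M := 2 * (1 + (8 * K + 2 * K ^ 2)) * (1 + α₀) ^ 4 with hM
  have hM0 : 0 < M := by positivity
  refine ⟨M * C + (C + 4), by positivity, fun F hF y => ?_⟩
  set α : ℂ := α₀ + y * Complex.I with hαd
  set H := fun p => 2 * euler (RP e 2 F) p + ((Module.finrank ℝ V : ℂ) - 2 + α) * RP e 2 F p
  have hHc : Cls e H := ((hF.RP he 2).euler.const_mul 2).add he ((hF.RP he 2).const_mul _)
  have hnα : ‖α‖ ≤ (1 + α₀) * Real.exp |y| := by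
    have e1 : ‖α‖ ≤ α₀ + |y| := by
      refine (norm_add_le _ _).trans ?_
      simp [abs_of_nonneg hα]
    have e2 := Real.add_one_le_exp |y|
    nlinarith [abs_nonneg y, Real.exp_nonneg |y|]
  have hexp : 1 ≤ Real.exp |y| := Real.one_le_exp (abs_nonneg y)
  set A := C * Real.exp (C * |y|) with hA
  have hA0 : 0 ≤ A := by positivity
  calc wsq e (g - α₀) (RP e α F)
      = wsq e (g - 2 - α₀) (fun p => (lor e p p : ℂ) * RP e α F p) := by
        rw [← wsq_lor_mul he, sub_right_comm]
    _ = wsq e (g - 2 - α₀) (fun p => RP e α (fun p => (lor e p p : ℂ) * F p) p +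
          α * RP e α H p) := by
        rw [funext (hF.lor_mul_RP he α)]
    _ ≤ 2 * wsq e (g - 2 - α₀) (RP e α (fun p => (lor e p p : ℂ) * F p)) +
          2 * wsq e (g - 2 - α₀) (fun p => α * RP e α H p) :=
        wsq_add_le _ ((hF.mulLor.RP he α).contDiff he).continuous.measurable he
    _ ≤ 2 * (ENNReal.ofReal A * wsq e g F) + 2 * (ENNReal.ofReal (‖α‖ ^ 2) *
          (ENNReal.ofReal A * (ENNReal.ofReal (8 * K + 2 * ‖α‖ ^ 2 * K ^ 2) * wsq e g F))) := by
        rw [wsq_const_mul]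
        gcongr
        · refine (h _ hF.mulLor y).trans_eq ?_
          rw [wsq_lor_mul he]
        · refine (h _ hHc y).trans ?_
          gcongr
          exact wsq_commutator_le he h1 h0 hg hF α
    _ = ENNReal.ofReal (2 * A * (1 + ‖α‖ ^ 2 * (8 * K + 2 * ‖α‖ ^ 2 * K ^ 2))) *
          wsq e g F := by
        simp only [← mul_assoc]
        rw [show (2 : ℝ≥0∞) = ENNReal.ofReal 2 by simp, ← ENNReal.ofReal_mul (by positivity),
          ← ENNReal.ofReal_mul (by positivity), ← ENNReal.ofReal_mul (by positivity),
          ← ENNReal.ofReal_mul (by positivity), ← add_mul,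
          ← ENNReal.ofReal_add (by positivity) (by positivity)]
        congr 2; ring
    _ ≤ _ := by
        refine mul_le_mul_left (ENNReal.ofReal_le_ofReal ?_) _
        set X := (1 + α₀) * Real.exp |y| with hX
        have hX1 : 1 ≤ X := by nlinarith
        have e1 : 1 + ‖α‖ ^ 2 * (8 * K + 2 * ‖α‖ ^ 2 * K ^ 2) ≤
            (1 + (8 * K + 2 * K ^ 2)) * X ^ 4 := by
          have e2 : ‖α‖ ^ 2 ≤ X ^ 2 := by gcongr
          have e3 : 1 ≤ X ^ 2 := one_le_pow₀ hX1
          have e4 : X ^ 4 = X ^ 2 * X ^ 2 := by ring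
          rw [e4]
          set s := ‖α‖ ^ 2
          have hs : 0 ≤ s := by positivity
          set t := X ^ 2
          have e5 : s ≤ t * t := by nlinarith
          have e6 : s * s ≤ t * t := by nlinarith
          nlinarith [mul_nonneg hK0 (sub_nonneg.2 e5), mul_nonneg (sq_nonneg K) (sub_nonneg.2 e6)]
        calc 2 * A * (1 + ‖α‖ ^ 2 * (8 * K + 2 * ‖α‖ ^ 2 * K ^ 2))
            ≤ 2 * A * ((1 + (8 * K + 2 * K ^ 2)) * X ^ 4) := by gcongr
          _ = M * C * Real.exp ((C + 4) * |y|) := by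
              rw [hX, hA, hM, mul_pow, ← Real.exp_nat_mul, add_mul C 4, Real.exp_add]
              push_cast; ring
          _ ≤ _ := by
              have hMC : 0 < M * C := by positivity
              exact mul_le_mul (by linarith) (Real.exp_le_exp.2
                (mul_le_mul_of_nonneg_right (by linarith) (abs_nonneg y)))
                (Real.exp_nonneg _) (by positivity)

/-- The weighted `L²` estimates for the Riesz operators. -/
theorem exists_wsq_RP_le {g : ℝ} (hg : g < 1) {α₀ : ℝ} (hα : 0 ≤ α₀) :
    ∃ C : ℝ, 0 < C ∧ ∀ (F : V → ℂ) (_ : Cls e F) (y : ℝ),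
      wsq e (g - α₀) (RP e (α₀ + y * Complex.I) F) ≤
        ENNReal.ofReal (C * Real.exp (C * |y|)) * wsq e g F := by
  obtain ⟨k, hk⟩ := exists_nat_ge (g + Module.finrank ℝ V / 2)
  have main : ∀ (k : ℕ) (g : ℝ), g < 1 → g + Module.finrank ℝ V / 2 ≤ k →
      ∃ C : ℝ, 0 < C ∧ ∀ (F : V → ℂ) (_ : Cls e F) (y : ℝ),
      wsq e (g - α₀) (RP e (α₀ + y * Complex.I) F) ≤
        ENNReal.ofReal (C * Real.exp (C * |y|)) * wsq e g F := fun k => by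
    induction k with
    | zero => exact fun g _ h => wsq_RP_le_of_le he (by push_cast at h; linarith) hα
    | succ k ih =>
      intro g hg h
      push_cast at h
      exact wsq_RP_le_step he h1 h0 hg hα (ih (g - 2) (by linarith) (by linarith))
  exact main k g hg hk

end WeightedLTwo

section UniformBound

variable {V : Type*} [NormedAddCommGroup V] [InnerProductSpace ℝ V] {e : V}
  [FiniteDimensional ℝ V] [MeasurableSpace V] [BorelSpace V] (he : ‖e‖ = 1)
include he

lemma norm_T_le {α : ℂ} (hα : 0 ≤ α.re) (S : 𝓢(V, ℂ)) (p : V) :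
    ‖T e e α S p‖ ≤ Real.exp (Real.pi * |α.im| / 2) * ∫ η, ‖𝓕 S η‖ := by
  have hm := axis_mem_cone he
  rw [T_apply he hm, ← integral_const_mul]
  refine norm_integral_le_of_norm_le ((𝓕 S).integrable.norm.const_mul _) (.of_forall fun η => ?_)
  have h := norm_mult_le he hm hα η
  rw [mult_eq_exp he hm, lor_self_axis he, Real.one_rpow, one_mul] at h
  rw [norm_mul, norm_mul, Complex.norm_exp_ofReal_mul_I, one_mul]
  exact mul_le_mul_of_nonneg_right h (norm_nonneg _)

lemma abs_inner_axis_le (v : V) : |⟪e, v⟫_ℝ| ≤ ‖v‖ := by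
  simpa [he] using abs_real_inner_le_norm e v

lemma norm_sp_le (v : V) : ‖sp e v‖ ≤ ‖v‖ := by
  have := norm_sq_eq_sp he v
  exact abs_le_of_sq_le_sq' (by nlinarith [sq_nonneg ⟪e, v⟫_ℝ]) (norm_nonneg _) |>.2

lemma abs_lor_self_le (v : V) : |lor e v v| ≤ ‖v‖ ^ 2 := by
  have h1 := norm_sq_eq_sp he v
  have h2 := lor_self_eq_sp he v
  rw [abs_le]
  constructor <;> nlinarith [sq_nonneg ⟪e, v⟫_ℝ, sq_nonneg ‖sp e v‖]

lemma smul_axis_add_mem_cone {R : ℝ} (hR : 2 < R) {v : V} (hv : ‖v‖ ≤ 1) : R • e + v ∈ cone e := by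
  have h1 := abs_le.1 (abs_inner_axis_le he v)
  have h2 := norm_sp_le he v
  have h3 : sp e (R • e) = 0 := by
    rw [sp_smul, sp, inner_self_axis he, one_smul, sub_self, smul_zero]
  have h4 : ⟪e, R • e + v⟫_ℝ = R + ⟪e, v⟫_ℝ := by
    rw [inner_add_right, inner_smul_right, inner_self_axis he, mul_one]
  change ‖sp e (R • e + v)‖ < _
  rw [sp_add, h3, zero_add, h4]
  linarith

lemma abs_log_lor_sub_le {R : ℝ} (hR : 6 ≤ R) {v : V} (hv : ‖v‖ ≤ 1) :
    |Real.log (lor e (R • e + v) (R • e + v)) - 2 * Real.log R| ≤ 6 / R := by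
  have h1 := abs_le.1 ((abs_inner_axis_le he v).trans hv)
  have h2 := abs_le.1 ((abs_lor_self_le he v).trans (pow_le_one₀ (norm_nonneg _) hv))
  have hR0 : 0 < R := by linarith
  have h3 : lor e (R • e + v) (R • e + v) = R ^ 2 + 2 * R * ⟪e, v⟫_ℝ + lor e v v := by
    simp only [lor_add_left, lor_add_right, lor_smul_left, lor_smul_right, lor_axis he,
      lor_comm e v e, inner_self_axis he]
    ring
  set σ := lor e (R • e + v) (R • e + v)
  have hσ : 0 < σ := lor_pos he (smul_axis_add_mem_cone he (by linarith) hv)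
  have h4 : Real.log σ - 2 * Real.log R = Real.log (σ / R ^ 2) := by
    rw [Real.log_div hσ.ne' (by positivity), Real.log_pow]; norm_num
  rw [h4]
  set s := σ / R ^ 2
  have hs0 : 0 < s := by positivity
  have hs : |s - 1| ≤ 3 / R := by
    have : s - 1 = (2 * R * ⟪e, v⟫_ℝ + lor e v v) / R ^ 2 := by
      simp only [s, h3]; field_simp; ring
    rw [this, abs_div, abs_of_pos (show 0 < R ^ 2 by positivity), div_le_div_iff₀ (by positivity) hR0]
    have : |2 * R * ⟪e, v⟫_ℝ + lor e v v| ≤ 3 * R := by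
      rw [abs_le]; constructor <;> nlinarith
    nlinarith
  have h5 := Real.log_le_sub_one_of_pos hs0
  have h6 := Real.one_sub_inv_le_log_of_pos hs0
  have h8 : 3 / R ≤ 1 / 2 := by rw [div_le_div_iff₀ hR0 (by norm_num)]; linarith
  have h7 := abs_le.1 hs
  have h9 : 6 / R = 2 * (3 / R) := by ring
  have h10 : -(2 * (3 / R)) ≤ 1 - s⁻¹ := by
    have : 1 - s⁻¹ = (s - 1) / s := by field_simp
    rw [this, le_div_iff₀ hs0]
    nlinarith
  rw [h9, abs_le]
  constructor <;> linarith

/-- A lower bound for the normalising factor on the imaginary axis. -/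
lemma exists_le_norm_coneGamma : ∃ C : ℝ, 0 < C ∧ ∀ y : ℝ,
    1 ≤ C * Real.exp (C * |y|) * ‖coneGamma e (y * Complex.I)‖ := by
  have hm := axis_mem_cone he
  let χ : ContDiffBump (0 : V) := ⟨1 / 2, 1, by norm_num, by norm_num⟩
  have hχc : HasCompactSupport fun p => ((χ p : ℝ) : ℂ) :=
    χ.hasCompactSupport.comp_left (g := fun x : ℝ => (x : ℂ)) (by simp)
  have hχs : ContDiff ℝ (⊤ : ℕ∞) fun p => ((χ p : ℝ) : ℂ) :=
    Complex.ofRealCLM.contDiff.comp χ.contDiff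
  set S : 𝓢(V, ℂ) := hχc.toSchwartzMap hχs with hS
  have hSχ : ∀ p, S p = ((χ p : ℝ) : ℂ) := fun p => rfl
  set I := ∫ p, χ p with hI
  have hI0 : 0 < I := χ.integral_pos
  set B := ∫ η, ‖𝓕 S η‖ with hB
  have hB0 : 0 ≤ B := integral_nonneg fun η => norm_nonneg _
  have key : ∀ y : ℝ, Real.exp (-(6 * (1 + |y|) + 1)) / 2 * I ≤
      ‖coneGamma e (y * Complex.I)‖ * (Real.exp (Real.pi * |y|) * B) := fun y => by
    set R := 6 * (1 + |y|) with hR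
    have hR6 : 6 ≤ R := by rw [hR]; nlinarith [abs_nonneg y]
    have h1 := norm_T_le he (α := 2 * (y * Complex.I) + Module.finrank ℝ V) (by simp) S (R • e)
    have h2 : |(2 * (y * Complex.I) + Module.finrank ℝ V : ℂ).im| = 2 * |y| := by simp [abs_mul]
    rw [h2, show Real.pi * (2 * |y|) / 2 = Real.pi * |y| by ring] at h1
    refine le_trans ?_ (mul_le_mul_of_nonneg_left h1 (norm_nonneg _))
    rw [← norm_mul, coneGamma_mul_T he hm (by simp)]
    set f : V → ℂ := fun p' => Complex.exp (-(⟪e, p'⟫_ℝ : ℂ)) *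
      (lor e p' p' : ℂ) ^ (y * Complex.I) * S (R • e - p') with hf
    have hfi : IntegrableOn f (cone e) := by
      have hcS : Continuous fun p' => S (R • e - p') := S.continuous.comp (by fun_prop)
      have := integrableOn_cone_exp he hm (z := y * Complex.I) (by simp)
        (f := fun p => Complex.exp (-(⟪e, p⟫_ℝ : ℂ)) * S (R • e - p))
        (Continuous.aestronglyMeasurable (by fun_prop))
        (fun p => by
          rw [norm_mul, Complex.norm_exp, hSχ, Complex.norm_real, Real.norm_eq_abs,
            abs_of_nonneg χ.nonneg]
          simpa using mul_le_of_le_one_right (Real.exp_nonneg _) χ.le_one)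
      refine this.congr (.of_forall fun p => ?_)
      simp only [hf]; ring
    set u : ℂ := Complex.exp ((-(y * (2 * Real.log R)) : ℝ) * Complex.I) with hu
    have hun : ‖u‖ = 1 := Complex.norm_exp_ofReal_mul_I _
    have hpt : ∀ p ∈ cone e, Real.exp (-(R + 1)) / 2 * χ (R • e - p) ≤ (u * f p).re := by
      intro p hp
      by_cases h0 : χ (R • e - p) = 0
      · simp [hf, hSχ, h0]
      have hv : ‖p - R • e‖ ≤ 1 := by
        have : R • e - p ∈ Function.support χ := h0
        rw [χ.support_eq, mem_ball_zero_iff] at this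
        rw [norm_sub_rev]; exact this.le
      have hlog := abs_log_lor_sub_le he hR6 hv
      rw [add_sub_cancel] at hlog
      have hinner : ⟪e, p⟫_ℝ ≤ R + 1 := by
        have := (abs_le.1 ((abs_inner_axis_le he (p - R • e)).trans hv)).2
        rw [inner_sub_right, inner_smul_right, inner_self_axis he] at this
        linarith
      have hσ := lor_pos he hp
      set x := y * (Real.log (lor e p p) - 2 * Real.log R) with hx
      have hx1 : x ^ 2 ≤ 1 := by
        rw [sq_le_one_iff_abs_le_one, hx, abs_mul]
        calc |y| * _ ≤ |y| * (6 / R) := by gcongr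
          _ ≤ 1 := by
            rw [← mul_div_assoc, div_le_one (by linarith), hR]; linarith
      have hcos : 1 / 2 ≤ Real.cos x := by
        linarith [Real.one_sub_sq_div_two_le_cos (x := x)]
      have hfe : u * f p = ((Real.exp (-⟪e, p⟫_ℝ) * χ (R • e - p) : ℝ) : ℂ) *
          Complex.exp (x * Complex.I) := by
        simp only [hf, hu, hSχ]
        rw [Complex.cpow_def_of_ne_zero (by exact_mod_cast hσ.ne'), ← Complex.ofReal_log hσ.le]
        push_cast
        have : Complex.exp (x * Complex.I) = Complex.exp (-(y * (2 * (Real.log R : ℂ))) * Complex.I) *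
            Complex.exp ((Real.log (lor e p p) : ℂ) * (y * Complex.I)) := by
          rw [← Complex.exp_add, hx]; push_cast; ring_nf
        rw [this]; push_cast; ring
      rw [hfe, Complex.re_ofReal_mul, Complex.exp_ofReal_mul_I_re]
      have hχ0 : 0 ≤ χ (R • e - p) := χ.nonneg
      have hexp : Real.exp (-(R + 1)) ≤ Real.exp (-⟪e, p⟫_ℝ) := Real.exp_le_exp.2 (by linarith)
      calc Real.exp (-(R + 1)) / 2 * χ (R • e - p)
          = (Real.exp (-(R + 1)) * χ (R • e - p)) * (1 / 2) := by ring
        _ ≤ _ := by gcongr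
    have hχi : Integrable fun p => χ (R • e - p) := (χ.integrable (μ := volume)).comp_sub_left _
    calc Real.exp (-(R + 1)) / 2 * I
        = ∫ p in cone e, Real.exp (-(R + 1)) / 2 * χ (R • e - p) := by
          rw [integral_const_mul, setIntegral_eq_integral_of_forall_compl_eq_zero,
            integral_sub_left_eq_self (fun p => χ p)]
          intro p hp
          by_contra h0
          have : R • e - p ∈ Function.support χ := h0
          rw [χ.support_eq, mem_ball_zero_iff, norm_sub_rev] at this
          have := smul_axis_add_mem_cone he (show 2 < R by linarith) this.le
          rw [add_sub_cancel] at this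
          exact hp this
      _ ≤ ∫ p in cone e, (u * f p).re := by
          refine setIntegral_mono_on (hχi.const_mul _).integrableOn (hfi.const_mul u).re
            (measurableSet_cone e) hpt
      _ = (∫ p in cone e, u * f p).re := integral_re (hfi.const_mul u)
      _ ≤ ‖∫ p in cone e, u * f p‖ := Complex.re_le_norm _
      _ = _ := by rw [integral_const_mul, norm_mul, hun, one_mul]
  refine ⟨2 * Real.exp 7 * B / I + (6 + Real.pi), by have := Real.pi_pos; positivity, fun y => ?_⟩
  have h1 := key y
  have hπ := Real.pi_pos
  set c := ‖coneGamma e (y * Complex.I)‖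
  have hc : 0 ≤ c := norm_nonneg _
  have h2 : 1 ≤ 2 * Real.exp 7 * B / I * Real.exp ((6 + Real.pi) * |y|) * c := by
    have e1 : Real.exp (-(6 * (1 + |y|) + 1)) * (Real.exp 7 * Real.exp (6 * |y|)) = 1 := by
      rw [← Real.exp_add, ← Real.exp_add, Real.exp_eq_one_iff]; ring
    have e2 := mul_le_mul_of_nonneg_left h1
      (show 0 ≤ 2 / I * (Real.exp 7 * Real.exp (6 * |y|)) by positivity)
    have e3 : 2 / I * (Real.exp 7 * Real.exp (6 * |y|)) *
        (Real.exp (-(6 * (1 + |y|) + 1)) / 2 * I) = 1 := by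
      calc _ = (I / I) * (Real.exp (-(6 * (1 + |y|) + 1)) * (Real.exp 7 * Real.exp (6 * |y|))) := by
            ring
        _ = 1 := by rw [e1, div_self hI0.ne', one_mul]
    rw [e3] at e2
    refine e2.trans_eq ?_
    rw [add_mul, Real.exp_add]; ring
  refine h2.trans ?_
  have hA : 0 ≤ 2 * Real.exp 7 * B / I := by positivity
  exact mul_le_mul_of_nonneg_right (mul_le_mul (by linarith) (Real.exp_le_exp.2
    (mul_le_mul_of_nonneg_right (by linarith) (abs_nonneg y))) (Real.exp_nonneg _)
    (by positivity)) hc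

/-- The uniform bound for the Riesz operators on the line where the kernel is bounded. -/
theorem exists_norm_RP_le : ∃ C : ℝ, 0 < C ∧ ∀ (F : V → ℂ) (_ : Cls e F) (_ : Integrable F)
    (y : ℝ) (p : V), ‖RP e (Module.finrank ℝ V + y * Complex.I) F p‖ ≤
      C * Real.exp (C * |y|) * ∫ p, ‖F p‖ := by
  obtain ⟨C, hC, h⟩ := exists_le_norm_coneGamma he
  refine ⟨C, hC, fun F hF hi y p => ?_⟩
  have hm := axis_mem_cone he
  obtain ⟨S, hS⟩ := hF.conj e hm
  have h1 := norm_coneGamma_mul_T_le he hm (y / 2) S p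
  have h2 : (2 * (((y / 2 : ℝ) : ℂ) * Complex.I) + Module.finrank ℝ V : ℂ) =
      Module.finrank ℝ V + y * Complex.I := by push_cast; ring
  rw [h2] at h1
  have h3 : ∫ p' in cone e, Real.exp (-⟪e, p'⟫_ℝ) * ‖S (p - p')‖ ≤
      Real.exp (-⟪e, p⟫_ℝ) * ∫ p, ‖F p‖ := by
    rw [← integral_sub_left_eq_self (fun p => ‖F p‖) volume p, ← integral_const_mul]
    have hi2 : Integrable fun p' => Real.exp (-⟪e, p⟫_ℝ) * ‖F (p - p')‖ :=
      (hi.norm.comp_sub_left p).const_mul _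
    have heq : ∀ p', Real.exp (-⟪e, p'⟫_ℝ) * ‖S (p - p')‖ =
        Real.exp (-⟪e, p⟫_ℝ) * ‖F (p - p')‖ := fun p' => by
      rw [hS, norm_mul, Complex.norm_exp, ← mul_assoc, ← Real.exp_add, inner_sub_right]
      congr 2; simp; ring
    simp only [heq]
    exact setIntegral_le_integral hi2 (.of_forall fun p' => by positivity)
  have h4 := (hF.isConj_RP he hm (Module.finrank ℝ V + y * Complex.I) hS).eq p
  set X := RP e (Module.finrank ℝ V + y * Complex.I) F p
  have h5 : ‖T e e (Module.finrank ℝ V + y * Complex.I) S p‖ = Real.exp (-⟪e, p⟫_ℝ) * ‖X‖ := by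
    rw [h4, norm_mul, Complex.norm_exp, ← mul_assoc, ← Real.exp_add]; simp
  rw [h5] at h1
  have h6 : ‖coneGamma e ((y / 2 : ℝ) * Complex.I)‖ * ‖X‖ ≤ ∫ p, ‖F p‖ := by
    have := h1.trans h3
    rw [mul_left_comm] at this
    exact le_of_mul_le_mul_left this (Real.exp_pos _)
  have h7 := h (y / 2)
  set c := ‖coneGamma e ((y / 2 : ℝ) * Complex.I)‖
  have h8 : Real.exp (C * |y / 2|) ≤ Real.exp (C * |y|) := by
    refine Real.exp_le_exp.2 (mul_le_mul_of_nonneg_left ?_ hC.le)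
    rw [abs_div, abs_two]; linarith [abs_nonneg y]
  calc ‖X‖ = 1 * ‖X‖ := (one_mul _).symm
    _ ≤ (C * Real.exp (C * |y / 2|) * c) * ‖X‖ := by gcongr
    _ = C * Real.exp (C * |y / 2|) * (c * ‖X‖) := by ring
    _ ≤ C * Real.exp (C * |y|) * ∫ p, ‖F p‖ := by gcongr

end UniformBound

section ParametricIntegral

variable {X : Type*} [MeasurableSpace X] {μ : Measure X}

/-- A dominated family of holomorphic functions has a holomorphic integral. -/
lemma diffContOnCl_integral {f : ℂ → X → ℂ} {U : Set ℂ} (hU : IsOpen U) {B : X → ℝ}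
    (hf : ∀ p, Differentiable ℂ fun z => f z p)
    (hm : ∀ z ∈ closure U, AEStronglyMeasurable (f z) μ) (hB : Integrable B μ)
    (hb : ∀ z ∈ closure U, ∀ p, ‖f z p‖ ≤ B p) :
    DiffContOnCl ℂ (fun z => ∫ p, f z p ∂μ) U := by
  refine ⟨fun z₀ hz₀ => DifferentiableAt.differentiableWithinAt ?_, fun z₀ hz₀ => ?_⟩
  · obtain ⟨r, hr, hrU⟩ := Metric.isOpen_iff.1 hU z₀ hz₀
    have hsub : ∀ z ∈ Metric.ball z₀ r, z ∈ closure U := fun z hz => subset_closure (hrU hz)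
    have hr2 : 0 < r / 2 := by positivity
    have hderiv : ∀ z ∈ Metric.ball z₀ (r / 2), ∀ p, ‖deriv (fun z => f z p) z‖ ≤ B p / (r / 3) := by
      intro z hz p
      refine Complex.norm_deriv_le_of_forall_mem_sphere_norm_le (by positivity)
        (hf p).diffContOnCl fun w hw => hb w (hsub w ?_) p
      rw [Metric.mem_ball] at hz ⊢
      rw [mem_sphere_iff_norm, ← dist_eq_norm] at hw
      linarith [dist_triangle w z z₀]
    have hmeas : AEStronglyMeasurable (fun p => deriv (fun z => f z p) z₀) μ := by
      set h : ℕ → ℂ := fun k => ((r / (k + 2) : ℝ) : ℂ) with hh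
      have h0 : Tendsto h atTop (𝓝[≠] 0) := by
        refine tendsto_nhdsWithin_iff.2 ⟨?_, .of_forall fun k => ?_⟩
        · have h1 : Tendsto (fun k : ℕ => r / ((k : ℝ) + 2)) atTop (𝓝 0) :=
            tendsto_const_nhds.div_atTop
              (tendsto_atTop_add_const_right _ _ tendsto_natCast_atTop_atTop)
          have := (Complex.continuous_ofReal.tendsto 0).comp h1
          rwa [Complex.ofReal_zero] at this
        · simp only [hh, mem_compl_iff, mem_singleton_iff, Complex.ofReal_eq_zero]
          positivity
      refine aestronglyMeasurable_of_tendsto_ae atTop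
        (f := fun k p => (h k)⁻¹ • (f (z₀ + h k) p - f z₀ p)) (fun k => ?_)
        (.of_forall fun p => ?_)
      · refine AEStronglyMeasurable.const_smul
          (AEStronglyMeasurable.sub (hm (z₀ + h k) (hsub _ ?_)) (hm _ (subset_closure hz₀))) (h k)⁻¹
        rw [Metric.mem_ball, dist_eq_norm, add_sub_cancel_left, Complex.norm_real,
          Real.norm_of_nonneg (by positivity), div_lt_iff₀ (by positivity)]
        nlinarith [(Nat.cast_nonneg k : (0 : ℝ) ≤ k)]
      · exact (hasDerivAt_iff_tendsto_slope_zero.1 (hf p z₀).hasDerivAt).comp h0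
    refine (hasDerivAt_integral_of_dominated_loc_of_deriv_le
      (bound := fun p => B p / (r / 3)) (Metric.ball_mem_nhds z₀ hr2) ?_ ?_ hmeas
      (.of_forall fun p z hz => hderiv z hz p) (hB.div_const _)
      (.of_forall fun p z _ => (hf p z).hasDerivAt)).2.differentiableAt
    · filter_upwards [Metric.ball_mem_nhds z₀ hr] with z hz using hm z (hsub z hz)
    · exact hB.mono' (hm _ (subset_closure hz₀)) (.of_forall (hb _ (subset_closure hz₀)))
  · exact continuousWithinAt_of_dominated (bound := B)
      (eventually_nhdsWithin_of_forall fun z hz => hm z hz)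
      (eventually_nhdsWithin_of_forall fun z hz => .of_forall (hb z hz)) hB
      (.of_forall fun p => (hf p).continuous.continuousWithinAt)

end ParametricIntegral

section Pairing

variable {V : Type*} [NormedAddCommGroup V] [InnerProductSpace ℝ V] {e : V}
  [FiniteDimensional ℝ V] [MeasurableSpace V] [BorelSpace V]

/-- Cauchy-Schwarz for the weighted norms on the light cone. -/
lemma enorm_integral_mul_sq_le (he : ‖e‖ = 1) (c : ℝ) {u h : V → ℂ} (hu : Measurable u)
    (hh : Measurable h)
    (hs : ∀ p ∉ cone e, h p = 0) :
    ‖∫ p, u p * h p‖ₑ ^ 2 ≤ wsq e c u * wsq e (-c) h := by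
  have hw := measurable_lor_rpow (V := V) e
  have hmc := measurableSet_cone (V := V) e
  have h1 : ∫ p, u p * h p = ∫ p in cone e, u p * h p :=
    (setIntegral_eq_integral_of_forall_compl_eq_zero fun p hp => by rw [hs p hp, mul_zero]).symm
  have h2 : ‖∫ p, u p * h p‖ₑ ≤ ∫⁻ p in cone e,
      ((fun p => ENNReal.ofReal (lor e p p ^ (c / 2) * ‖u p‖)) *
        fun p => ENNReal.ofReal (lor e p p ^ (-c / 2) * ‖h p‖)) p := by
    rw [h1]
    refine (enorm_integral_le_lintegral_enorm _).trans_eq (setLIntegral_congr_fun hmc fun p hp => ?_)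
    have hσ := lor_pos he hp
    simp only [Pi.mul_apply]
    rw [← ofReal_mul (by positivity), ← ofReal_norm, norm_mul]
    congr 1
    have : lor e p p ^ (c / 2) * lor e p p ^ (-c / 2) = 1 := by
      rw [← Real.rpow_add hσ, neg_div, add_neg_cancel, Real.rpow_zero]
    linear_combination (-‖u p‖ * ‖h p‖) * this
  have h3 := ENNReal.lintegral_mul_le_Lp_mul_Lq (volume.restrict (cone e))
    (show (2 : ℝ).HolderConjugate 2 from Real.HolderConjugate.two_two)
    (f := fun p => ENNReal.ofReal (lor e p p ^ (c / 2) * ‖u p‖))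
    (g := fun p => ENNReal.ofReal (lor e p p ^ (-c / 2) * ‖h p‖))
    ((hw _).mul hu.norm).ennreal_ofReal.aemeasurable
    ((hw _).mul hh.norm).ennreal_ofReal.aemeasurable
  have key : ∀ (c : ℝ) (u : V → ℂ), ∫⁻ p in cone e,
      ENNReal.ofReal (lor e p p ^ (c / 2) * ‖u p‖) ^ (2 : ℝ) = wsq e c u := fun c u => by
    refine setLIntegral_congr_fun hmc fun p hp => ?_
    have hσ := lor_pos he hp
    rw [ENNReal.ofReal_rpow_of_nonneg (by positivity) (by norm_num), Real.rpow_two, mul_pow,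
      ← Real.rpow_mul_natCast hσ.le]
    congr 3; push_cast; ring
  rw [key, key] at h3
  calc _ ≤ (wsq e c u ^ (1 / 2 : ℝ) * wsq e (-c) h ^ (1 / 2 : ℝ)) ^ 2 := by
        gcongr; exact h2.trans h3
    _ = _ := by
        rw [mul_pow, ← ENNReal.rpow_mul_natCast, ← ENNReal.rpow_mul_natCast]; norm_num

lemma Cls.zero (he : ‖e‖ = 1) : Cls e (fun _ => 0 : V → ℂ) :=
  Cls.of_compact he contDiff_const (HasCompactSupport.zero) (by
    have : tsupport (fun _ => 0 : V → ℂ) = ∅ := tsupport_eq_empty_iff.2 rfl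
    rw [this]; exact empty_subset _)

lemma Cls.sum (he : ‖e‖ = 1) {κ : Type*} (s : Finset κ) {H : κ → V → ℂ}
    (hH : ∀ i ∈ s, Cls e (H i)) : Cls e fun p => ∑ i ∈ s, H i p := by
  classical
  induction s using Finset.induction_on with
  | empty => simpa using Cls.zero he
  | insert a s ha ih =>
    simp only [Finset.sum_insert ha]
    exact (hH a (Finset.mem_insert_self _ _)).add he
      (ih fun i hi => hH i (Finset.mem_insert_of_mem hi))

/-- A bound for the Riesz operators in vertical strips. -/
lemma Cls.exists_norm_RP_le_exp (he : ‖e‖ = 1) {F : V → ℂ} (hF : Cls e F) {K : Set V}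
    (hK : IsCompact K) : ∃ M : ℝ, 0 ≤ M ∧ ∀ α : ℂ, 0 ≤ α.re → ∀ p ∈ K,
      ‖LightCone.RP e α F p‖ ≤ M * Real.exp (Real.pi * |α.im| / 2) := by
  have hm := axis_mem_cone he
  obtain ⟨S, hS⟩ := hF.conj e hm
  obtain ⟨R, hR⟩ := hK.isBounded.exists_norm_le
  have hS0 : 0 ≤ ∫ η, ‖𝓕 S η‖ := integral_nonneg fun _ => norm_nonneg _
  refine ⟨Real.exp R * ∫ η, ‖𝓕 S η‖, by positivity, fun α hα p hp => ?_⟩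
  have h4 := (hF.isConj_RP he hm α hS).eq p
  have h5 : LightCone.RP e α F p = Complex.exp (⟪e, p⟫_ℝ : ℂ) * T e e α S p := by
    exact h4
  rw [h5, norm_mul, Complex.norm_exp, Complex.ofReal_re, mul_assoc,
    mul_comm (∫ η, ‖𝓕 S η‖)]
  refine mul_le_mul (Real.exp_le_exp.2 ?_) (norm_T_le he hα S p) (norm_nonneg _) (Real.exp_nonneg _)
  exact (le_abs_self _).trans ((abs_inner_axis_le he p).trans (hR p hp))

end Pairing

section ThreeLines

variable {V : Type*} [NormedAddCommGroup V] [InnerProductSpace ℝ V] {e : V}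
  [FiniteDimensional ℝ V] [MeasurableSpace V] [BorelSpace V]

lemma exp_sub_sq_le (a y : ℝ) : Real.exp (a * |y| - y ^ 2) ≤ Real.exp (a ^ 2) := by
  refine Real.exp_le_exp.2 ?_
  nlinarith [sq_nonneg (a - |y|), sq_abs y, sq_nonneg a, sq_nonneg y, sq_nonneg (a + |y|)]

lemma norm_cexp_sq (z : ℂ) : ‖Complex.exp (z ^ 2)‖ = Real.exp (z.re ^ 2 - z.im ^ 2) := by
  rw [Complex.norm_exp]
  congr 1
  simp [sq]

/-- Stein interpolation for the analytic family of Riesz operators, for finite sums. -/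
theorem exists_pairing_three_lines (he : ‖e‖ = 1) {e₁ : V} (h1 : ‖e₁‖ = 1) (h0 : ⟪e, e₁⟫_ℝ = 0)
    {κ α₀ ϑ : ℝ} (hκ : κ < 1) (hα : 0 ≤ α₀) (hϑ0 : 0 ≤ ϑ) (hϑ1 : ϑ ≤ 1)
    (hα2 : (1 - ϑ) * α₀ + ϑ * Module.finrank ℝ V = 2) (ι : Type*) :
    ∃ C : ℝ, 0 < C ∧ ∀ (s : Finset ι) (χ : ι → V → ℂ), (∀ i ∈ s, Cls e (χ i)) →
      (∀ i ∈ s, Integrable (χ i)) → ∀ c : ι → ℂ → ℂ, (∀ i, Differentiable ℂ (c i)) →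
      (∀ i, ∃ M, ∀ z : ℂ, 0 ≤ z.re → z.re ≤ 1 → ‖c i z‖ ≤ M) → ∀ g : ℂ → V → ℂ,
      (∀ p, Differentiable ℂ fun z => g z p) → (∀ z, Measurable (g z)) →
      ∀ K : Set V, IsCompact K → K ⊆ cone e → ∀ M : ℝ,
      (∀ z : ℂ, 0 ≤ z.re → z.re ≤ 1 → ∀ p, ‖g z p‖ ≤ M) → (∀ z, ∀ p ∉ K, g z p = 0) →
      ∀ X B Y : ℝ, 0 ≤ X → 0 ≤ B → 0 ≤ Y →
      (∀ y : ℝ, wsq e κ (fun p => ∑ i ∈ s, c i (y * Complex.I) * χ i p) ≤ ENNReal.ofReal X) →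
      (∀ y : ℝ, wsq e (α₀ - κ) (g (y * Complex.I)) ≤ ENNReal.ofReal B) →
      (∀ y : ℝ, ∫ p, ‖∑ i ∈ s, c i (1 + y * Complex.I) * χ i p‖ ≤ Y) →
      (∀ y : ℝ, ∫ p, ‖g (1 + y * Complex.I) p‖ ≤ B) →
      ‖∫ p, RP e 2 (fun p => ∑ i ∈ s, c i ϑ * χ i p) p * g ϑ p‖ ≤
        C * ((X * B) ^ ((1 - ϑ) / 2) * (Y * B) ^ ϑ) := by
  obtain ⟨C₀, hC₀, hRP0⟩ := exists_wsq_RP_le he h1 h0 hκ hα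
  obtain ⟨C₁, hC₁, hRP1⟩ := exists_norm_RP_le he
  set N : ℝ := ((Module.finrank ℝ V : ℕ) : ℝ) with hN
  set δ : ℝ := N - α₀ with hδ
  set D : ℝ := |δ| with hD
  set A₀ : ℝ := C₀ * Real.exp ((C₀ * D) ^ 2) with hA₀
  set A₁ : ℝ := C₁ * Real.exp (1 + (C₁ * D) ^ 2) with hA₁
  have hA₀' : 0 < A₀ := by positivity
  have hA₁' : 0 < A₁ := by positivity
  refine ⟨A₀ ^ ((1 - ϑ) / 2) * A₁ ^ ϑ, by positivity, ?_⟩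
  intro s χ hχ hχi c hc hcb g hg hgm K hK hKc M hgM hgK X B Y hX0 hB0 hY0 hX hB hY hB1
  set α : ℂ → ℂ := fun z => α₀ + z * δ with hαdef
  have hαre : ∀ z : ℂ, (α z).re = α₀ + z.re * δ := fun z => by simp [hαdef]
  have hαim : ∀ z : ℂ, (α z).im = z.im * δ := fun z => by simp [hαdef]
  have hαd : Differentiable ℂ α := by fun_prop
  set F : ℂ → V → ℂ := fun z p => ∑ i ∈ s, c i z * χ i p with hF
  have hFc : ∀ z, Cls e (F z) := fun z => Cls.sum he s fun i hi => (hχ i hi).const_mul _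
  have hFi : ∀ z, Integrable (F z) := fun z =>
    integrable_finsetSum s fun i hi => (hχi i hi).const_mul _
  have hRP : ∀ z p, RP e (α z) (F z) p = ∑ i ∈ s, c i z * RP e (α z) (χ i) p := fun z p =>
    (hFc z).RP_sum he hχ (fun i => c i z) (fun _ => rfl) (α z) p
  have hRPm : ∀ z, Measurable (RP e (α z) (F z)) := fun z =>
    (((hFc z).RP he (α z)).contDiff he).continuous.measurable
  have hM0 : 0 ≤ M := (norm_nonneg _).trans (hgM 0 le_rfl (by simp) 0)
  set f : ℂ → V → ℂ := fun z p => Complex.exp (z ^ 2) * (RP e (α z) (F z) p * g z p) with hf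
  have hstrip : closure (Complex.HadamardThreeLines.verticalStrip 0 1) ⊆
      Complex.HadamardThreeLines.verticalClosedStrip 0 1 := by
    refine closure_minimal (preimage_mono Ioo_subset_Icc_self) ?_
    exact isClosed_Icc.preimage Complex.continuous_re
  have hopen : IsOpen (Complex.HadamardThreeLines.verticalStrip 0 1) :=
    isOpen_Ioo.preimage Complex.continuous_re
  choose! m hm0 hm using fun i (hi : i ∈ s) => (hχ i hi).exists_norm_RP_le_exp he hK
  choose Mc hMc using hcb
  have hMc0 : ∀ i, 0 ≤ Mc i := fun i => (norm_nonneg _).trans (hMc i 0 le_rfl (by simp))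
  set E : ℝ := Real.exp 1 * Real.exp ((Real.pi * D / 2) ^ 2) with hE
  set L : ℝ := E * ((∑ i ∈ s, Mc i * m i) * M) with hL
  have hfb : ∀ z : ℂ, 0 ≤ z.re → z.re ≤ 1 → ∀ p, ‖f z p‖ ≤ K.indicator (fun _ => L) p := by
    intro z hz0 hz1 p
    by_cases hp : p ∈ K
    swap
    · simp [hf, hgK z p hp, hp]
    rw [indicator_of_mem hp]
    have hre : 0 ≤ (α z).re := by
      rw [hαre, hδ]
      nlinarith [(Nat.cast_nonneg _ : (0 : ℝ) ≤ Module.finrank ℝ V),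
        mul_nonneg hz0 (Nat.cast_nonneg _ : (0 : ℝ) ≤ Module.finrank ℝ V),
        mul_nonneg (sub_nonneg.2 hz1) hα]
    have hexp : Real.exp (z.re ^ 2 - z.im ^ 2) * Real.exp (Real.pi * |(α z).im| / 2) ≤ E := by
      have h := exp_sub_sq_le (Real.pi * D / 2) z.im
      rw [← Real.exp_add, hE, ← Real.exp_add, Real.exp_le_exp, hαim, abs_mul]
      rw [Real.exp_le_exp] at h
      have : z.re ^ 2 ≤ 1 := by nlinarith
      have h2 : Real.pi * (|z.im| * D) / 2 = Real.pi * D / 2 * |z.im| := by ring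
      linarith
    have hsum : ‖RP e (α z) (F z) p‖ ≤
        (∑ i ∈ s, Mc i * m i) * Real.exp (Real.pi * |(α z).im| / 2) := by
      rw [hRP, Finset.sum_mul]
      refine norm_sum_le_of_le _ fun i hi => ?_
      rw [norm_mul, mul_assoc]
      exact mul_le_mul (hMc i z hz0 hz1) (hm i hi _ hre p hp) (norm_nonneg _) (hMc0 i)
    have hS : 0 ≤ ∑ i ∈ s, Mc i * m i :=
      Finset.sum_nonneg fun i hi => mul_nonneg (hMc0 i) (hm0 i hi)
    calc ‖f z p‖ = Real.exp (z.re ^ 2 - z.im ^ 2) * (‖RP e (α z) (F z) p‖ * ‖g z p‖) := by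
          rw [hf, norm_mul, norm_mul, norm_cexp_sq]
      _ ≤ Real.exp (z.re ^ 2 - z.im ^ 2) *
          (((∑ i ∈ s, Mc i * m i) * Real.exp (Real.pi * |(α z).im| / 2)) * M) := by
          gcongr; exact hgM z hz0 hz1 p
      _ = (Real.exp (z.re ^ 2 - z.im ^ 2) * Real.exp (Real.pi * |(α z).im| / 2)) *
          ((∑ i ∈ s, Mc i * m i) * M) := by ring
      _ ≤ L := by rw [hL]; gcongr
  have hLi : Integrable (K.indicator fun _ : V => L) :=
    (integrable_indicator_iff hK.measurableSet).2
      (integrableOn_const hK.measure_lt_top.ne)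
  have hfm : ∀ z, Measurable (f z) := fun z => ((hRPm z).mul (hgm z)).const_mul _
  set Φ : ℂ → ℂ := fun z => ∫ p, f z p with hΦ
  have hΦe : ∀ z, Φ z = Complex.exp (z ^ 2) * ∫ p, RP e (α z) (F z) p * g z p := fun z =>
    integral_const_mul _ _
  have hdc : DiffContOnCl ℂ Φ (Complex.HadamardThreeLines.verticalStrip 0 1) := by
    refine diffContOnCl_integral hopen (fun p => ?_)
      (fun z _ => (hfm z).aestronglyMeasurable) hLi
      (fun z hz p => hfb z (hstrip hz).1 (hstrip hz).2 p)
    have hd : Differentiable ℂ fun z => RP e (α z) (F z) p := by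
      simp only [hRP]
      refine Differentiable.fun_sum fun i hi => (hc i).mul ?_
      exact ((hχ i hi).differentiable_RP he p).comp hαd
    have he2 : Differentiable ℂ fun z : ℂ => Complex.exp (z ^ 2) := by fun_prop
    exact he2.mul (hd.mul (hg p))
  have hbdd : BddAbove (norm ∘ Φ '' Complex.HadamardThreeLines.verticalClosedStrip 0 1) := by
    refine ⟨∫ p, K.indicator (fun _ => L) p, ?_⟩
    rintro _ ⟨z, hz, rfl⟩
    exact norm_integral_le_of_norm_le hLi (.of_forall (hfb z hz.1 hz.2))
  have hleft : ∀ z ∈ Complex.re ⁻¹' {(0 : ℝ)}, ‖Φ z‖ ≤ √(A₀ * (X * B)) := by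
    intro z hz
    have hz' : z = z.im * Complex.I := by apply Complex.ext <;> simp [show z.re = 0 from hz]
    set y := z.im
    refine Real.le_sqrt_of_sq_le ?_
    have hcs := enorm_integral_mul_sq_le he (κ - α₀) (hRPm z) (hgm z)
      fun p hp => hgK z p fun h => hp (hKc h)
    have e1 : α z = α₀ + ((y * δ : ℝ) : ℂ) * Complex.I := by
      rw [hαdef]; simp only []; rw [hz']; push_cast; ring
    have h3 := hRP0 (F z) (hFc z) (y * δ)
    rw [← e1] at h3
    have h4 : wsq e κ (F z) ≤ ENNReal.ofReal X := by
      have := hX y; rw [← hz'] at this; exact this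
    have h5 : wsq e (-(κ - α₀)) (g z) ≤ ENNReal.ofReal B := by
      have := hB y; rw [← hz'] at this; rwa [neg_sub]
    have h6 : ‖∫ p, RP e (α z) (F z) p * g z p‖ₑ ^ 2 ≤
        ENNReal.ofReal (C₀ * Real.exp (C₀ * |y * δ|)) * ENNReal.ofReal X * ENNReal.ofReal B :=
      hcs.trans (by gcongr; exact h3.trans (by gcongr))
    rw [← ofReal_norm, ← ENNReal.ofReal_pow (norm_nonneg _), ← ENNReal.ofReal_mul (by positivity),
      ← ENNReal.ofReal_mul (by positivity), ENNReal.ofReal_le_ofReal_iff (by positivity)] at h6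
    have hexp := exp_sub_sq_le (C₀ * D) y
    rw [hΦe, norm_mul, norm_cexp_sq, show z.re = 0 from hz, mul_pow]
    calc Real.exp (0 ^ 2 - y ^ 2) ^ 2 * ‖∫ p, RP e (α z) (F z) p * g z p‖ ^ 2
        ≤ Real.exp (0 ^ 2 - y ^ 2) * 1 * (C₀ * Real.exp (C₀ * |y * δ|) * X * B) := by
          rw [sq (Real.exp _)]
          gcongr
          exact Real.exp_le_one_iff.2 (by nlinarith [sq_nonneg y])
      _ = C₀ * Real.exp (C₀ * D * |y| - y ^ 2) * (X * B) := by
          rw [sub_eq_add_neg (C₀ * D * |y|), Real.exp_add, abs_mul, ← hD,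
            show C₀ * (|y| * D) = C₀ * D * |y| by ring, show (0 : ℝ) ^ 2 - y ^ 2 = -y ^ 2 by ring]
          ring
      _ ≤ A₀ * (X * B) := by rw [hA₀]; gcongr
  have hright : ∀ z ∈ Complex.re ⁻¹' {(1 : ℝ)}, ‖Φ z‖ ≤ A₁ * (Y * B) := by
    intro z hz
    have hz' : z = 1 + z.im * Complex.I := by apply Complex.ext <;> simp [show z.re = 1 from hz]
    set y := z.im
    have e1 : α z = Module.finrank ℝ V + ((y * δ : ℝ) : ℂ) * Complex.I := by
      rw [hαdef]; simp only []; rw [hz', hδ, hN]; push_cast; ring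
    have h3 := fun p => hRP1 (F z) (hFc z) (hFi z) (y * δ) p
    rw [← e1] at h3
    have h4 : ∫ p, ‖F z p‖ ≤ Y := by
      have := hY y; rw [← hz'] at this; exact this
    have h5 : ∫ p, ‖g z p‖ ≤ B := by
      have := hB1 y; rw [← hz'] at this; exact this
    have hgi : Integrable (g z) := by
      refine Integrable.mono' ((integrable_indicator_iff hK.measurableSet).2
        (integrableOn_const hK.measure_lt_top.ne (C := M))) (hgm z).aestronglyMeasurable
        (.of_forall fun p => ?_)
      by_cases hp : p ∈ K
      · rw [indicator_of_mem hp]; exact hgM z (by rw [show z.re = 1 from hz]; simp) (le_of_eq hz) p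
      · simp [hp, hgK z p hp]
    have h6 : ‖∫ p, RP e (α z) (F z) p * g z p‖ ≤ C₁ * Real.exp (C₁ * |y * δ|) * Y * B := by
      calc _ ≤ ∫ p, C₁ * Real.exp (C₁ * |y * δ|) * Y * ‖g z p‖ := by
            refine norm_integral_le_of_norm_le (hgi.norm.const_mul _) (.of_forall fun p => ?_)
            rw [norm_mul]
            gcongr
            exact (h3 p).trans (by gcongr)
        _ ≤ _ := by rw [integral_const_mul]; gcongr
    have hexp := exp_sub_sq_le (C₁ * D) y
    rw [hΦe, norm_mul, norm_cexp_sq, show z.re = 1 from hz]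
    calc Real.exp (1 ^ 2 - y ^ 2) * ‖∫ p, RP e (α z) (F z) p * g z p‖
        ≤ Real.exp (1 ^ 2 - y ^ 2) * (C₁ * Real.exp (C₁ * |y * δ|) * Y * B) := by gcongr
      _ = C₁ * (Real.exp 1 * Real.exp (C₁ * D * |y| - y ^ 2)) * (Y * B) := by
          rw [sub_eq_add_neg (C₁ * D * |y|), Real.exp_add, abs_mul, ← hD,
            show C₁ * (|y| * D) = C₁ * D * |y| by ring,
            show (1 : ℝ) ^ 2 - y ^ 2 = 1 + -y ^ 2 by ring, Real.exp_add]
          ring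
      _ ≤ A₁ * (Y * B) := by rw [hA₁, Real.exp_add]; gcongr
  have hmem : (ϑ : ℂ) ∈ Complex.HadamardThreeLines.verticalClosedStrip 0 1 := by
    simp [Complex.HadamardThreeLines.verticalClosedStrip, hϑ0, hϑ1]
  have hfin := Complex.HadamardThreeLines.norm_le_interp_of_mem_verticalClosedStrip' one_pos hmem
    hdc hbdd hleft hright
  have hαϑ : α ϑ = 2 := by
    rw [hαdef]; simp only []
    have : α₀ + ϑ * δ = 2 := by rw [hδ]; linarith
    exact_mod_cast this
  rw [hΦe, hαϑ, norm_mul, norm_cexp_sq] at hfin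
  simp only [Complex.ofReal_re, Complex.ofReal_im, sub_zero, div_one] at hfin
  have hone : 1 ≤ Real.exp (ϑ ^ 2 - 0 ^ 2) := Real.one_le_exp (by nlinarith [sq_nonneg ϑ])
  refine (le_mul_of_one_le_left (norm_nonneg _) hone).trans (hfin.trans_eq ?_)
  rw [Real.sqrt_eq_rpow, ← Real.rpow_mul (by positivity), Real.mul_rpow hA₀'.le (by positivity),
    Real.mul_rpow hA₁'.le (by positivity), show 1 / 2 * (1 - ϑ) = (1 - ϑ) / 2 by ring]
  ring

end ThreeLines

section Partition

variable {V : Type*} [NormedAddCommGroup V] [InnerProductSpace ℝ V] [FiniteDimensional ℝ V]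

/-- A finite smooth partition of unity on a compact set, subordinate to small balls. -/
lemma exists_finite_partition {K : Set V} (hK : IsCompact K) {δ : ℝ} (hδ : 0 < δ) :
    ∃ (t : Finset V) (χ : V → V → ℝ), (∀ i ∈ t, i ∈ K) ∧ (∀ i, ContDiff ℝ (⊤ : ℕ∞) (χ i)) ∧
      (∀ i p, 0 ≤ χ i p) ∧ (∀ i ∈ t, tsupport (χ i) ⊆ Metric.ball i δ) ∧
      (∀ p, ∑ i ∈ t, χ i p ≤ 1) ∧ ∀ p ∈ K, ∑ i ∈ t, χ i p = 1 := by
  classical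
  obtain ⟨t, htK, htf, ht⟩ := hK.finite_cover_balls hδ
  obtain ⟨f, hf⟩ := SmoothPartitionOfUnity.exists_isSubordinate (modelWithCornersSelf ℝ V)
    hK.isClosed (fun i : htf.toFinset => Metric.ball (i : V) δ) (fun _ => Metric.isOpen_ball)
    (by intro x hx
        obtain ⟨i, hi, hxi⟩ := mem_iUnion₂.1 (ht hx)
        exact mem_iUnion.2 ⟨⟨i, htf.mem_toFinset.2 hi⟩, hxi⟩)
  refine ⟨htf.toFinset, fun i p => if hi : i ∈ htf.toFinset then f ⟨i, hi⟩ p else 0,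
    fun i hi => htK (htf.mem_toFinset.1 hi), fun i => ?_, fun i p => ?_, fun i hi => ?_,
    fun p => ?_, fun p hp => ?_⟩
  · by_cases hi : i ∈ htf.toFinset
    · simp only [hi, dite_true]
      exact (f ⟨i, hi⟩).contMDiff.contDiff
    · simp only [hi, dite_false]
      exact contDiff_const
  · simp only []
    split_ifs
    · exact f.nonneg _ _
    · exact le_rfl
  · simp only [hi, dite_true]
    exact hf ⟨i, hi⟩
  · have := f.sum_le_one p
    rw [finsum_eq_sum_of_fintype] at this
    rw [← Finset.sum_attach]
    simpa using this
  · have := f.sum_eq_one hp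
    rw [finsum_eq_sum_of_fintype] at this
    rw [← Finset.sum_attach]
    simpa using this

lemma norm_sum_partition_sub_le {E : Type*} [NormedAddCommGroup E] [NormedSpace ℝ E] {K : Set V}
    {δ ω : ℝ} {t : Finset V} {χ : V → V → ℝ} (hnn : ∀ i p, 0 ≤ χ i p)
    (hs : ∀ i ∈ t, tsupport (χ i) ⊆ Metric.ball i δ) (h1 : ∀ p, ∑ i ∈ t, χ i p ≤ 1)
    (hK1 : ∀ p ∈ K, ∑ i ∈ t, χ i p = 1) {G : V → E} (hω : 0 ≤ ω)
    (hG : ∀ x y, dist x y < δ → ‖G x - G y‖ ≤ ω) (hGK : ∀ p ∉ K, G p = 0) (p : V) :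
    ‖∑ i ∈ t, χ i p • G i - G p‖ ≤ ω := by
  have h2 : G p = ∑ i ∈ t, χ i p • G p := by
    rw [← Finset.sum_smul]
    by_cases hp : p ∈ K
    · rw [hK1 p hp, one_smul]
    · rw [hGK p hp, smul_zero]
  calc ‖∑ i ∈ t, χ i p • G i - G p‖ = ‖∑ i ∈ t, χ i p • (G i - G p)‖ := by
        simp only [smul_sub, Finset.sum_sub_distrib]
        rw [← h2]
    _ ≤ ∑ i ∈ t, χ i p * ω := by
        refine norm_sum_le_of_le _ fun i hi => ?_
        rw [norm_smul, Real.norm_of_nonneg (hnn i p)]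
        by_cases hp : χ i p = 0
        · simp [hp]
        have := hs i hi (subset_tsupport _ hp)
        exact mul_le_mul_of_nonneg_left (hG _ _ (by rwa [dist_comm])) (hnn i p)
    _ ≤ 1 * ω := by rw [← Finset.sum_mul]; gcongr; exact h1 p
    _ = ω := one_mul _

lemma continuous_of_continuousOn_of_eq_zero {X E : Type*} [TopologicalSpace X] [TopologicalSpace E]
    [Zero E] {u : X → E} {U K : Set X} (hU : IsOpen U) (hK : IsClosed K) (hKU : K ⊆ U)
    (hu : ContinuousOn u U) (h0 : ∀ p ∉ K, u p = 0) : Continuous u := by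
  refine continuous_iff_continuousAt.2 fun x => ?_
  by_cases hx : x ∈ U
  · exact hu.continuousAt (hU.mem_nhds hx)
  · have : u =ᶠ[𝓝 x] fun _ => 0 := by
      filter_upwards [hK.isOpen_compl.mem_nhds fun h => hx (hKU h)] with y hy using h0 y hy
    exact continuousAt_const.congr this.symm

end Partition

section Stein

/-- The analytic deformation of a value `v` at a point with Lorentz square `σ`. -/
noncomputable def stein (s ϑ m σ : ℝ) (z v : ℂ) : ℂ :=
  if v = 0 then 0 else v / ‖v‖ * Complex.exp ((s / 2 * (1 + z)) *
    (Real.log (σ ^ (-(m * (1 - ϑ))) * ‖v‖) : ℝ) + m * (1 - z) * (Real.log σ : ℝ))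

variable {s ϑ m σ : ℝ}

lemma differentiable_stein (v : ℂ) : Differentiable ℂ fun z => stein s ϑ m σ z v := by
  unfold stein
  split_ifs
  · exact differentiable_const _
  · fun_prop

@[simp] lemma stein_zero (z : ℂ) : stein s ϑ m σ z 0 = 0 := by simp [stein]

lemma stein_self (hs : s * (1 + ϑ) = 2) (hσ : 0 < σ) (v : ℂ) : stein s ϑ m σ ϑ v = v := by
  by_cases hv : v = 0
  · simp [hv]
  have hv' : 0 < ‖v‖ := norm_pos_iff.2 hv
  rw [stein, if_neg hv]
  have h1 : ((s : ℂ) / 2 * (1 + ϑ)) = 1 := by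
    have : s / 2 * (1 + ϑ) = 1 := by linarith
    exact_mod_cast this
  have h2 : (Real.log (σ ^ (-(m * (1 - ϑ))) * ‖v‖) : ℝ) + m * (1 - ϑ) * Real.log σ =
      Real.log ‖v‖ := by
    rw [Real.log_mul (by positivity) hv'.ne', Real.log_rpow hσ]; ring
  rw [h1, one_mul, show (((Real.log (σ ^ (-(m * (1 - ϑ))) * ‖v‖) : ℝ) : ℂ) +
    m * (1 - ϑ) * (Real.log σ : ℝ)) = (Real.log ‖v‖ : ℝ) by rw [← h2]; push_cast; ring,
    ← Complex.ofReal_exp, Real.exp_log hv',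
    div_mul_cancel₀ _ (Complex.ofReal_ne_zero.2 hv'.ne')]

lemma norm_stein (hs : 0 < s) (hσ : 0 < σ) {z : ℂ} (hz : -1 < z.re) (v : ℂ) :
    ‖stein s ϑ m σ z v‖ = (σ ^ (-(m * (1 - ϑ))) * ‖v‖) ^ (s / 2 * (1 + z.re)) *
      σ ^ (m * (1 - z.re)) := by
  have hpos : 0 < s / 2 * (1 + z.re) := by
    have : 0 < 1 + z.re := by linarith
    positivity
  by_cases hv : v = 0
  · simp [hv, Real.zero_rpow hpos.ne']
  have hv' : 0 < ‖v‖ := norm_pos_iff.2 hv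
  rw [stein, if_neg hv, norm_mul, norm_div, Complex.norm_real, norm_norm, div_self hv'.ne', one_mul,
    Complex.norm_exp,
    Real.rpow_def_of_pos (show 0 < σ ^ (-(m * (1 - ϑ))) * ‖v‖ by positivity) (s / 2 * (1 + z.re)),
    Real.rpow_def_of_pos hσ (m * (1 - z.re)), ← Real.exp_add]
  congr 1
  have e1 : ((s : ℂ) / 2 * (1 + z)).re = s / 2 * (1 + z.re) := by
    rw [show (s : ℂ) / 2 = ((s / 2 : ℝ) : ℂ) by push_cast; ring, Complex.re_ofReal_mul]; simp
  have e2 : ((m : ℂ) * (1 - z)).re = m * (1 - z.re) := by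
    rw [Complex.re_ofReal_mul]; simp
  rw [Complex.add_re, Complex.re_mul_ofReal, Complex.re_mul_ofReal, e1, e2]
  ring

lemma norm_stein_le (hs : 0 < s) (hσ : 0 < σ) {z : ℂ} (hz0 : 0 ≤ z.re) (hz1 : z.re ≤ 1) (v : ℂ) :
    ‖stein s ϑ m σ z v‖ ≤ (1 + σ ^ (-(m * (1 - ϑ))) * ‖v‖) ^ s *
      Real.exp (|m| * |Real.log σ|) := by
  rw [norm_stein hs hσ (by linarith)]
  have h0 : 0 ≤ σ ^ (-(m * (1 - ϑ))) * ‖v‖ := by positivity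
  refine mul_le_mul ?_ ?_ (by positivity) (by positivity)
  · refine (Real.rpow_le_rpow h0 (le_add_of_nonneg_left zero_le_one) (by positivity)).trans ?_
    exact Real.rpow_le_rpow_of_exponent_le (by linarith) (by nlinarith)
  · rw [Real.rpow_def_of_pos hσ, Real.exp_le_exp]
    calc Real.log σ * (m * (1 - z.re)) ≤ |Real.log σ * (m * (1 - z.re))| := le_abs_self _
      _ = |m| * |Real.log σ| * (1 - z.re) := by
        rw [abs_mul, abs_mul, abs_of_nonneg (sub_nonneg.2 hz1)]; ring
      _ ≤ |m| * |Real.log σ| := mul_le_of_le_one_right (by positivity) (by linarith)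

lemma measurable_stein {X : Type*} [MeasurableSpace X] {σ : X → ℝ} (hσ : Measurable σ) {v : X → ℂ}
    (hv : Measurable v) (z : ℂ) : Measurable fun p => stein s ϑ m (σ p) z (v p) := by
  unfold stein
  refine Measurable.ite (hv (measurableSet_singleton 0)) measurable_const ?_
  fun_prop

end Stein

section PairingBound

variable {V : Type*} [NormedAddCommGroup V] [InnerProductSpace ℝ V] {e : V}
  [FiniteDimensional ℝ V] [MeasurableSpace V] [BorelSpace V] (he : ‖e‖ = 1)
include he

lemma wsq_le_of_norm_le {κ : ℝ} {u : V → ℂ} {K : Set V} (hK : IsCompact K) (hKc : K ⊆ cone e)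
    {H : V → ℝ} (hH : IntegrableOn (fun p => lor e p p ^ κ * H p ^ 2) K)
    (hu : ∀ p ∈ K, ‖u p‖ ≤ H p) (hu0 : ∀ p ∉ K, u p = 0) :
    wsq e κ u ≤ ENNReal.ofReal (∫ p in K, lor e p p ^ κ * H p ^ 2) := by
  have hpos : ∀ p ∈ K, 0 ≤ lor e p p ^ κ := fun p hp => by
    have := lor_pos he (hKc hp); positivity
  have hKm := hK.measurableSet
  rw [ofReal_integral_eq_lintegral_ofReal hH (ae_restrict_of_forall_mem hKm fun p hp =>
    mul_nonneg (hpos p hp) (sq_nonneg _)), wsq]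
  calc _ ≤ ∫⁻ p in cone e, K.indicator (fun p => ENNReal.ofReal (lor e p p ^ κ * H p ^ 2)) p := by
        refine lintegral_mono fun p => ?_
        by_cases hp : p ∈ K
        · rw [indicator_of_mem hp]
          have := hpos p hp
          have := hu p hp
          gcongr
        · simp [hu0 p hp, hp]
    _ = _ := by
        rw [lintegral_indicator hKm, Measure.restrict_restrict hKm, inter_eq_left.2 hKc]

lemma continuousOn_lor_rpow (c : ℝ) : ContinuousOn (fun p : V => lor e p p ^ c) (cone e) :=
  (continuous_lor e).continuousOn.rpow_const fun p hp => Or.inl (lor_pos he hp).ne'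

lemma continuous_weight_mul {F : V → ℂ} (hF : Continuous F) (hc : tsupport F ⊆ cone e) {c r d : ℝ}
    (hr : 0 < r) : Continuous fun p => (lor e p p ^ c * ‖F p‖) ^ r * lor e p p ^ d := by
  refine continuous_of_continuousOn_of_eq_zero (isOpen_cone e) (isClosed_tsupport F) hc ?_ ?_
  · exact (((continuousOn_lor_rpow he c).mul hF.norm.continuousOn).rpow_const
      fun _ _ => Or.inr hr.le).mul (continuousOn_lor_rpow he d)
  · intro p hp
    simp [image_eq_zero_of_notMem_tsupport hp, Real.zero_rpow hr.ne']

lemma RP_sub {F G : V → ℂ} (hF : Cls e F) (hG : Cls e G) (α : ℂ) (p : V) :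
    RP e α (fun p => F p - G p) p = RP e α F p - RP e α G p := by
  have hFG : Cls e fun p => F p - G p := by
    have := hF.add he (hG.const_mul (-1))
    simpa [sub_eq_add_neg] using this
  have := hFG.RP_sum he (s := Finset.univ) (H := ![F, G]) (fun i _ => by fin_cases i <;> assumption)
    ![1, -1] (fun p => by simp [sub_eq_add_neg]) α p
  simpa [sub_eq_add_neg] using this

lemma integrableOn_of_bounded {f : V → ℝ} (hf : Measurable f) {K : Set V} (hK : IsCompact K)
    {M : ℝ} (hM : ∀ p ∈ K, ‖f p‖ ≤ M) : IntegrableOn f K :=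
  Integrable.mono' (integrableOn_const hK.measure_lt_top.ne (C := M)) hf.aestronglyMeasurable
    (ae_restrict_of_forall_mem hK.measurableSet hM)

/-- Approximation of the pairing by that of a smooth step function. -/
lemma exists_pairing_approx {e₁ : V} (h1 : ‖e₁‖ = 1) (h0 : ⟪e, e₁⟫_ℝ = 0) {h : V → ℂ}
    (hh : Measurable h) {K K' : Set V} (hK : IsCompact K) (hKc : K ⊆ cone e) (hK' : IsCompact K')
    (hKc' : K' ⊆ cone e) {M : ℝ} (hM : ∀ p, ‖h p‖ ≤ M) (hhK : ∀ p ∉ K, h p = 0) :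
    ∃ C : ℝ, ∀ F G : V → ℂ, Cls e F → Cls e G → ∀ ω : ℝ, 0 ≤ ω → (∀ p, ‖F p - G p‖ ≤ ω) →
      (∀ p ∉ K', F p - G p = 0) →
      ‖∫ p, RP e 2 F p * h p‖ ≤ ‖∫ p, RP e 2 G p * h p‖ + C * ω := by
  obtain ⟨C₂, hC₂, hRP⟩ := exists_wsq_RP_le he h1 h0 (zero_lt_one : (0 : ℝ) < 1)
    (zero_le_two : (0 : ℝ) ≤ 2)
  have hM0 : 0 ≤ M := (norm_nonneg _).trans (hM 0)
  set W : ℝ := ∫ p in K, lor e p p ^ (2 : ℝ) * M ^ 2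
  set U : ℝ := ∫ p in K', lor e p p ^ (0 : ℝ)
  have hWi : IntegrableOn (fun p => lor e p p ^ (2 : ℝ) * M ^ 2) K :=
    (((continuousOn_lor_rpow he 2).mono hKc).mul continuousOn_const).integrableOn_compact hK
  have hW : wsq e 2 h ≤ ENNReal.ofReal W :=
    wsq_le_of_norm_le he hK hKc hWi (fun p _ => hM p) hhK
  have hW0 : 0 ≤ W := setIntegral_nonneg hK.measurableSet fun p hp => by
    have := lor_pos he (hKc hp); positivity
  have hU0 : 0 ≤ U := setIntegral_nonneg hK'.measurableSet fun p hp => by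
    have := lor_pos he (hKc' hp); positivity
  refine ⟨√(C₂ * U * W), fun F G hF hG ω hω hFG hFG0 => ?_⟩
  have hD : Cls e fun p => F p - G p := by
    have := hF.add he (hG.const_mul (-1))
    simpa [sub_eq_add_neg] using this
  have hcont : ∀ {F : V → ℂ}, Cls e F → Continuous (RP e 2 F) := fun hF =>
    ((hF.RP he 2).contDiff he).continuous
  have hintg : ∀ {F : V → ℂ}, Cls e F → Integrable fun p => RP e 2 F p * h p := by
    intro F hF
    obtain ⟨B, hB⟩ := hK.exists_bound_of_continuousOn (hcont hF).continuousOn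
    refine Integrable.mono' ((integrable_indicator_iff hK.measurableSet).2
      (integrableOn_const hK.measure_lt_top.ne (C := B * M)))
      ((hcont hF).measurable.mul hh).aestronglyMeasurable (.of_forall fun p => ?_)
    by_cases hp : p ∈ K
    · rw [indicator_of_mem hp, norm_mul]
      exact mul_le_mul (hB p hp) (hM p) (norm_nonneg _) ((norm_nonneg _).trans (hB p hp))
    · simp [hp, hhK p hp]
  have hsplit : ∫ p, RP e 2 F p * h p =
      (∫ p, RP e 2 G p * h p) + ∫ p, RP e 2 (fun p => F p - G p) p * h p := by
    rw [← integral_add (hintg hG) (hintg hD)]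
    congr 1; ext p
    rw [RP_sub he hF hG]; ring
  have hcs := enorm_integral_mul_sq_le he (-2) (hcont hD).measurable hh
    fun p hp => hhK p fun hk => hp (hKc hk)
  have h3 := hRP _ hD 0
  simp only [Complex.ofReal_zero, zero_mul, add_zero, abs_zero, mul_zero, Real.exp_zero, mul_one,
    zero_sub, Complex.ofReal_ofNat] at h3
  have h4 : wsq e 0 (fun p => F p - G p) ≤ ENNReal.ofReal (U * ω ^ 2) := by
    have := wsq_le_of_norm_le (κ := 0) (H := fun _ => ω) he hK' hKc'
      ((((continuousOn_lor_rpow he 0).mono hKc').mul continuousOn_const).integrableOn_compact hK')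
      (fun p _ => hFG p) hFG0
    rwa [integral_mul_const] at this
  have h5 : ‖∫ p, RP e 2 (fun p => F p - G p) p * h p‖ₑ ^ 2 ≤
      ENNReal.ofReal C₂ * ENNReal.ofReal (U * ω ^ 2) * ENNReal.ofReal W := by
    rw [neg_neg] at hcs
    exact hcs.trans (by gcongr; exact h3.trans (by gcongr))
  rw [← ofReal_norm, ← ENNReal.ofReal_pow (norm_nonneg _), ← ENNReal.ofReal_mul (by positivity),
    ← ENNReal.ofReal_mul (by positivity), ENNReal.ofReal_le_ofReal_iff (by positivity)] at h5
  rw [hsplit]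
  refine (norm_add_le _ _).trans (add_le_add_right ?_ _)
  refine (Real.le_sqrt_of_sq_le h5).trans_eq ?_
  rw [show C₂ * (U * ω ^ 2) * W = C₂ * U * W * ω ^ 2 by ring, Real.sqrt_mul (by positivity),
    Real.sqrt_sq hω]

end PairingBound

section PairingBound

variable {V : Type*} [NormedAddCommGroup V] [InnerProductSpace ℝ V] {e : V}
  [FiniteDimensional ℝ V] [MeasurableSpace V] [BorelSpace V]

/-- The dual form of the weighted estimate for the fundamental solution. -/
theorem exists_pairing_le (he : ‖e‖ = 1) {e₁ : V} (h1 : ‖e₁‖ = 1) (h0 : ⟪e, e₁⟫_ℝ = 0)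
    {κ α₀ ϑ s : ℝ} (hκ : κ < 1) (hα : 0 ≤ α₀) (hϑ0 : 0 ≤ ϑ) (hϑ1 : ϑ ≤ 1)
    (hα2 : (1 - ϑ) * α₀ + ϑ * Module.finrank ℝ V = 2) (hs : s * (1 + ϑ) = 2) :
    ∃ C : ℝ, 0 < C ∧ ∀ F : V → ℂ, ContDiff ℝ (⊤ : ℕ∞) F → HasCompactSupport F →
      tsupport F ⊆ cone e → ∀ h : V → ℂ, Measurable h → ∀ K : Set V, IsCompact K → K ⊆ cone e →
      ∀ M : ℝ, (∀ p, ‖h p‖ ≤ M) → (∀ p ∉ K, h p = 0) →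
      ‖∫ p, RP e 2 F p * h p‖ ≤
        C * ((∫ p in cone e, (lor e p p ^ (κ / 2 * (1 - ϑ)) * ‖F p‖) ^ s) *
          (∫ p in cone e, (lor e p p ^ (-((κ - α₀) / 2 * (1 - ϑ))) * ‖h p‖) ^ s)) ^
            ((1 + ϑ) / 2) := by
  obtain ⟨C, hC, hthree⟩ := exists_pairing_three_lines he h1 h0 hκ hα hϑ0 hϑ1 hα2 V
  refine ⟨C, hC, fun F hF hFc hFs h hh K hK hKc M hM hhK => ?_⟩
  have hs0 : 0 < s := by
    by_contra hcon
    nlinarith [not_lt.1 hcon]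
  have hM0 : 0 ≤ M := (norm_nonneg _).trans (hM 0)
  obtain ⟨r, hr, hrK⟩ := IsCompact.exists_cthickening_subset_open (s := tsupport F) hFc
    (isOpen_cone e) hFs
  have hK' : IsCompact (Metric.cthickening r (tsupport F)) := IsCompact.cthickening hFc
  set K' := Metric.cthickening r (tsupport F) with hK'def
  have hKK' : tsupport F ⊆ K' := Metric.self_subset_cthickening _
  set m : ℝ := -(κ / 2) with hm
  set m' : ℝ := (κ - α₀) / 2 with hm'
  set σ : V → ℝ := fun p => lor e p p with hσdef
  have hσ : ∀ {p}, p ∈ cone e → 0 < σ p := fun hp => lor_pos he hp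
  have hσm : Measurable σ := (continuous_lor e).measurable
  rw [show κ / 2 * (1 - ϑ) = -(m * (1 - ϑ)) by rw [hm]; ring]
  set c₀ : ℝ := -(m * (1 - ϑ)) with hc₀
  set c₁ : ℝ := -(m' * (1 - ϑ)) with hc₁
  set 𝒜 : ℝ := ∫ p in cone e, (σ p ^ c₀ * ‖F p‖) ^ s with h𝒜
  set ℬ : ℝ := ∫ p in cone e, (σ p ^ c₁ * ‖h p‖) ^ s with hℬ
  have h𝒜0 : 0 ≤ 𝒜 := setIntegral_nonneg (measurableSet_cone e) fun p hp => by
    have := hσ hp; positivity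
  have hℬ0 : 0 ≤ ℬ := setIntegral_nonneg (measurableSet_cone e) fun p hp => by
    have := hσ hp; positivity
  have hF0 : ∀ p ∉ tsupport F, F p = 0 := fun p hp => image_eq_zero_of_notMem_tsupport hp
  set G₀ : V → ℝ := fun p => (σ p ^ c₀ * ‖F p‖) ^ (s / 2) * σ p ^ m with hG₀
  set G₁ : V → ℝ := fun p => (σ p ^ c₀ * ‖F p‖) ^ s * σ p ^ (0 : ℝ) with hG₁
  have hG₀c : Continuous G₀ := continuous_weight_mul he hF.continuous hFs (by positivity)
  have hG₁c : Continuous G₁ := continuous_weight_mul he hF.continuous hFs hs0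
  have hG₀0 : ∀ p ∉ tsupport F, G₀ p = 0 := fun p hp => by
    have : s / 2 ≠ 0 := by positivity
    simp [hG₀, hF0 p hp, Real.zero_rpow this]
  have hG₁0 : ∀ p ∉ tsupport F, G₁ p = 0 := fun p hp => by
    simp [hG₁, hF0 p hp, Real.zero_rpow hs0.ne']
  have hG₀u := (HasCompactSupport.intro hFc hG₀0).uniformContinuous_of_continuous hG₀c
  have hG₁u := (HasCompactSupport.intro hFc hG₁0).uniformContinuous_of_continuous hG₁c
  have hFu := hFc.uniformContinuous_of_continuous hF.continuous
  have hwi : ∀ {u : V → ℝ}, Continuous u → IntegrableOn (fun p => σ p ^ κ * u p) K' := fun hu =>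
    (((continuousOn_lor_rpow he κ).mono hrK).mul hu.continuousOn).integrableOn_compact hK'
  set x₁ : ℝ := ∫ p in K', σ p ^ κ * (2 * G₀ p) with hx₁
  set x₂ : ℝ := ∫ p in K', σ p ^ κ * 1 with hx₂
  set y₁ : ℝ := ∫ p in K', (1 : ℝ) with hy₁
  have hx₀ : ∫ p in K', σ p ^ κ * G₀ p ^ 2 = 𝒜 := by
    rw [h𝒜, setIntegral_eq_of_subset_of_forall_sdiff_eq_zero (measurableSet_cone e) hrK]
    · refine setIntegral_congr_fun hK'.measurableSet fun p hp => ?_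
      have hp0 := hσ (hrK hp)
      simp only [hG₀]
      rw [mul_pow, ← Real.rpow_mul_natCast (by positivity), ← Real.rpow_mul_natCast hp0.le,
        mul_left_comm, ← Real.rpow_add hp0, hm]
      push_cast
      rw [show κ + -(κ / 2) * 2 = 0 by ring, Real.rpow_zero, mul_one]
      congr 1; ring
    · intro p hp
      rw [hF0 p fun h => hp.2 (hKK' h), norm_zero, mul_zero, Real.zero_rpow hs0.ne']
  have hy₀ : ∫ p in K', G₁ p = 𝒜 := by
    rw [h𝒜, setIntegral_eq_of_subset_of_forall_sdiff_eq_zero (measurableSet_cone e) hrK]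
    · simp [hG₁]
    · intro p hp
      rw [hF0 p fun h => hp.2 (hKK' h), norm_zero, mul_zero, Real.zero_rpow hs0.ne']
  obtain ⟨C', hC'⟩ := exists_pairing_approx he h1 h0 hh hK hKc hK' hrK hM hhK
  -- the dual family
  set g : ℂ → V → ℂ := fun z p => stein s ϑ m' (σ p) z (h p) with hg
  have hgm : ∀ z, Measurable (g z) := fun z => measurable_stein hσm hh z
  have hgK : ∀ z, ∀ p ∉ K, g z p = 0 := fun z p hp => by simp [hg, hhK p hp]
  obtain ⟨R₁, hR₁⟩ := hK.exists_bound_of_continuousOn ((continuousOn_lor_rpow he c₁).mono hKc)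
  obtain ⟨R₂, hR₂⟩ := hK.exists_bound_of_continuousOn (f := fun p => Real.log (σ p))
    ((continuous_lor e).continuousOn.log fun p hp => (hσ (hKc hp)).ne')
  have hb : ∀ p ∈ K, σ p ^ c₁ * ‖h p‖ ≤ R₁ * M := fun p hp =>
    mul_le_mul ((le_abs_self _).trans (hR₁ p hp)) (hM p) (norm_nonneg _)
      ((norm_nonneg _).trans (hR₁ p hp))
  have hgM : ∀ z : ℂ, 0 ≤ z.re → z.re ≤ 1 → ∀ p,
      ‖g z p‖ ≤ (1 + |R₁ * M|) ^ s * Real.exp (|m'| * R₂) := by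
    intro z hz0 hz1 p
    by_cases hp : p ∈ K
    · have hp0 := hσ (hKc hp)
      refine (norm_stein_le hs0 hp0 hz0 hz1 _).trans ?_
      have := (hb p hp).trans (le_abs_self _)
      have := hR₂ p hp
      rw [Real.norm_eq_abs] at this
      gcongr
    · rw [hgK z p hp, norm_zero]; positivity
  have hbm : Measurable fun p => (σ p ^ c₁ * ‖h p‖) ^ s :=
    ((hσm.pow_const _).mul hh.norm).pow_const _
  have hℬK : ∫ p in K, (σ p ^ c₁ * ‖h p‖) ^ s = ℬ := by
    rw [hℬ, setIntegral_eq_of_subset_of_forall_sdiff_eq_zero (measurableSet_cone e) hKc]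
    intro p hp
    rw [hhK p hp.2, norm_zero, mul_zero, Real.zero_rpow hs0.ne']
  have hbi : IntegrableOn (fun p => (σ p ^ c₁ * ‖h p‖) ^ s) K := by
    refine integrableOn_of_bounded he hbm hK (M := (R₁ * M) ^ s) fun p hp => ?_
    have hp0 := hσ (hKc hp)
    rw [Real.norm_of_nonneg (by positivity)]
    exact Real.rpow_le_rpow (by positivity) (hb p hp) hs0.le
  have hB0 : ∀ y : ℝ, wsq e (α₀ - κ) (g (y * Complex.I)) ≤ ENNReal.ofReal ℬ := by
    intro y
    have heq : ∀ p ∈ K, σ p ^ (α₀ - κ) * ((σ p ^ c₁ * ‖h p‖) ^ (s / 2) * σ p ^ m') ^ 2 =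
        (σ p ^ c₁ * ‖h p‖) ^ s := fun p hp => by
      have hp0 := hσ (hKc hp)
      rw [mul_pow, ← Real.rpow_mul_natCast (by positivity), ← Real.rpow_mul_natCast hp0.le,
        mul_left_comm, ← Real.rpow_add hp0, hm']
      push_cast
      rw [show α₀ - κ + (κ - α₀) / 2 * 2 = 0 by ring, Real.rpow_zero, mul_one]
      congr 1; ring
    have := wsq_le_of_norm_le (κ := α₀ - κ) (u := g (y * Complex.I))
      (H := fun p => (σ p ^ c₁ * ‖h p‖) ^ (s / 2) * σ p ^ m') he hK hKc
      (hbi.congr_fun (fun p hp => (heq p hp).symm) hK.measurableSet) (fun p hp => ?_)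
      (hgK _)
    · rwa [setIntegral_congr_fun hK.measurableSet heq, hℬK] at this
    · rw [hg]; simp only []
      rw [norm_stein hs0 (hσ (hKc hp)) (by simp)]
      simp [hc₁]
  have hB1 : ∀ y : ℝ, ∫ p, ‖g (1 + y * Complex.I) p‖ ≤ ℬ := by
    intro y
    rw [← hℬK, ← setIntegral_eq_integral_of_forall_compl_eq_zero (s := K)
      fun p hp => by rw [hgK _ p hp, norm_zero]]
    refine (setIntegral_congr_fun hK.measurableSet fun p hp => ?_).le
    rw [hg]; simp only []
    rw [norm_stein hs0 (hσ (hKc hp)) (by simp)]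
    have : s / 2 * (1 + 1) = s := by ring
    simp [hc₁, this]
  have key : ∀ ω : ℝ, 0 < ω → ‖∫ p, RP e 2 F p * h p‖ ≤
      C * (((𝒜 + ω * x₁ + ω ^ 2 * x₂) * ℬ) ^ ((1 - ϑ) / 2) * ((𝒜 + ω * y₁) * ℬ) ^ ϑ) + C' * ω := by
    intro ω hω
    obtain ⟨δ₀, hδ₀, hu₀⟩ := Metric.uniformContinuous_iff.1 hG₀u ω hω
    obtain ⟨δ₁, hδ₁, hu₁⟩ := Metric.uniformContinuous_iff.1 hG₁u ω hω
    obtain ⟨δ₂, hδ₂, hu₂⟩ := Metric.uniformContinuous_iff.1 hFu ω hω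
    set δ := min (min δ₀ δ₁) (min δ₂ r) with hδ
    have hδpos : 0 < δ := by positivity
    obtain ⟨t, χ, htK, hχs, hχ0, hχt, hχ1, hχK⟩ := exists_finite_partition (K := tsupport F) hFc hδpos
    have happ : ∀ {E : Type} [NormedAddCommGroup E] [NormedSpace ℝ E] {G : V → E}
        (_ : ∀ x y, dist x y < δ → dist (G x) (G y) < ω) (_ : ∀ p ∉ tsupport F, G p = 0) (p : V),
        ‖∑ i ∈ t, χ i p • G i - G p‖ ≤ ω := fun hG hG0 p =>
      norm_sum_partition_sub_le hχ0 hχt hχ1 hχK hω.le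
        (fun x y hxy => by rw [← dist_eq_norm]; exact (hG x y hxy).le) hG0 p
    have happ₀ := happ (G := G₀)
      (fun x y hxy => hu₀ (hxy.trans_le ((min_le_left _ _).trans (min_le_left _ _)))) hG₀0
    have happ₁ := happ (G := G₁)
      (fun x y hxy => hu₁ (hxy.trans_le ((min_le_left _ _).trans (min_le_right _ _)))) hG₁0
    have happ₂ := happ (G := F)
      (fun x y hxy => hu₂ (hxy.trans_le ((min_le_right _ _).trans (min_le_left _ _)))) hF0
    have hχK' : ∀ i ∈ t, tsupport (χ i) ⊆ K' := fun i hi => (hχt i hi).trans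
      ((Metric.ball_subset_ball ((min_le_right _ _).trans (min_le_right _ _))).trans
        (Metric.ball_subset_closedBall.trans (Metric.closedBall_subset_cthickening (htK i hi) r)))
    have hχ0' : ∀ i ∈ t, ∀ p ∉ K', χ i p = 0 := fun i hi p hp =>
      image_eq_zero_of_notMem_tsupport fun h => hp (hχK' i hi h)
    have hts : ∀ i, tsupport (fun p => (χ i p : ℂ)) = tsupport (χ i) := fun i => by
      simp only [tsupport]; congr 1; ext p; simp
    have hχc : ∀ i ∈ t, HasCompactSupport fun p => (χ i p : ℂ) := fun i hi =>
      HasCompactSupport.intro hK' fun p hp => by rw [hχ0' i hi p hp, Complex.ofReal_zero]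
    have hχsm : ∀ i, ContDiff ℝ (⊤ : ℕ∞) fun p => (χ i p : ℂ) := fun i =>
      Complex.ofRealCLM.contDiff.comp (hχs i)
    have hχCls : ∀ i ∈ t, Cls e fun p => (χ i p : ℂ) := fun i hi =>
      Cls.of_compact he (hχsm i) (hχc i hi) ((hts i).trans_subset ((hχK' i hi).trans hrK))
    set c : V → ℂ → ℂ := fun i z => stein s ϑ m (σ i) z (F i) with hc
    have hcϑ : ∀ i ∈ t, c i ϑ = F i := fun i hi => stein_self hs (hσ (hFs (htK i hi))) _
    have hc0 : ∀ i ∈ t, ∀ y : ℝ, ‖c i (y * Complex.I)‖ = G₀ i := fun i hi y => by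
      rw [hc]; simp only []
      rw [norm_stein hs0 (hσ (hFs (htK i hi))) (by simp)]
      simp [hG₀, hc₀]
    have hc1 : ∀ i ∈ t, ∀ y : ℝ, ‖c i (1 + y * Complex.I)‖ = G₁ i := fun i hi y => by
      rw [hc]; simp only []
      rw [norm_stein hs0 (hσ (hFs (htK i hi))) (by simp)]
      have : s / 2 * (1 + 1) = s := by ring
      simp [hG₁, hc₀, this]
    have hbound : ∀ {G : V → ℝ} {d : V → ℂ}, (∀ i ∈ t, ‖d i‖ = G i) →
        (∀ p, ‖∑ i ∈ t, χ i p • G i - G p‖ ≤ ω) → ∀ p, ‖∑ i ∈ t, d i * χ i p‖ ≤ G p + ω := by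
      intro G d hd hG p
      have h2 := (abs_le.1 (hG p)).2
      calc ‖∑ i ∈ t, d i * χ i p‖ ≤ ∑ i ∈ t, χ i p • G i := by
            refine norm_sum_le_of_le _ fun i hi => ?_
            rw [norm_mul, hd i hi, Complex.norm_real, Real.norm_of_nonneg (hχ0 i p), smul_eq_mul,
              mul_comm]
        _ ≤ _ := by linarith
    have hzero : ∀ (d : V → ℂ), ∀ p ∉ K', ∑ i ∈ t, d i * χ i p = 0 := fun d p hp =>
      Finset.sum_eq_zero fun i hi => by rw [hχ0' i hi p hp, Complex.ofReal_zero, mul_zero]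
    have hXY := hthree t (fun i p => (χ i p : ℂ)) hχCls
      (fun i hi => (hχsm i).continuous.integrable_of_hasCompactSupport (hχc i hi)) c
      (fun i => differentiable_stein _) (fun i => ?_) g (fun p => differentiable_stein _) hgm K hK hKc
      _ hgM hgK (𝒜 + ω * x₁ + ω ^ 2 * x₂) ℬ (𝒜 + ω * y₁) ?_ hℬ0 ?_ (fun y => ?_) hB0 (fun y => ?_) hB1
    · have hFδ : (fun p => ∑ i ∈ t, c i ϑ * (χ i p : ℂ)) = fun p => ∑ i ∈ t, χ i p • F i := by
        ext p
        refine Finset.sum_congr rfl fun i hi => ?_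
        rw [hcϑ i hi, Complex.real_smul, mul_comm]
      have hFδ0 : ∀ p ∉ K', F p - ∑ i ∈ t, c i ϑ * (χ i p : ℂ) = 0 := fun p hp => by
        rw [hzero _ p hp, hF0 p fun h => hp (hKK' h), sub_zero]
      have := hC' F (fun p => ∑ i ∈ t, c i ϑ * (χ i p : ℂ)) (Cls.of_compact he hF hFc hFs)
        (Cls.sum he t fun i hi => (hχCls i hi).const_mul _) ω hω.le
        (fun p => by rw [norm_sub_rev, congrFun hFδ p]; exact happ₂ p) hFδ0
      have hϑg : g ϑ = h := by
        ext p
        by_cases hp : p ∈ K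
        · exact stein_self hs (hσ (hKc hp)) _
        · rw [hgK _ p hp, hhK p hp]
      rw [hϑg] at hXY
      exact this.trans (add_le_add_left hXY _)
    · by_cases hi : i ∈ tsupport F
      · refine ⟨_, fun z hz0 hz1 => norm_stein_le hs0 (hσ (hFs hi)) hz0 hz1 _⟩
      · exact ⟨0, fun z _ _ => by simp [hc, hF0 i hi]⟩
    · have e1 : 0 ≤ x₁ := setIntegral_nonneg hK'.measurableSet fun p hp => by
        have := hσ (hrK hp); simp only [hG₀]; positivity
      have e2 : 0 ≤ x₂ := setIntegral_nonneg hK'.measurableSet fun p hp => by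
        have := hσ (hrK hp); positivity
      positivity
    · have e1 : 0 ≤ y₁ := setIntegral_nonneg hK'.measurableSet fun p hp => zero_le_one
      positivity
    · have hi : IntegrableOn (fun p => σ p ^ κ * (G₀ p + ω) ^ 2) K' := hwi (by fun_prop)
      have := wsq_le_of_norm_le he hK' hrK hi (fun p _ => hbound (fun i hi => hc0 i hi y) happ₀ p)
        (hzero _)
      refine this.trans_eq (congrArg _ ?_)
      rw [← hx₀, hx₁, hx₂, ← integral_const_mul, ← integral_const_mul, ← integral_add, ← integral_add]
      · congr 1; ext p; ring
      · exact (hwi (by fun_prop)).add ((hwi (by fun_prop)).const_mul _)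
      · exact (hwi (by fun_prop)).const_mul _
      · exact hwi (by fun_prop)
      · exact (hwi (by fun_prop)).const_mul _
    · rw [← setIntegral_eq_integral_of_forall_compl_eq_zero (s := K')
        fun p hp => by rw [hzero _ p hp, norm_zero]]
      have hi1 : IntegrableOn G₁ K' := hG₁c.continuousOn.integrableOn_compact hK'
      have hi2 : IntegrableOn (fun _ : V => (1 : ℝ)) K' :=
        continuousOn_const.integrableOn_compact hK'
      rw [← hy₀, hy₁, ← integral_const_mul, ← integral_add hi1 (hi2.const_mul _)]
      refine setIntegral_mono_on ?_ (hi1.add (hi2.const_mul _)) hK'.measurableSet fun p hp => ?_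
      · have : Continuous fun p => ‖∑ i ∈ t, c i (1 + y * Complex.I) * (χ i p : ℂ)‖ :=
          (continuous_finsetSum _ fun i _ => continuous_const.mul (hχsm i).continuous).norm
        exact this.continuousOn.integrableOn_compact hK'
      · rw [mul_one]
        exact hbound (fun i hi => hc1 i hi y) happ₁ p
  have hlim : Tendsto (fun ω : ℝ => C * (((𝒜 + ω * x₁ + ω ^ 2 * x₂) * ℬ) ^ ((1 - ϑ) / 2) *
      ((𝒜 + ω * y₁) * ℬ) ^ ϑ) + C' * ω) (𝓝[>] 0)
      (𝓝 (C * (((𝒜 + 0 * x₁ + 0 ^ 2 * x₂) * ℬ) ^ ((1 - ϑ) / 2) *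
      ((𝒜 + 0 * y₁) * ℬ) ^ ϑ) + C' * 0)) := by
    refine (Continuous.tendsto ?_ 0).mono_left nhdsWithin_le_nhds
    have e1 : Continuous fun ω : ℝ => ((𝒜 + ω * x₁ + ω ^ 2 * x₂) * ℬ) ^ ((1 - ϑ) / 2) :=
      Continuous.rpow_const (by fun_prop) fun _ => Or.inr (by linarith)
    have e2 : Continuous fun ω : ℝ => ((𝒜 + ω * y₁) * ℬ) ^ ϑ :=
      Continuous.rpow_const (by fun_prop) fun _ => Or.inr hϑ0
    fun_prop
  have := ge_of_tendsto hlim (eventually_nhdsWithin_of_forall fun ω hω => key ω hω)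
  refine this.trans_eq ?_
  rw [zero_mul, zero_mul, mul_zero, add_zero, add_zero, show (0 : ℝ) ^ 2 * x₂ = 0 by ring, add_zero,
    ← Real.rpow_add_of_nonneg (by positivity) (by linarith) hϑ0]
  congr 2; ring

end PairingBound

section Cutoff

variable {V : Type*} [NormedAddCommGroup V] [InnerProductSpace ℝ V] {e : V}

/-- A smooth cutoff equal to `1` up to time `T` and to `0` after time `T + 1`. -/
noncomputable def timeCutoff (e : V) (T : ℝ) (p : V) : ℝ :=
  Real.smoothTransition (T + 1 - ⟪e, p⟫_ℝ)

lemma contDiff_timeCutoff (T : ℝ) : ContDiff ℝ (⊤ : ℕ∞) (timeCutoff e T) := by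
  have h : ContDiff ℝ (⊤ : ℕ∞) fun p : V => T + 1 - ⟪e, p⟫_ℝ :=
    contDiff_const.sub (innerSL ℝ e).contDiff
  exact Real.smoothTransition.contDiff.comp h

lemma timeCutoff_eq_one {T : ℝ} {p : V} (hp : ⟪e, p⟫_ℝ ≤ T) : timeCutoff e T p = 1 :=
  Real.smoothTransition.one_of_one_le (by linarith)

lemma timeCutoff_eq_zero {T : ℝ} {p : V} (hp : T + 1 ≤ ⟪e, p⟫_ℝ) : timeCutoff e T p = 0 :=
  Real.smoothTransition.zero_of_nonpos (by linarith)

lemma timeCutoff_nonneg (T : ℝ) (p : V) : 0 ≤ timeCutoff e T p := Real.smoothTransition.nonneg _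

lemma timeCutoff_le_one (T : ℝ) (p : V) : timeCutoff e T p ≤ 1 := Real.smoothTransition.le_one _

/-- The part of the closed cone up to time `T`. -/
def truncCone (e : V) (T : ℝ) : Set V := {p | p ∈ ccone e ∧ ⟪e, p⟫_ℝ ≤ T}

lemma isClosed_truncCone (T : ℝ) : IsClosed (truncCone e T) :=
  (isClosed_ccone e).inter (isClosed_le (f := fun p : V => ⟪e, p⟫_ℝ) (by fun_prop) continuous_const)

lemma norm_le_of_mem_truncCone (he : ‖e‖ = 1) {T : ℝ} {p : V} (hp : p ∈ truncCone e T) :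
    ‖p‖ ≤ 2 * T := by
  obtain ⟨h1, h2⟩ := hp
  have h1 : ‖sp e p‖ ≤ ⟪e, p⟫_ℝ := h1
  have h3 := norm_sq_eq_sp he p
  have h4 := norm_nonneg (sp e p)
  nlinarith [norm_nonneg p]

lemma isCompact_truncCone [FiniteDimensional ℝ V] (he : ‖e‖ = 1) (T : ℝ) :
    IsCompact (truncCone e T) :=
  Metric.isCompact_of_isClosed_isBounded (isClosed_truncCone T)
    (Metric.isBounded_closedBall.subset fun _ hp =>
      mem_closedBall_zero_iff.2 (norm_le_of_mem_truncCone he hp))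

lemma mem_cone_of_sub_mem (he : ‖e‖ = 1) {ε : ℝ} (hε : 0 < ε) {p : V}
    (hp : p - ε • e ∈ ccone e) : p ∈ cone e := by
  have := add_mem_cone hp (smul_mem_cone hε (axis_mem_cone he))
  rwa [sub_add_cancel] at this

lemma mem_ccone_of_sub_mem (he : ‖e‖ = 1) {ε : ℝ} (hε : 0 ≤ ε) {p : V}
    (hp : p - ε • e ∈ ccone e) : p ∈ ccone e := by
  rcases hε.eq_or_lt with rfl | h
  · simpa using hp
  · exact cone_subset_ccone e (mem_cone_of_sub_mem he h hp)

variable {ε : ℝ} {u : V → ℂ}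

lemma tsupport_timeCutoff_mul_subset (he : ‖e‖ = 1) (hε : 0 < ε)
    (hu : ∀ p, u p ≠ 0 → p - ε • e ∈ ccone e) (T : ℝ) :
    tsupport (fun p => (timeCutoff e T p : ℂ) * u p) ⊆ {p | p - ε • e ∈ ccone e} ∩ truncCone e (T + 1) := by
  refine closure_minimal (fun p hp => ?_)
    (((isClosed_ccone e).preimage (by fun_prop)).inter (isClosed_truncCone _))
  have h1 := hu p (right_ne_zero_of_mul hp)
  refine ⟨h1, mem_ccone_of_sub_mem he hε.le h1, ?_⟩
  by_contra h2
  exact left_ne_zero_of_mul hp (by rw [timeCutoff_eq_zero (not_le.1 h2).le]; simp)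

lemma hasCompactSupport_timeCutoff_mul [FiniteDimensional ℝ V] (he : ‖e‖ = 1) (hε : 0 < ε)
    (hu : ∀ p, u p ≠ 0 → p - ε • e ∈ ccone e) (T : ℝ) :
    HasCompactSupport fun p => (timeCutoff e T p : ℂ) * u p :=
  (isCompact_truncCone he (T + 1)).of_isClosed_subset (isClosed_tsupport _)
    ((tsupport_timeCutoff_mul_subset he hε hu T).trans inter_subset_right)

lemma tsupport_timeCutoff_mul_subset_cone (he : ‖e‖ = 1) (hε : 0 < ε)
    (hu : ∀ p, u p ≠ 0 → p - ε • e ∈ ccone e) (T : ℝ) :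
    tsupport (fun p => (timeCutoff e T p : ℂ) * u p) ⊆ cone e := fun _ hp =>
  mem_cone_of_sub_mem he hε (tsupport_timeCutoff_mul_subset he hε hu T hp).1

lemma contDiff_timeCutoff_mul (hu : ContDiff ℝ (⊤ : ℕ∞) u) (T : ℝ) :
    ContDiff ℝ (⊤ : ℕ∞) fun p => (timeCutoff e T p : ℂ) * u p :=
  (Complex.ofRealCLM.contDiff.comp (contDiff_timeCutoff T)).mul hu

lemma norm_timeCutoff_mul_le (T : ℝ) (p : V) : ‖(timeCutoff e T p : ℂ) * u p‖ ≤ ‖u p‖ := by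
  rw [norm_mul, Complex.norm_real, Real.norm_of_nonneg (timeCutoff_nonneg T p)]
  exact mul_le_of_le_one_left (norm_nonneg _) (timeCutoff_le_one T p)

variable {ι : Type*} [Fintype ι]

lemma contDiff_box (b : OrthonormalBasis ι ℝ V) (hu : ContDiff ℝ (⊤ : ℕ∞) u) :
    ContDiff ℝ (⊤ : ℕ∞) (box e b u) := by
  have hu' : ContDiff ℝ (⊤ : ℕ∞) (fderiv ℝ u) := hu.fderiv_right (m := (⊤ : ℕ∞)) (by simp)
  unfold box
  refine ContDiff.sum fun i _ => ?_
  have : ContDiff ℝ (⊤ : ℕ∞) fun y => fderiv ℝ u y (refl e (b i)) := by fun_prop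
  exact (this.fderiv_right (m := (⊤ : ℕ∞)) (by simp)).clm_apply contDiff_const

lemma box_comp_sub (b : OrthonormalBasis ι ℝ V) (u : V → ℂ) (a p : V) :
    box e b (fun y => u (y - a)) p = box e b u (p - a) := by
  simp only [box, fderiv_comp_sub]
  refine Finset.sum_congr rfl fun i _ => ?_
  rw [fderiv_comp_sub (f := fun y => fderiv ℝ u y (refl e (b i)))]

lemma box_congr (b : OrthonormalBasis ι ℝ V) {v : V → ℂ} {p : V} (h : u =ᶠ[𝓝 p] v) :
    box e b u p = box e b v p := by
  refine Finset.sum_congr rfl fun i _ => ?_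
  have h2 : (fun y => fderiv ℝ u y (refl e (b i))) =ᶠ[𝓝 p] fun y => fderiv ℝ v y (refl e (b i)) := by
    filter_upwards [h.eventuallyEq_nhds] with y hy
    rw [hy.fderiv_eq]
  rw [h2.fderiv_eq]

lemma continuous_eq_zero_of_notMem_cone {f : V → ℂ} (hf : Continuous f)
    (hs : ∀ p, f p ≠ 0 → p ∈ ccone e) (he : ‖e‖ = 1) {p : V} (hp : p ∉ cone e) : f p = 0 := by
  have h1 : Tendsto (fun δ : ℝ => f (p - δ • e)) (𝓝[>] 0) (𝓝 (f p)) := by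
    have : Continuous fun δ : ℝ => f (p - δ • e) := by fun_prop
    simpa using (this.tendsto 0).mono_left nhdsWithin_le_nhds
  refine tendsto_nhds_unique h1 (tendsto_const_nhds.congr' ?_)
  filter_upwards [self_mem_nhdsWithin] with δ hδ
  by_contra h2
  exact hp (mem_cone_of_sub_mem he hδ (hs _ fun h => h2 h.symm))

/-- On times at most `T`, a function supported in the shifted cone is recovered from its truncated
d'Alembertian. -/
lemma RP_timeCutoff_box [FiniteDimensional ℝ V] [MeasurableSpace V] [BorelSpace V]
    (he : ‖e‖ = 1) (hε : 0 < ε) (b : OrthonormalBasis ι ℝ V) (hu : ContDiff ℝ (⊤ : ℕ∞) u)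
    (hs : ∀ p, u p ≠ 0 → p - ε • e ∈ ccone e) {T : ℝ} {p : V} (hp : ⟪e, p⟫_ℝ ≤ T) :
    RP e 2 (fun p => (timeCutoff e T p : ℂ) * box e b u p) p = u p := by
  have hF : Cls e fun p => (timeCutoff e T p : ℂ) * box e b u p :=
    Cls.of_compact he (contDiff_timeCutoff_mul (contDiff_box b hu) T)
      (hasCompactSupport_timeCutoff_mul he hε (box_supp b hs) T)
      (tsupport_timeCutoff_mul_subset_cone he hε (box_supp b hs) T)
  have hG : Cls e fun p => (timeCutoff e T p : ℂ) * u p :=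
    Cls.of_compact he (contDiff_timeCutoff_mul hu T) (hasCompactSupport_timeCutoff_mul he hε hs T)
      (tsupport_timeCutoff_mul_subset_cone he hε hs T)
  have h1 := RP_sub he hF (hG.box b) 2 p
  have hFG := hF.add he ((hG.box b).const_mul (-1))
  have h2 := hFG.RP_eq_zero he 2 (p := p) fun p' hp' => by
    have h3 : ⟪e, p - p'⟫_ℝ < T := by
      have := ((mem_cone_iff he).1 hp').1
      rw [inner_sub_right]; linarith
    have h4 : (fun p => (timeCutoff e T p : ℂ) * u p) =ᶠ[𝓝 (p - p')] u := by
      have : ∀ᶠ y in 𝓝 (p - p'), ⟪e, y⟫_ℝ < T :=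
        (isOpen_lt (by fun_prop) continuous_const).mem_nhds h3
      filter_upwards [this] with y hy
      rw [timeCutoff_eq_one hy.le]; simp
    rw [box_congr b h4, timeCutoff_eq_one h3.le]
    simp
  have h5 : RP e 2 (fun p => (timeCutoff e T p : ℂ) * box e b u p -
      box e b (fun p => (timeCutoff e T p : ℂ) * u p) p) p = 0 := by
    rw [← h2]
    congr 1
    funext p
    ring
  rw [h5, hG.RP_box he b p, timeCutoff_eq_one hp] at h1
  simpa using (sub_eq_zero.1 h1.symm)

end Cutoff

section Duality

variable {V : Type*} [NormedAddCommGroup V] [InnerProductSpace ℝ V] {e : V}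
  [FiniteDimensional ℝ V] [MeasurableSpace V] [BorelSpace V] {ι : Type*} [Fintype ι]

/-- The weighted estimate on compact sets for functions supported in a shifted cone. -/
lemma exists_shifted_bound (he : ‖e‖ = 1) {e₁ : V} (h1 : ‖e₁‖ = 1) (h0 : ⟪e, e₁⟫_ℝ = 0)
    (b : OrthonormalBasis ι ℝ V) {q s γ₁ γ₂ : ℝ} (hq : 2 ≤ q) (hs : 1 / q + 1 / s = 1)
    (hγq : γ₂ * q < 1) (hγ : γ₂ - γ₁ = 1 - (1 / 2 - 1 / q) * Module.finrank ℝ V)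
    (hγ' : 0 ≤ γ₂ - γ₁) :
    ∃ C : ℝ, 0 < C ∧ ∀ ε : ℝ, 0 < ε → ∀ u : V → ℂ, ContDiff ℝ (⊤ : ℕ∞) u →
      (∀ p, u p ≠ 0 → p - ε • e ∈ ccone e) → ∀ T : ℝ, ∀ K : Set V, IsCompact K → K ⊆ cone e →
      (∀ p ∈ K, ⟪e, p⟫_ℝ ≤ T) →
      (∫⁻ p in K, ENNReal.ofReal ((lor e p p ^ γ₁ * ‖u p‖) ^ q)) ^ (1 / q) ≤
        ENNReal.ofReal C * (∫⁻ p in cone e, ENNReal.ofReal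
          ((lor e p p ^ γ₂ * ‖(timeCutoff e T p : ℂ) * box e b u p‖) ^ s)) ^ (1 / s) := by
  have hq0 : 0 < q := by linarith
  have hs1 : 1 / s = 1 - 1 / q := by linarith
  have hqi : 1 / q ≤ 1 / 2 := one_div_le_one_div_of_le (by norm_num) hq
  have hs0 : 0 < s := one_div_pos.1 (by linarith)
  have hsq : (q - 1) * s = q := by field_simp at hs; linarith
  set N : ℝ := ((Module.finrank ℝ V : ℕ) : ℝ) with hN
  obtain ⟨C, hC, hpair⟩ := exists_pairing_le he h1 h0 (κ := γ₂ * q) (α₀ := (γ₂ - γ₁) * q)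
    (ϑ := 1 - 2 / q) (s := s) hγq (by positivity)
    (by have : 2 / q = 2 * (1 / q) := by ring
        linarith) (by have : 0 < 2 / q := by positivity
                      linarith)
    (by rw [← hN]; rw [hγ]; field_simp; ring) (by field_simp; linarith)
  have hw1 : γ₂ * q / 2 * (1 - (1 - 2 / q)) = γ₂ := by field_simp; ring
  have hw2 : -((γ₂ * q - (γ₂ - γ₁) * q) / 2 * (1 - (1 - 2 / q))) = -γ₁ := by field_simp; ring
  have hw3 : (1 + (1 - 2 / q)) / 2 = 1 / s := by rw [hs1]; ring
  simp only [hw1, hw2, hw3] at hpair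
  refine ⟨C, hC, fun ε hε u hu hus T K hK hKc hKT => ?_⟩
  set F : V → ℂ := fun p => (timeCutoff e T p : ℂ) * box e b u p with hFdef
  have hFc : ContDiff ℝ (⊤ : ℕ∞) F := contDiff_timeCutoff_mul (contDiff_box b hu) T
  have hFs : HasCompactSupport F := hasCompactSupport_timeCutoff_mul he hε (box_supp b hus) T
  have hFt : tsupport F ⊆ cone e := tsupport_timeCutoff_mul_subset_cone he hε (box_supp b hus) T
  set g : V → ℝ := fun p => (lor e p p ^ γ₁ * ‖u p‖) ^ q with hg
  have hgc : ContinuousOn g (cone e) :=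
    ((continuousOn_lor_rpow he γ₁).mul hu.continuous.norm.continuousOn).rpow_const
      fun _ _ => Or.inr hq0.le
  have hlor : ∀ p ∈ K, 0 < lor e p p := fun p hp => lor_pos he (hKc hp)
  have hg0 : ∀ p ∈ K, 0 ≤ g p := fun p hp => Real.rpow_nonneg
    (mul_nonneg (Real.rpow_nonneg (hlor p hp).le _) (norm_nonneg _)) _
  have hgi : IntegrableOn g K := (hgc.mono hKc).integrableOn_compact hK
  set A : ℝ := ∫ p in K, g p with hA
  have hA0 : 0 ≤ A := setIntegral_nonneg hK.measurableSet hg0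
  set B : ℝ := ∫ p in cone e, (lor e p p ^ γ₂ * ‖F p‖) ^ s with hB
  have hBn : ∀ p ∈ cone e, 0 ≤ (lor e p p ^ γ₂ * ‖F p‖) ^ s := fun p hp => Real.rpow_nonneg
    (mul_nonneg (Real.rpow_nonneg (lor_pos he hp).le _) (norm_nonneg _)) _
  have hB0 : 0 ≤ B := setIntegral_nonneg (isOpen_cone e).measurableSet hBn
  have hBc : Continuous fun p => (lor e p p ^ γ₂ * ‖F p‖) ^ s := by
    have := continuous_weight_mul he hFc.continuous hFt (c := γ₂) (d := 0) hs0
    simpa using this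
  have hBi : IntegrableOn (fun p => (lor e p p ^ γ₂ * ‖F p‖) ^ s) (cone e) := by
    refine (hBc.integrable_of_hasCompactSupport (hFs.mono fun p hp h => hp ?_)).integrableOn
    simp [h, Real.zero_rpow hs0.ne']
  -- the dual function
  set h : V → ℂ := K.indicator fun p =>
    ((lor e p p ^ (γ₁ * q) * ‖u p‖ ^ (q - 2) : ℝ) : ℂ) * (starRingEnd ℂ) (u p) with hh
  have hcont : ContinuousOn (fun p => ((lor e p p ^ (γ₁ * q) * ‖u p‖ ^ (q - 2) : ℝ) : ℂ) *
      (starRingEnd ℂ) (u p)) K := by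
    refine (Complex.continuous_ofReal.comp_continuousOn
      (((continuousOn_lor_rpow he _).mono hKc).mul
        (hu.continuous.norm.continuousOn.rpow_const fun _ _ => Or.inr (by linarith)))).mul ?_
    exact (Complex.continuous_conj.comp hu.continuous).continuousOn
  have hhm : Measurable h := by
    have h1 : Measurable fun p : V => ((lor e p p ^ (γ₁ * q) * ‖u p‖ ^ (q - 2) : ℝ) : ℂ) *
        (starRingEnd ℂ) (u p) := by
      have h2 := measurable_lor_rpow e (γ₁ * q)
      have h3 := hu.continuous.measurable
      exact (Complex.measurable_ofReal.comp (h2.mul (h3.norm.pow_const _))).mul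
        (Complex.continuous_conj.measurable.comp h3)
    exact h1.indicator hK.measurableSet
  obtain ⟨M, hM⟩ := hK.exists_bound_of_continuousOn hcont
  have hM' : ∀ p, ‖h p‖ ≤ max M 0 := fun p => by
    by_cases hp : p ∈ K
    · rw [hh, indicator_of_mem hp]; exact (hM p hp).trans (le_max_left _ _)
    · rw [hh, indicator_of_notMem hp]; simp
  have key := hpair F hFc hFs hFt h hhm K hK hKc (max M 0) hM' fun p hp => indicator_of_notMem hp _
  have hnorm : ∀ p ∈ K, ‖h p‖ = lor e p p ^ (γ₁ * q) * ‖u p‖ ^ (q - 1) := fun p hp => by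
    have hl := hlor p hp
    rw [hh, indicator_of_mem hp, norm_mul, Complex.norm_real, RCLike.norm_conj, Real.norm_of_nonneg
      (by positivity), mul_assoc]
    congr 1
    rcases (norm_nonneg (u p)).eq_or_lt with h0 | h0
    · rw [← h0, mul_zero, Real.zero_rpow (by linarith)]
    · rw [← Real.rpow_add_one h0.ne']; congr 1; ring
  have hlhs : ∫ p, RP e 2 F p * h p = (A : ℂ) := by
    have h2 : ∀ p, RP e 2 F p * h p = K.indicator (fun p => ((g p : ℝ) : ℂ)) p := fun p => by
      by_cases hp : p ∈ K
      · have hl := hlor p hp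
        rw [RP_timeCutoff_box he hε b hu hus (hKT p hp), indicator_of_mem hp, hh, indicator_of_mem hp,
          mul_left_comm, Complex.mul_conj, ← Complex.ofReal_mul, Complex.normSq_eq_norm_sq,
          show g p = (lor e p p ^ γ₁ * ‖u p‖) ^ q from rfl,
          Real.mul_rpow (by positivity) (norm_nonneg _), ← Real.rpow_mul hl.le, mul_assoc]
        congr 2
        rcases (norm_nonneg (u p)).eq_or_lt with h0 | h0
        · rw [← h0, Real.zero_rpow hq0.ne']; simp
        · rw [← Real.rpow_natCast, ← Real.rpow_add h0]; congr 1; push_cast; ring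
      · rw [hh, indicator_of_notMem hp, indicator_of_notMem hp, mul_zero]
    rw [integral_congr_ae (Eventually.of_forall h2), integral_indicator hK.measurableSet,
      integral_complex_ofReal]
  have hrhs : ∫ p in cone e, (lor e p p ^ (-γ₁) * ‖h p‖) ^ s = A := by
    have h2 : ∀ p, (lor e p p ^ (-γ₁) * ‖h p‖) ^ s = K.indicator g p := fun p => by
      by_cases hp : p ∈ K
      · have hl := hlor p hp
        rw [indicator_of_mem hp, hnorm p hp, ← mul_assoc, ← Real.rpow_add hl,
          show g p = (lor e p p ^ γ₁ * ‖u p‖) ^ q from rfl,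
          Real.mul_rpow (by positivity) (by positivity), ← Real.rpow_mul hl.le,
          ← Real.rpow_mul (norm_nonneg _), hsq,
          Real.mul_rpow (by positivity) (by positivity), ← Real.rpow_mul hl.le]
        congr 2
        linear_combination γ₁ * hsq
      · rw [hh, indicator_of_notMem hp, indicator_of_notMem hp, norm_zero, mul_zero,
          Real.zero_rpow hs0.ne']
    rw [integral_congr_ae (Eventually.of_forall h2), setIntegral_indicator hK.measurableSet,
      inter_eq_self_of_subset_right hKc]
  rw [hlhs, hrhs, Complex.norm_real, Real.norm_of_nonneg hA0, Real.mul_rpow hB0 hA0] at key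
  have hfin : A ^ (1 / q) ≤ C * B ^ (1 / s) := by
    rcases hA0.eq_or_lt with h0 | h0
    · rw [← h0, Real.zero_rpow (by positivity)]; positivity
    · have h3 : A = A ^ (1 / q) * A ^ (1 / s) := by
        rw [← Real.rpow_add h0, hs, Real.rpow_one]
      have h4 : 0 < A ^ (1 / s) := by positivity
      rw [← mul_assoc] at key
      nth_rw 1 [h3] at key
      exact le_of_mul_le_mul_right key h4
  rw [← ofReal_integral_eq_lintegral_ofReal hgi (ae_restrict_of_forall_mem hK.measurableSet hg0),
    ← ofReal_integral_eq_lintegral_ofReal hBi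
      (ae_restrict_of_forall_mem (isOpen_cone e).measurableSet hBn),
    ENNReal.ofReal_rpow_of_nonneg hA0 (by positivity),
    ENNReal.ofReal_rpow_of_nonneg hB0 (by positivity), ← ENNReal.ofReal_mul hC.le]
  exact ENNReal.ofReal_le_ofReal hfin

end Duality

section Limit

variable {V : Type*} [NormedAddCommGroup V] [InnerProductSpace ℝ V] {e : V}
  [FiniteDimensional ℝ V] [MeasurableSpace V] [BorelSpace V] {ι : Type*} [Fintype ι]

/-- The weighted `L^s` density of `f` on the cone. -/
noncomputable def coneDensity (e : V) (γ s : ℝ) (f : V → ℂ) (p : V) : ℝ≥0∞ :=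
  ENNReal.ofReal ((lor e p p ^ γ * ‖f p‖) ^ s)

lemma coneDensity_eq_zero {γ s : ℝ} (hs : 0 < s) {f : V → ℂ} {p : V} (hp : f p = 0) :
    coneDensity e γ s f p = 0 := by
  simp [coneDensity, hp, Real.zero_rpow hs.ne']

lemma coneDensity_mono (he : ‖e‖ = 1) {γ s : ℝ} (hs : 0 < s) {f g : V → ℂ} {p : V} (hp : p ∈ ccone e)
    (h : ‖f p‖ ≤ ‖g p‖) : coneDensity e γ s f p ≤ coneDensity e γ s g p := by
  have := ((mem_ccone_iff he).1 hp).2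
  unfold coneDensity
  gcongr

lemma measurable_coneDensity {γ s : ℝ} {f : V → ℂ} (hf : Continuous f) :
    Measurable (coneDensity e γ s f) :=
  (((measurable_lor_rpow e γ).mul hf.measurable.norm).pow_const s).ennreal_ofReal

lemma lor_sub_axis_le (he : ‖e‖ = 1) {ε : ℝ} (hε : 0 ≤ ε) {p : V} (hp : p - ε • e ∈ ccone e) :
    lor e (p - ε • e) (p - ε • e) ≤ lor e p p := by
  have h1 := ((mem_ccone_iff he).1 hp).1
  have h3 := inner_self_axis he
  have h4 : lor e (p - ε • e) (p - ε • e) = lor e p p - 2 * ε * ⟪e, p⟫_ℝ + ε ^ 2 := by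
    simp only [lor_sub_left, lor_sub_right, lor_smul_left, lor_smul_right, lor_axis he,
      lor_comm e p e, h3]; ring
  have h5 : ⟪e, p - ε • e⟫_ℝ = ⟪e, p⟫_ℝ - ε := by simp [inner_sub_right, inner_smul_right, h3, he]
  nlinarith

lemma lintegral_shift_le_of_nonpos (he : ‖e‖ = 1) {γ s : ℝ} (hγ : γ ≤ 0) (hs : 0 < s) {f : V → ℂ}
    (hf0 : ∀ p ∉ cone e, f p = 0) {ε : ℝ} (hε : 0 < ε) (T : ℝ) :
    ∫⁻ p in cone e, coneDensity e γ s (fun p => (timeCutoff e T p : ℂ) * f (p - ε • e)) p ≤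
      ∫⁻ p in cone e, coneDensity e γ s f p := by
  have hm := (isOpen_cone e).measurableSet
  rw [← lintegral_indicator hm, ← lintegral_indicator hm,
    ← lintegral_sub_right_eq_self ((cone e).indicator (coneDensity e γ s f)) (ε • e)]
  refine lintegral_mono fun p => indicator_apply_le' (fun hp => ?_) fun _ => zero_le
  by_cases h : p - ε • e ∈ cone e
  · rw [indicator_of_mem h]
    have h1 := lor_pos he h
    have h2 := lor_sub_axis_le he hε.le (cone_subset_ccone e h)
    refine (coneDensity_mono he hs (g := fun p => f (p - ε • e)) (cone_subset_ccone e hp)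
      (norm_timeCutoff_mul_le (u := fun p => f (p - ε • e)) T p)).trans ?_
    refine ENNReal.ofReal_le_ofReal ?_
    have h3 := Real.rpow_le_rpow_of_nonpos h1 h2 hγ
    have h4 := Real.rpow_nonneg (lor_pos he hp).le γ
    gcongr
  · exact (coneDensity_eq_zero hs (by simp [hf0 _ h])).trans_le zero_le

lemma exists_shift_tendsto_of_nonneg (he : ‖e‖ = 1) {γ s : ℝ} (hγ : 0 ≤ γ) (hs : 0 < s)
    {f : V → ℂ} (hf : Continuous f) (hf0 : ∀ p ∉ cone e, f p = 0) (T : ℝ) :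
    ∃ J : ℝ → ℝ≥0∞, Continuous J ∧ J 0 ≤ ∫⁻ p in cone e, coneDensity e γ s f p ∧
      ∀ ε, ∫⁻ p in cone e, coneDensity e γ s (fun p => (timeCutoff e T p : ℂ) * f (p - ε • e)) p ≤
        J ε := by
  have hm := (isOpen_cone e).measurableSet
  set K := truncCone e (T + 1) with hKdef
  have hK : IsCompact K := isCompact_truncCone he _
  set G : ℝ → V → ℝ := fun ε p =>
    (lor e p p ^ γ * ‖(timeCutoff e T p : ℂ) * f (p - ε • e)‖) ^ s with hG
  have hGc : Continuous (Function.uncurry G) := by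
    have h1 : Continuous fun x : ℝ × V => lor e x.2 x.2 ^ γ :=
      ((continuous_lor e).comp continuous_snd).rpow_const fun _ => Or.inr hγ
    have h2 : Continuous fun x : ℝ × V => (timeCutoff e T x.2 : ℂ) * f (x.2 - x.1 • e) := by
      have := (contDiff_timeCutoff (e := e) T).continuous
      fun_prop
    exact (h1.mul h2.norm).rpow_const fun _ => Or.inr hs.le
  have hG0 : ∀ ε, ∀ p ∈ K, 0 ≤ G ε p := fun ε p hp => Real.rpow_nonneg
    (mul_nonneg (Real.rpow_nonneg ((mem_ccone_iff he).1 hp.1).2 _) (norm_nonneg _)) _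
  have hGl : ∀ ε, ENNReal.ofReal (∫ p in K, G ε p) = ∫⁻ p in K, ENNReal.ofReal (G ε p) := fun ε =>
    ofReal_integral_eq_lintegral_ofReal
      ((hGc.comp (by fun_prop : Continuous fun p : V => (ε, p))).continuousOn.integrableOn_compact hK)
      (ae_restrict_of_forall_mem hK.measurableSet (hG0 ε))
  refine ⟨fun ε => ENNReal.ofReal (∫ p in K, G ε p), ?_, ?_, fun ε => ?_⟩
  · exact ENNReal.continuous_ofReal.comp (continuous_parametric_integral_of_continuous hGc hK)
  · simp only [hGl]
    rw [← lintegral_indicator hm, ← lintegral_indicator hK.measurableSet]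
    refine lintegral_mono fun p => indicator_apply_le' (fun hp => ?_) fun _ => zero_le
    by_cases h : p ∈ cone e
    · rw [indicator_of_mem h]
      have := coneDensity_mono he hs (γ := γ)
        (f := fun p => (timeCutoff e T p : ℂ) * f p) hp.1 (norm_timeCutoff_mul_le (e := e) (u := f) T p)
      simpa [hG, coneDensity] using this
    · simp [hG, hf0 p h, Real.zero_rpow hs.ne']
  · simp only [hGl]
    rw [← lintegral_indicator hm, ← lintegral_indicator hK.measurableSet]
    refine lintegral_mono fun p => indicator_apply_le' (fun hp => ?_) fun _ => zero_le
    by_cases h : p ∈ K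
    · rw [indicator_of_mem h]; rfl
    · have h2 : T + 1 ≤ ⟪e, p⟫_ℝ := by
        by_contra h3
        exact h ⟨cone_subset_ccone e hp, (not_le.1 h3).le⟩
      exact (coneDensity_eq_zero hs (by simp [timeCutoff_eq_zero h2])).trans_le zero_le

/-- The weighted Strichartz estimate in an inner product space with a chosen time axis. -/
theorem exists_lintegral_bound (he : ‖e‖ = 1) {e₁ : V} (h1 : ‖e₁‖ = 1) (h0 : ⟪e, e₁⟫_ℝ = 0)
    (b : OrthonormalBasis ι ℝ V) {q s γ₁ γ₂ : ℝ} (hq : 2 ≤ q) (hs : 1 / q + 1 / s = 1)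
    (hγq : γ₂ * q < 1) (hγ : γ₂ - γ₁ = 1 - (1 / 2 - 1 / q) * Module.finrank ℝ V)
    (hγ' : 0 ≤ γ₂ - γ₁) :
    ∃ C : ℝ, 0 < C ∧ ∀ w : V → ℂ, ContDiff ℝ (⊤ : ℕ∞) w → (∀ p, w p ≠ 0 → p ∈ ccone e) →
      (∫⁻ p in cone e, coneDensity e γ₁ q w p) ^ (1 / q) ≤
        ENNReal.ofReal C * (∫⁻ p in cone e, coneDensity e γ₂ s (box e b w) p) ^ (1 / s) := by
  obtain ⟨C, hC, hbd⟩ := exists_shifted_bound he h1 h0 b hq hs hγq hγ hγ'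
  refine ⟨C, hC, fun w hw hws => ?_⟩
  have hq0 : 0 < q := by linarith
  have hqi : 1 / q ≤ 1 / 2 := one_div_le_one_div_of_le (by norm_num) hq
  have hs0 : 0 < s := one_div_pos.1 (by linarith)
  set f := box e b w with hf
  have hfc : Continuous f := (contDiff_box b hw).continuous
  have hfs : ∀ p ∉ cone e, f p = 0 := fun p hp => continuous_eq_zero_of_notMem_cone hfc
    (fun p hp => by simpa using box_supp b (ε := 0) (fun p hp => by simpa using hws p hp) p hp) he hp
  set R := ∫⁻ p in cone e, coneDensity e γ₂ s f p with hR
  set ε : ℕ → ℝ := fun k => 1 / ((k : ℝ) + 1) with hε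
  have hε0 : ∀ k, 0 < ε k := fun k => by positivity
  have hεt : Tendsto ε atTop (𝓝 0) := tendsto_one_div_add_atTop_nhds_zero_nat
  -- the estimate on compact subsets of the cone
  have hcomp : ∀ K : Set V, IsCompact K → K ⊆ cone e →
      ∫⁻ p in K, coneDensity e γ₁ q w p ≤ (ENNReal.ofReal C * R ^ (1 / s)) ^ q := by
    intro K hK hKc
    obtain ⟨T, hT⟩ := hK.exists_bound_of_continuousOn (f := fun p => ⟪e, p⟫_ℝ) (by fun_prop)
    have hT' : ∀ p ∈ K, ⟪e, p⟫_ℝ ≤ T := fun p hp => (Real.le_norm_self _).trans (hT p hp)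
    obtain ⟨J, B, hJt, hB, hJ⟩ : ∃ (J : ℕ → ℝ≥0∞) (B : ℝ≥0∞), Tendsto J atTop (𝓝 B) ∧ B ≤ R ∧
        ∀ k, ∫⁻ p in cone e, coneDensity e γ₂ s
          (fun p => (timeCutoff e T p : ℂ) * f (p - ε k • e)) p ≤ J k := by
      rcases le_total γ₂ 0 with h | h
      · exact ⟨fun _ => R, R, tendsto_const_nhds, le_rfl, fun k =>
          lintegral_shift_le_of_nonpos he h hs0 hfs (hε0 k) T⟩
      · obtain ⟨J, hJc, hJ0, hJ⟩ := exists_shift_tendsto_of_nonneg he h hs0 hfc hfs T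
        exact ⟨fun k => J (ε k), J 0, (hJc.tendsto 0).comp hεt, hJ0, fun k => hJ _⟩
    have hk : ∀ k, ∫⁻ p in K, coneDensity e γ₁ q (fun p => w (p - ε k • e)) p ≤
        (ENNReal.ofReal C * J k ^ (1 / s)) ^ q := by
      intro k
      have h2 := hbd (ε k) (hε0 k) (fun p => w (p - ε k • e)) (by fun_prop)
        (fun p hp => hws _ hp) T K hK hKc hT'
      simp only [box_comp_sub] at h2
      have h3 : ENNReal.ofReal C * (∫⁻ p in cone e, ENNReal.ofReal ((lor e p p ^ γ₂ *
          ‖(timeCutoff e T p : ℂ) * box e b w (p - ε k • e)‖) ^ s)) ^ (1 / s) ≤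
          ENNReal.ofReal C * J k ^ (1 / s) := by
        have := hJ k
        unfold coneDensity at this
        have hs0' : 0 ≤ 1 / s := by positivity
        gcongr
      have h4 := h2.trans h3
      rw [one_div, ENNReal.rpow_inv_le_iff hq0] at h4
      exact h4
    have hlim : ∀ p, Tendsto (fun k => coneDensity e γ₁ q (fun p => w (p - ε k • e)) p) atTop
        (𝓝 (coneDensity e γ₁ q w p)) := by
      intro p
      have h2 : Continuous fun δ : ℝ =>
          ENNReal.ofReal ((lor e p p ^ γ₁ * ‖w (p - δ • e)‖) ^ q) := by
        have hwc := hw.continuous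
        have h3 : Continuous fun δ : ℝ => lor e p p ^ γ₁ * ‖w (p - δ • e)‖ := by fun_prop
        exact ENNReal.continuous_ofReal.comp (h3.rpow_const fun _ => Or.inr hq0.le)
      have := (h2.tendsto 0).comp hεt
      simpa [coneDensity, Function.comp_def] using this
    have hlimR : Tendsto (fun k => (ENNReal.ofReal C * J k ^ (1 / s)) ^ q) atTop
        (𝓝 ((ENNReal.ofReal C * B ^ (1 / s)) ^ q)) :=
      (ENNReal.Tendsto.const_mul (hJt.ennrpow_const _) (Or.inr ENNReal.ofReal_ne_top)).ennrpow_const _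
    calc ∫⁻ p in K, coneDensity e γ₁ q w p
        = ∫⁻ p in K, liminf (fun k => coneDensity e γ₁ q (fun p => w (p - ε k • e)) p) atTop := by
          simp only [(hlim _).liminf_eq]
      _ ≤ liminf (fun k => ∫⁻ p in K, coneDensity e γ₁ q (fun p => w (p - ε k • e)) p) atTop :=
          lintegral_liminf_le fun k => measurable_coneDensity
            (hw.continuous.comp (by fun_prop : Continuous fun p : V => p - ε k • e))
      _ ≤ liminf (fun k => (ENNReal.ofReal C * J k ^ (1 / s)) ^ q) atTop :=
          liminf_le_liminf (Eventually.of_forall hk)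
      _ = (ENNReal.ofReal C * B ^ (1 / s)) ^ q := hlimR.liminf_eq
      _ ≤ (ENNReal.ofReal C * R ^ (1 / s)) ^ q := by
          have hs0' : 0 ≤ 1 / s := by positivity
          gcongr
  set K : ℕ → Set V := fun m => {p | p - ε m • e ∈ ccone e} ∩ truncCone e m with hK
  have hKcpt : ∀ m, IsCompact (K m) := fun m =>
    (isCompact_truncCone he m).inter_left ((isClosed_ccone e).preimage (by fun_prop))
  have hKcone : ∀ m, K m ⊆ cone e := fun m p hp => mem_cone_of_sub_mem he (hε0 m) hp.1
  have hεanti : Antitone ε := fun m k hmk => by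
    have : (m : ℝ) ≤ k := by exact_mod_cast hmk
    exact one_div_le_one_div_of_le (by positivity) (by linarith)
  have hKmono : Monotone K := fun m k hmk p hp => by
    refine ⟨ccone_mono he (hεanti hmk) hp.1, hp.2.1, hp.2.2.trans ?_⟩
    exact_mod_cast hmk
  have hKU : ⋃ m, K m = cone e := by
    refine Subset.antisymm (iUnion_subset hKcone) fun p hp => ?_
    obtain ⟨δ, hδ, hδp⟩ := exists_supp_of_compact (isCompact_singleton (x := p))
      (singleton_subset_iff.2 hp) he
    obtain ⟨m, hm1, hm2⟩ := ((hεt.eventually (gt_mem_nhds hδ)).and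
      (tendsto_natCast_atTop_atTop.eventually_ge_atTop ⟪e, p⟫_ℝ)).exists
    exact mem_iUnion.2 ⟨m, ccone_mono he hm1.le (hδp p rfl), cone_subset_ccone e hp, hm2⟩
  rw [one_div, ENNReal.rpow_inv_le_iff hq0, ← hKU,
    setLIntegral_iUnion_of_directed _ hKmono.directed_le]
  exact iSup_le fun m => by simpa only [one_div] using hcomp _ (hKcpt m) (hKcone m)

end Limit

section Minkowski

variable (n : ℕ)

/-- Space-time with the Euclidean inner product. -/
abbrev SpaceTime : Type := WithLp 2 (ℝ × EuclideanSpace ℝ (Fin n))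

/-- The unit vector in the time direction. -/
noncomputable def timeAxis : SpaceTime n := WithLp.toLp 2 (1, 0)

variable {n}

lemma inner_timeAxis (p : SpaceTime n) : ⟪timeAxis n, p⟫_ℝ = p.ofLp.1 := by
  simp [timeAxis, WithLp.prod_inner_apply]

lemma norm_timeAxis : ‖timeAxis n‖ = 1 := by
  have h : ‖timeAxis n‖ ^ 2 = 1 := by
    rw [← real_inner_self_eq_norm_sq, inner_timeAxis]; rfl
  nlinarith [norm_nonneg (timeAxis n)]

lemma lor_timeAxis (p : SpaceTime n) :
    lor (timeAxis n) p p = p.ofLp.1 ^ 2 - ‖p.ofLp.2‖ ^ 2 := by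
  rw [lor, inner_timeAxis, WithLp.prod_inner_apply, real_inner_self_eq_norm_sq,
    real_inner_self_eq_norm_sq, Real.norm_eq_abs, sq_abs]
  ring

lemma mem_cone_timeAxis {p : SpaceTime n} :
    p ∈ cone (timeAxis n) ↔ ‖p.ofLp.2‖ < p.ofLp.1 := by
  rw [mem_cone_iff norm_timeAxis, inner_timeAxis, lor_timeAxis]
  have := norm_nonneg p.ofLp.2
  constructor
  · rintro ⟨h1, h2⟩; nlinarith
  · intro h; exact ⟨by linarith, by nlinarith⟩

lemma mem_ccone_timeAxis {p : SpaceTime n} :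
    p ∈ ccone (timeAxis n) ↔ ‖p.ofLp.2‖ ≤ p.ofLp.1 := by
  rw [mem_ccone_iff norm_timeAxis, inner_timeAxis, lor_timeAxis]
  have := norm_nonneg p.ofLp.2
  constructor
  · rintro ⟨h1, h2⟩; exact abs_le_of_sq_le_sq' (by linarith) h1 |>.2
  · intro h; exact ⟨by linarith, by nlinarith⟩

lemma fderiv_comp_ofLp {f : ℝ × EuclideanSpace ℝ (Fin n) → ℂ} (p v : SpaceTime n) :
    fderiv ℝ (fun y : SpaceTime n => f y.ofLp) p v = fderiv ℝ f p.ofLp v.ofLp := by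
  have := (WithLp.prodContinuousLinearEquiv 2 ℝ ℝ (EuclideanSpace ℝ (Fin n))).comp_right_fderiv
    (f := f) (x := p)
  exact congrArg (fun L : SpaceTime n →L[ℝ] ℂ => L v) this

lemma refl_timeAxis_time : refl (timeAxis n) (timeAxis n) = timeAxis n := by
  rw [refl, real_inner_self_eq_norm_sq, norm_timeAxis]; module

lemma refl_timeAxis_space (x : EuclideanSpace ℝ (Fin n)) :
    refl (timeAxis n) (WithLp.toLp 2 (0, x)) = -WithLp.toLp 2 (0, x) := by
  rw [refl, inner_timeAxis]; simp

/-- The standard orthonormal basis of space-time. -/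
noncomputable def spaceTimeBasis (n : ℕ) : OrthonormalBasis (Fin 1 ⊕ Fin n) ℝ (SpaceTime n) :=
  ((OrthonormalBasis.singleton (Fin 1) ℝ)).prod (EuclideanSpace.basisFun (Fin n) ℝ)

lemma box_comp_ofLp (w : ℝ × EuclideanSpace ℝ (Fin n) → ℂ) (p : SpaceTime n) :
    box (timeAxis n) (spaceTimeBasis n) (fun y => w y.ofLp) p =
      fderiv ℝ (fun y => fderiv ℝ w y ((1 : ℝ), 0)) p.ofLp ((1 : ℝ), 0)
        - ∑ j : Fin n, fderiv ℝ (fun y => fderiv ℝ w y (0, EuclideanSpace.single j 1)) p.ofLp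
          (0, EuclideanSpace.single j 1) := by
  have ht : ∀ i, spaceTimeBasis n (Sum.inl i) = timeAxis n := fun i =>
    (OrthonormalBasis.prod_apply _ _ _).trans (by simp [timeAxis])
  have hx : ∀ j, spaceTimeBasis n (Sum.inr j) = WithLp.toLp 2 (0, EuclideanSpace.single j 1) :=
    fun j =>
      (OrthonormalBasis.prod_apply _ _ _).trans (by simp)
  rw [box, Fintype.sum_sum_type, Fin.sum_univ_one, sub_eq_add_neg, ← Finset.sum_neg_distrib]
  simp only [ht, hx, refl_timeAxis_time, refl_timeAxis_space, map_neg, fderiv_comp_ofLp]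
  congr 1
  · exact fderiv_comp_ofLp (f := fun y => fderiv ℝ w y ((1 : ℝ), 0)) p (timeAxis n)
  · refine Finset.sum_congr rfl fun j _ => ?_
    have h := fderiv_comp_ofLp (f := fun y => fderiv ℝ w y (0, EuclideanSpace.single j 1)) p
      (WithLp.toLp 2 (0, EuclideanSpace.single j 1))
    rw [← h, ← neg_apply, ← fderiv_fun_neg]

lemma eLpNorm_lightCone {γ r : ℝ} (hr : 0 < r) (f : ℝ × EuclideanSpace ℝ (Fin n) → ℂ) :
    eLpNorm (fun p : ℝ × EuclideanSpace ℝ (Fin n) => ((p.1 ^ 2 - ‖p.2‖ ^ 2) ^ γ : ℝ) • f p)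
      (ENNReal.ofReal r)
      (volume.restrict {p : ℝ × EuclideanSpace ℝ (Fin n) | ‖p.2‖ < p.1}) =
    (∫⁻ p in cone (timeAxis n), coneDensity (timeAxis n) γ r (fun y => f y.ofLp) p) ^ (1 / r) := by
  have hS : MeasurableSet {p : ℝ × EuclideanSpace ℝ (Fin n) | ‖p.2‖ < p.1} :=
    (isOpen_lt (by fun_prop) (by fun_prop)).measurableSet
  have hpre : cone (timeAxis n) =
      WithLp.ofLp ⁻¹' {p : ℝ × EuclideanSpace ℝ (Fin n) | ‖p.2‖ < p.1} := by
    ext p; exact mem_cone_timeAxis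
  rw [eLpNorm_eq_lintegral_rpow_enorm_toReal (by simpa using hr) (by simp),
    ENNReal.toReal_ofReal hr.le, hpre]
  have hmp := WithLp.volume_preserving_ofLp ℝ (EuclideanSpace ℝ (Fin n))
  have hemb : MeasurableEmbedding (WithLp.ofLp : SpaceTime n → ℝ × EuclideanSpace ℝ (Fin n)) :=
    (WithLp.prodContinuousLinearEquiv 2 ℝ ℝ
      (EuclideanSpace ℝ (Fin n))).toHomeomorph.measurableEmbedding
  rw [← hmp.setLIntegral_comp_preimage_emb hemb]
  congr 1
  refine setLIntegral_congr_fun (hmp.measurable hS) fun p hp => ?_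
  have hl : 0 ≤ p.ofLp.1 ^ 2 - ‖p.ofLp.2‖ ^ 2 := by
    have h1 : ‖p.ofLp.2‖ < p.ofLp.1 := hp
    nlinarith [norm_nonneg p.ofLp.2]
  simp only [coneDensity, lor_timeAxis]
  rw [enorm_smul, Real.enorm_of_nonneg (Real.rpow_nonneg hl γ), ← ofReal_norm,
    ← ENNReal.ofReal_mul (by positivity), ENNReal.ofReal_rpow_of_nonneg (by positivity) hr.le]

end Minkowski
end LightCone

/-- Weighted Strichartz estimates of Georgiev–Lindblad–Sogge/Tataru: for `w` smooth and
supported in the (closed) forward light cone,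
`‖(t²-|x|²)^γ₁ w‖_{L^q(Λ)} ≤ C ‖(t²-|x|²)^γ₂ □w‖_{L^{q'}(Λ)}`,
where `Λ = {(t,x) : t > |x|}` and `□ = ∂_t² - Δ_x`. -/
theorem weighted_strichartz (n : ℕ) (hn : 2 ≤ n) (q q' γ₁ γ₂ : ℝ)
    (hq1 : 2 ≤ q) (hq2 : q ≤ 2 * ((n : ℝ) + 1) / ((n : ℝ) - 1))
    (hγ₁ : γ₁ < ((n : ℝ) - 1) / 2 - (n : ℝ) / q)
    (hγ₂ : γ₂ = γ₁ - ((n : ℝ) - 1) / 2 + ((n : ℝ) + 1) / q)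
    (hq' : 1 / q + 1 / q' = 1) :
    ∃ C : ℝ, 0 < C ∧ ∀ w : ℝ × EuclideanSpace ℝ (Fin n) → ℂ,
      ContDiff ℝ (⊤ : ℕ∞) w →
      (Function.support w ⊆ {p : ℝ × EuclideanSpace ℝ (Fin n) | ‖p.2‖ ≤ p.1}) →
      eLpNorm (fun p : ℝ × EuclideanSpace ℝ (Fin n) =>
          ((p.1 ^ 2 - ‖p.2‖ ^ 2) ^ γ₁ : ℝ) • w p) (ENNReal.ofReal q)
        (volume.restrict {p : ℝ × EuclideanSpace ℝ (Fin n) | ‖p.2‖ < p.1})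
      ≤ ENNReal.ofReal C *
        eLpNorm (fun p : ℝ × EuclideanSpace ℝ (Fin n) =>
          ((p.1 ^ 2 - ‖p.2‖ ^ 2) ^ γ₂ : ℝ) •
            (fderiv ℝ (fun y => fderiv ℝ w y ((1 : ℝ), 0)) p ((1 : ℝ), 0)
              - ∑ j : Fin n, fderiv ℝ (fun y => fderiv ℝ w y (0, EuclideanSpace.single j 1)) p
                  (0, EuclideanSpace.single j 1))) (ENNReal.ofReal q')
        (volume.restrict {p : ℝ × EuclideanSpace ℝ (Fin n) | ‖p.2‖ < p.1}) := by
  have hq0 : 0 < q := by linarith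
  have hqi : 1 / q ≤ 1 / 2 := one_div_le_one_div_of_le (by norm_num) hq1
  have hq'0 : 0 < q' := one_div_pos.1 (by linarith)
  have hn' : (2 : ℝ) ≤ n := by exact_mod_cast hn
  have hdim : ((Module.finrank ℝ (LightCone.SpaceTime n) : ℕ) : ℝ) = n + 1 := by
    have h : Module.finrank ℝ (LightCone.SpaceTime n) = 1 + n := by
      rw [Module.finrank_eq_card_basis (LightCone.spaceTimeBasis n).toBasis]; simp
    rw [h]; push_cast; ring
  have hγq : γ₂ * q < 1 := by
    have h : γ₂ < 1 / q := by
      have : ((n : ℝ) + 1) / q = n / q + 1 / q := by ring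
      linarith
    calc γ₂ * q < 1 / q * q := by gcongr
      _ = 1 := by field_simp
  have hγ : γ₂ - γ₁ = 1 - (1 / 2 - 1 / q) * Module.finrank ℝ (LightCone.SpaceTime n) := by
    rw [hdim, hγ₂]; ring
  have hγ' : 0 ≤ γ₂ - γ₁ := by
    rw [le_div_iff₀ (by linarith)] at hq2
    have h : ((n : ℝ) - 1) / 2 ≤ ((n : ℝ) + 1) / q := by
      rw [div_le_div_iff₀ (by norm_num) hq0]; linarith
    linarith
  set e₁ : LightCone.SpaceTime n := WithLp.toLp 2 (0, EuclideanSpace.single ⟨0, by omega⟩ 1) with he₁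
  have h1 : ‖e₁‖ = 1 := by
    have h : ‖e₁‖ ^ 2 = 1 := by
      rw [← real_inner_self_eq_norm_sq, WithLp.prod_inner_apply]
      simp [he₁]
    nlinarith [norm_nonneg e₁]
  obtain ⟨C, hC, hmain⟩ := LightCone.exists_lintegral_bound LightCone.norm_timeAxis h1
    (LightCone.inner_timeAxis _) (LightCone.spaceTimeBasis n) hq1 hq' hγq hγ hγ'
  refine ⟨C, hC, fun w hw hws => ?_⟩
  rw [LightCone.eLpNorm_lightCone hq0, LightCone.eLpNorm_lightCone hq'0]
  have hW : ContDiff ℝ (⊤ : ℕ∞) fun y : LightCone.SpaceTime n => w y.ofLp :=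
    hw.comp (WithLp.prodContinuousLinearEquiv 2 ℝ ℝ (EuclideanSpace ℝ (Fin n))).contDiff
  have h := hmain _ hW fun p hp => LightCone.mem_ccone_timeAxis.2 (hws hp)
  rwa [funext (LightCone.box_comp_ofLp w)] at h
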